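/- arXiv:1806.04538 — 2 statements merged into one kernel-verified Lean document; each statement's English description precedes it below -/
import Mathlib

section
/- Assume k is perfect, d ≥ 2, and let Ω ≠ R be a canonical ideal of A with I ⊆ Ω. Suppose R/Ω is locally regular on the punctured spectrum, i.e., for every prime ideal 𝔭 ≠ 𝔪 of R containing Ω, the local ring (R/Ω)_𝔭 is regular. If Ω^{[p]} : Ω ⊄ 𝔪^{[p]} + ((x_1 x_2 ⋯ x_n)^{p−1}), then A is strongly F-regular. -/
/-- `𝔞^{[q]}`: the ideal generated by the `q`-th powers of all elements of `𝔞`. -/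
def frobPow {R : Type} [CommRing R] (q : ℕ) (a : Ideal R) : Ideal R :=
  Ideal.span ((fun x => x ^ q) '' (a : Set R))

noncomputable def extModule (R : Type) [CommRing R] (e : ℕ) (M N : Type) [AddCommGroup M]
    [AddCommGroup N] [Module R M] [Module R N] : ModuleCat R :=
  ((Ext R (ModuleCat R) e).obj (Opposite.op (ModuleCat.of R M))).obj (ModuleCat.of R N)

/-- `Ω` is a canonical ideal of `A = R/I`: `I ⊆ Ω ⊆ R` and `Ω/I ≅ Ext_R^e(R/I, R)`,
where `e = n - d`. -/
def IsCanonicalIdeal (R : Type) [CommRing R] (e : ℕ) (I Ω : Ideal R) : Prop :=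
  I ≤ Ω ∧ Nonempty
    ((↥Ω ⧸ (Submodule.comap Ω.subtype (I : Submodule R R))) ≃ₗ[R] extModule R e (R ⧸ I) R)

def IsCohenMacaulayLocalOfDim (A : Type) [CommRing A] (m : Ideal A) (d : ℕ) : Prop :=
  ringKrullDim A = d ∧
    ∃ rs : List A, rs.length = d ∧ (∀ x ∈ rs, x ∈ m) ∧ RingTheory.Sequence.IsRegular A rs

/-- A regular local ring: a Noetherian ring with a unique maximal ideal which can be
generated by `dim` many elements. -/
def IsRegularLocalRing' (S : Type) [CommRing S] : Prop :=
  IsNoetherianRing S ∧ ∃ M : Ideal S, M.IsMaximal ∧ (∀ N : Ideal S, N.IsMaximal → N = M) ∧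
    ∃ s : Finset S, Ideal.span (s : Set S) = M ∧ (s.card : WithBot (WithTop ℕ)) = ringKrullDim S

/-- `A` is strongly `F`-regular. -/
def StronglyFRegular (p : ℕ) (A : Type) [CommRing A] : Prop :=
  ∀ c : A, (∀ P ∈ minimalPrimes A, c ∉ P) →
    ∃ (e : ℕ) (ψ : A →+ A), 1 ≤ e ∧ (∀ a x : A, ψ (a ^ p ^ e * x) = a * ψ x) ∧ ψ c = 1

section ExtComparison

open CategoryTheory Abelian

lemma CategoryTheory.ProjectiveResolution.extMk_eq_zero_iff_of_zero {C : Type*} [Category C]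
    [Abelian C] [HasExt C] {X Y : C} (P : ProjectiveResolution X) (f : P.complex.X 0 ⟶ Y)
    (hf : P.complex.d 1 0 ≫ f = 0) :
    P.extMk f 1 rfl hf = 0 ↔ f = 0 := by
  refine ⟨fun h ↦ ?_, fun h ↦ by subst h; simp⟩
  simp only [← P.extEquivCohomologyClass.apply_eq_iff_eq,
    ProjectiveResolution.extEquivCohomologyClass_extMk,
    ProjectiveResolution.extEquivCohomologyClass_zero,
    CochainComplex.HomComplex.CohomologyClass.mk_eq_zero_iff] at h
  rw [CochainComplex.HomComplex.Cocycle.toSingleMk_mem_coboundaries_iff _ _ _ _ _ 1 (by simp)] at h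
  obtain ⟨g, hg⟩ := h
  have h0 : P.cochainComplex.d (-((0 : ℕ) : ℤ)) 1 = 0 :=
    (P.cochainComplex.isZero_of_isStrictlyLE 0 1 (by simp)).eq_of_tgt _ _
  rw [h0, Limits.zero_comp] at hg
  rw [← cancel_epi (P.cochainComplexXIso (-((0 : ℕ) : ℤ)) 0 rfl).hom, ← hg, Limits.comp_zero]

lemma CategoryTheory.ProjectiveResolution.extMk_eq_zero_iff_exists_prev {C : Type*} [Category C]
    [Abelian C] [HasExt C] {X Y : C} (P : ProjectiveResolution X) (n : ℕ) (f : P.complex.X n ⟶ Y)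
    (hf : P.complex.d (n + 1) n ≫ f = 0) :
    (∃ g : P.complex.X ((ComplexShape.up ℕ).prev n) ⟶ Y, P.complex.d n _ ≫ g = f) ↔
      P.extMk f (n + 1) rfl hf = 0 := by
  cases n with
  | zero =>
    rw [P.extMk_eq_zero_iff_of_zero, P.complex.shape _ _ (by simp)]
    simp [eq_comm]
  | succ p =>
    rw [P.extMk_eq_zero_iff _ _ _ _ p rfl, (ComplexShape.up ℕ).prev_eq' (i := p + 1) (j := p) rfl]

variable {R : Type} [CommRing R]

/-- The class map from cocycles on a projective resolution to `Ext`, as a linear map. -/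
noncomputable def CategoryTheory.ProjectiveResolution.extMkLinear {X Y : ModuleCat.{0} R}
    (P : ProjectiveResolution X) (n : ℕ) :
    LinearMap.ker (Linear.leftComp R Y (P.complex.d (n + 1) n)) →ₗ[R] Abelian.Ext X Y n where
  toFun f := P.extMk f.1 (n + 1) rfl (LinearMap.mem_ker.mp f.2)
  map_add' f g := (P.add_extMk _ _ _ _ _ _).symm
  map_smul' r f := by
    refine Eq.trans ?_ ((P.extMk_comp_mk₀ f.1 (n + 1) rfl (LinearMap.mem_ker.mp f.2) (r • 𝟙 Y)).symm.trans
      (Ext.smul_eq_comp_mk₀ _ r).symm)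
    congr 1

lemma nonempty_ext_linearEquiv (X Y : ModuleCat.{0} R) (n : ℕ) :
    Nonempty ((((_root_.Ext R (ModuleCat R) n).obj (Opposite.op X)).obj Y) ≃ₗ[R]
      Abelian.Ext X Y n) := by
  let P := projectiveResolution X
  let K := P.complex.linearYonedaObj R Y
  have e₁ : (((_root_.Ext R (ModuleCat R) n).obj (Opposite.op X)).obj Y) ≃ₗ[R] K.homology n :=
    (P.isoExt n Y).toLinearEquiv
  have e₂ : K.homology n ≃ₗ[R] (K.sc' ((ComplexShape.up ℕ).prev n) n (n + 1)).moduleCatLeftHomologyData.H :=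
    (ShortComplex.homologyMapIso (K.isoSc' _ n (n + 1) rfl (by simp)) ≪≫
      (ShortComplex.moduleCatHomologyIso _)).toLinearEquiv
  have hs : Function.Surjective (P.extMkLinear (Y := Y) n) := fun α ↦ by
    obtain ⟨f, hf, rfl⟩ := P.extMk_surjective α (n + 1) rfl
    exact ⟨⟨f, LinearMap.mem_ker.mpr hf⟩, rfl⟩
  refine ⟨e₁ ≪≫ₗ e₂ ≪≫ₗ ?_ ≪≫ₗ (P.extMkLinear n).quotKerEquivOfSurjective hs⟩
  refine Submodule.quotEquivOfEq _ _ ?_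
  refine Submodule.ext fun f ↦ ?_
  have hf : P.complex.d (n + 1) n ≫ (f.1 : P.complex.X n ⟶ Y) = 0 := LinearMap.mem_ker.mp f.2
  have hr : f ∈ LinearMap.range (K.sc' ((ComplexShape.up ℕ).prev n) n (n + 1)).moduleCatToCycles ↔
      ∃ g : P.complex.X ((ComplexShape.up ℕ).prev n) ⟶ Y,
        P.complex.d n _ ≫ g = f.1 :=
    exists_congr fun g ↦ Subtype.ext_iff
  exact hr.trans (P.extMk_eq_zero_iff_exists_prev n f.1 hf)

end ExtComparison

section ExtPull

open CategoryTheory Abelian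

variable {R : Type} [CommRing R] {L M N : Type} [AddCommGroup L] [AddCommGroup M] [AddCommGroup N]
  [Module R L] [Module R M] [Module R N] {Y : ModuleCat.{0} R} {i : ℕ}

/-- Contravariant functoriality of `Ext` along a linear map. -/
noncomputable def extPull (Y : ModuleCat.{0} R) (i : ℕ) (u : M →ₗ[R] N) :
    Abelian.Ext (ModuleCat.of R N) Y i →ₗ[R] Abelian.Ext (ModuleCat.of R M) Y i where
  toFun ξ := (Ext.mk₀ (ModuleCat.ofHom u)).comp ξ (zero_add i)
  map_add' _ _ := by simp
  map_smul' _ _ := by simp [Ext.comp_smul]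

lemma extPull_apply (u : M →ₗ[R] N) (ξ : Abelian.Ext (ModuleCat.of R N) Y i) :
    extPull Y i u ξ = (Ext.mk₀ (ModuleCat.ofHom u)).comp ξ (zero_add i) := rfl

lemma extPull_comp (u : L →ₗ[R] M) (v : M →ₗ[R] N) (ξ : Abelian.Ext (ModuleCat.of R N) Y i) :
    extPull Y i (v ∘ₗ u) ξ = extPull Y i u (extPull Y i v ξ) := by
  simp [extPull_apply]

lemma extPull_id (ξ : Abelian.Ext (ModuleCat.of R N) Y i) :
    extPull Y i LinearMap.id ξ = ξ :=
  Ext.mk₀_id_comp ξ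

lemma extPull_add (u v : M →ₗ[R] N) (ξ : Abelian.Ext (ModuleCat.of R N) Y i) :
    extPull Y i (u + v) ξ = extPull Y i u ξ + extPull Y i v ξ := by
  simp [extPull_apply, ModuleCat.ofHom_add, Ext.mk₀_add]

lemma extPull_smul (r : R) (u : M →ₗ[R] N) (ξ : Abelian.Ext (ModuleCat.of R N) Y i) :
    extPull Y i (r • u) ξ = r • extPull Y i u ξ := by
  have : ModuleCat.ofHom (r • u) = r • ModuleCat.ofHom u := rfl
  simp [extPull_apply, this, Ext.mk₀_smul, Ext.smul_comp]

/-- `extPull` as a linear function of the map along which one pulls back. -/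
noncomputable def extPullFlip (ξ : Abelian.Ext (ModuleCat.of R N) Y i) :
    (M →ₗ[R] N) →ₗ[R] Abelian.Ext (ModuleCat.of R M) Y i where
  toFun u := extPull Y i u ξ
  map_add' u v := extPull_add u v ξ
  map_smul' r u := extPull_smul r u ξ

lemma exists_extPull_eq_of_extPull_ker_eq_zero {f : M →ₗ[R] N} (hf : Function.Surjective f)
    (ξ : Abelian.Ext (ModuleCat.of R M) Y i) (h : extPull Y i (LinearMap.ker f).subtype ξ = 0) :
    ∃ η, extPull Y i f η = ξ :=
  Ext.contravariant_sequence_exact₂ (LinearMap.shortExact_shortComplexKer hf) Y ξ h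

lemma extPull_injective {f : M →ₗ[R] N} (hf : Function.Surjective f)
    (h : ∀ j, j + 1 = i → Subsingleton (Abelian.Ext (ModuleCat.of R (LinearMap.ker f)) Y j)) :
    Function.Injective (extPull Y i f) := by
  cases i with
  | zero =>
    have : Epi (ModuleCat.ofHom f) := (ModuleCat.epi_iff_surjective _).mpr hf
    exact Ext.precomp_mk₀_injective_of_epi Y (ModuleCat.ofHom f)
  | succ j =>
    refine (injective_iff_map_eq_zero _).mpr fun ξ hξ ↦ ?_
    obtain ⟨η, rfl⟩ := Ext.contravariant_sequence_exact₃
      (LinearMap.shortExact_shortComplexKer hf) Y ξ hξ (n₀ := j) (add_comm 1 j)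
    have := h j rfl
    have h0 : η = 0 := Subsingleton.elim (α := Abelian.Ext (ModuleCat.of R (LinearMap.ker f)) Y j) _ _
    subst h0
    exact Ext.comp_zero ..

lemma extPull_ker_surjective {f : M →ₗ[R] N} (hf : Function.Surjective f)
    [Subsingleton (Abelian.Ext (ModuleCat.of R N) Y (i + 1))] :
    Function.Surjective (extPull Y i (LinearMap.ker f).subtype) := fun ξ ↦
  Ext.contravariant_sequence_exact₁ (LinearMap.shortExact_shortComplexKer hf) Y ξ
    (n₁ := i + 1) (add_comm 1 i)
    (Subsingleton.elim (α := Abelian.Ext (ModuleCat.of R N) Y (i + 1)) _ _)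

lemma sum_extPull_proj_single {ι : Type} [Fintype ι] [DecidableEq ι]
    (ξ : Abelian.Ext (ModuleCat.of R (ι → M)) Y i) :
    ∑ j, extPull Y i (LinearMap.proj j) (extPull Y i (LinearMap.single R (fun _ ↦ M) j) ξ) = ξ := by
  simp_rw [← extPull_comp]
  have := map_sum (extPullFlip (M := ι → M) ξ)
    (fun j ↦ LinearMap.single R (fun _ ↦ M) j ∘ₗ LinearMap.proj j) Finset.univ
  refine this.symm.trans ?_
  have h : ∑ j, LinearMap.single R (fun _ ↦ M) j ∘ₗ LinearMap.proj j =
      (LinearMap.id : (ι → M) →ₗ[R] (ι → M)) := by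
    ext; simp
  rw [h]
  exact extPull_id ξ

variable {I : Ideal R}

/-- The linear map `R ⧸ I → N` sending `1` to `x`, for `N` killed by `I`. -/
def quotEval (hN : ∀ a ∈ I, ∀ x : N, a • x = 0) : N →ₗ[R] (R ⧸ I) →ₗ[R] N where
  toFun x := I.liftQ (LinearMap.toSpanSingleton R N x) fun a ha ↦ by simpa using hN a ha x
  map_add' x y := by
    ext
    change (1 : R) • (x + y) = (1 : R) • x + (1 : R) • y
    simp
  map_smul' r x := by
    ext
    change (1 : R) • r • x = r • (1 : R) • x
    simp

lemma quotEval_one (hN : ∀ a ∈ I, ∀ x : N, a • x = 0) (x : N) : quotEval hN x 1 = x :=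
  one_smul R x

lemma linearMap_quot_ext {u v : (R ⧸ I) →ₗ[R] N} (h : u 1 = v 1) : u = v := by
  ext; exact h

lemma comp_quotEval (hM : ∀ a ∈ I, ∀ x : M, a • x = 0) (hN : ∀ a ∈ I, ∀ x : N, a • x = 0)
    (u : M →ₗ[R] N) (x : M) : u ∘ₗ quotEval hM x = quotEval hN (u x) := by
  apply linearMap_quot_ext
  rw [LinearMap.comp_apply, quotEval_one, quotEval_one]

lemma smul_quot_eq_zero : ∀ a ∈ I, ∀ x : R ⧸ I, a • x = 0 := fun a ha x ↦ by
  rw [Algebra.smul_def, Ideal.Quotient.algebraMap_eq, Ideal.Quotient.eq_zero_iff_mem.mpr ha,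
    zero_mul]

lemma smul_quot_pi_eq_zero (s : ℕ) : ∀ a ∈ I, ∀ x : Fin s → R ⧸ I, a • x = 0 :=
  fun a ha _ ↦ funext fun _ ↦ smul_quot_eq_zero a ha _

lemma proj_comp_quotEval_single (s : ℕ) (l : Fin s) :
    (LinearMap.proj l : (Fin s → R ⧸ I) →ₗ[R] R ⧸ I) ∘ₗ
      quotEval (smul_quot_pi_eq_zero s) (Pi.single l 1) = LinearMap.id := by
  rw [comp_quotEval _ smul_quot_eq_zero]
  apply linearMap_quot_ext
  rw [quotEval_one]
  simp

lemma proj_comp_quotEval_single_of_ne (s : ℕ) {l j : Fin s} (h : j ≠ l) :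
    (LinearMap.proj j : (Fin s → R ⧸ I) →ₗ[R] R ⧸ I) ∘ₗ
      quotEval (smul_quot_pi_eq_zero s) (Pi.single l 1) = 0 := by
  rw [comp_quotEval _ smul_quot_eq_zero]
  apply linearMap_quot_ext
  rw [quotEval_one]
  simp [h]

/-- The comparison map `Ext(N, Y) → Hom(N, Ext(R ⧸ I, Y))` for `N` killed by `I`. -/
noncomputable def extToHom (hN : ∀ a ∈ I, ∀ x : N, a • x = 0)
    (ξ : Abelian.Ext (ModuleCat.of R N) Y i) :
    N →ₗ[R] Abelian.Ext (ModuleCat.of R (R ⧸ I)) Y i :=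
  extPullFlip ξ ∘ₗ quotEval hN

lemma extToHom_apply (hN : ∀ a ∈ I, ∀ x : N, a • x = 0)
    (ξ : Abelian.Ext (ModuleCat.of R N) Y i) (x : N) :
    extToHom hN ξ x = extPull Y i (quotEval hN x) ξ := rfl

lemma extToHom_extPull (hM : ∀ a ∈ I, ∀ x : M, a • x = 0) (hN : ∀ a ∈ I, ∀ x : N, a • x = 0)
    (u : M →ₗ[R] N) (ξ : Abelian.Ext (ModuleCat.of R N) Y i) :
    extToHom hM (extPull Y i u ξ) = extToHom hN ξ ∘ₗ u := by
  ext x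
  rw [LinearMap.comp_apply, extToHom_apply, extToHom_apply, ← extPull_comp,
    comp_quotEval hM hN]

lemma extToHom_pi_injective (s : ℕ) (ξ : Abelian.Ext (ModuleCat.of R (Fin s → R ⧸ I)) Y i)
    (h : extToHom (smul_quot_pi_eq_zero s) ξ = 0) : ξ = 0 := by
  rw [← sum_extPull_proj_single ξ]
  refine Finset.sum_eq_zero fun j _ ↦ ?_
  have : LinearMap.single R (fun _ ↦ R ⧸ I) j =
      quotEval (smul_quot_pi_eq_zero s) (Pi.single j (1 : R ⧸ I)) :=
    linearMap_quot_ext (by simp [quotEval_one])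
  rw [this, ← extToHom_apply, h, LinearMap.zero_apply, map_zero]

lemma extToHom_pi_surjective (s : ℕ)
    (h : (Fin s → R ⧸ I) →ₗ[R] Abelian.Ext (ModuleCat.of R (R ⧸ I)) Y i) :
    ∃ ξ, extToHom (smul_quot_pi_eq_zero s) ξ = h := by
  refine ⟨∑ j, extPull Y i (LinearMap.proj j) (h (Pi.single j 1)), ?_⟩
  refine LinearMap.pi_ext' fun l ↦ linearMap_quot_ext ?_
  rw [LinearMap.comp_apply, LinearMap.comp_apply, extToHom_apply, map_sum,
    LinearMap.single_apply, Finset.sum_eq_single l]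
  · rw [← extPull_comp, proj_comp_quotEval_single, extPull_id]
  · intro j _ hj
    rw [← extPull_comp, proj_comp_quotEval_single_of_ne s hj]
    exact map_zero (extPullFlip _)
  · simp

lemma exists_pi_quot_surjective [Module.Finite R N] (hN : ∀ a ∈ I, ∀ x : N, a • x = 0) :
    ∃ (s : ℕ) (f : (Fin s → R ⧸ I) →ₗ[R] N), Function.Surjective f := by
  obtain ⟨s, g, hg⟩ := Module.Finite.exists_fin' R N
  refine ⟨s, ∑ j, quotEval hN (g (Pi.single j 1)) ∘ₗ LinearMap.proj j, fun x ↦ ?_⟩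
  obtain ⟨y, rfl⟩ := hg x
  refine ⟨fun j ↦ Ideal.Quotient.mk I (y j), ?_⟩
  have key (j : Fin s) : quotEval hN (g (Pi.single j 1)) (Ideal.Quotient.mk I (y j)) =
    y j • g (Pi.single j 1) := rfl
  simp only [LinearMap.sum_apply, LinearMap.comp_apply, LinearMap.proj_apply, key]
  simp_rw [← map_smul, ← map_sum]
  congr 1
  ext l
  simp [Finset.sum_apply, Pi.single_apply]

lemma subsingleton_ext_of_quot [IsNoetherianRing R] [Module.Finite R N]
    (hN : ∀ a ∈ I, ∀ x : N, a • x = 0) {c : ℕ}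
    (hI : ∀ j < c, Subsingleton (Abelian.Ext (ModuleCat.of R (R ⧸ I)) Y j)) (hi : i < c) :
    Subsingleton (Abelian.Ext (ModuleCat.of R N) Y i) := by
  induction i using Nat.strong_induction_on generalizing N with
  | _ i ih =>
  obtain ⟨s, f, hf⟩ := exists_pi_quot_surjective hN
  have : Subsingleton (Abelian.Ext (ModuleCat.of R (Fin s → R ⧸ I)) Y i) := by
    refine subsingleton_of_forall_eq 0 fun ξ ↦ ?_
    have := hI i hi
    rw [← sum_extPull_proj_single ξ]
    refine Finset.sum_eq_zero fun j _ ↦ ?_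
    rw [Subsingleton.elim (extPull Y i (LinearMap.single R (fun _ ↦ R ⧸ I) j) ξ) 0, map_zero]
  refine (extPull_injective (Y := Y) (i := i) hf fun j hj ↦ ?_).subsingleton
  exact ih j (by lia) (fun a ha x ↦ Subtype.ext (smul_quot_pi_eq_zero s a ha _)) (by lia)

lemma extToHom_injective [IsNoetherianRing R] [Module.Finite R N]
    (hN : ∀ a ∈ I, ∀ x : N, a • x = 0)
    (hI : ∀ j < i, Subsingleton (Abelian.Ext (ModuleCat.of R (R ⧸ I)) Y j))
    (ξ : Abelian.Ext (ModuleCat.of R N) Y i) (h : extToHom hN ξ = 0) : ξ = 0 := by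
  obtain ⟨s, f, hf⟩ := exists_pi_quot_surjective hN
  refine (injective_iff_map_eq_zero (extPull Y i f)).mp (extPull_injective hf fun j hj ↦ ?_) _ ?_
  · exact subsingleton_ext_of_quot
      (fun a ha x ↦ Subtype.ext (smul_quot_pi_eq_zero s a ha _)) hI (by lia)
  · apply extToHom_pi_injective
    rw [extToHom_extPull _ hN, h, LinearMap.zero_comp]

lemma extToHom_surjective [IsNoetherianRing R] [Module.Finite R N]
    (hN : ∀ a ∈ I, ∀ x : N, a • x = 0)
    (hI : ∀ j < i, Subsingleton (Abelian.Ext (ModuleCat.of R (R ⧸ I)) Y j))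
    (h : N →ₗ[R] Abelian.Ext (ModuleCat.of R (R ⧸ I)) Y i) :
    ∃ ξ, extToHom hN ξ = h := by
  obtain ⟨s, f, hf⟩ := exists_pi_quot_surjective hN
  obtain ⟨ξ, hξ⟩ := extToHom_pi_surjective s (h ∘ₗ f)
  have hK : ∀ a ∈ I, ∀ x : LinearMap.ker f, a • x = 0 := fun a ha x ↦
    Subtype.ext (smul_quot_pi_eq_zero s a ha _)
  obtain ⟨η, rfl⟩ := exists_extPull_eq_of_extPull_ker_eq_zero hf ξ <| by
    refine extToHom_injective hK hI _ ?_
    rw [extToHom_extPull hK (smul_quot_pi_eq_zero s), hξ]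
    ext x
    simp
  refine ⟨η, ?_⟩
  rw [extToHom_extPull _ hN] at hξ
  ext x
  obtain ⟨y, rfl⟩ := hf x
  exact LinearMap.congr_fun hξ y

/-- Maps to `Ext(R ⧸ I, Y)` extend from a kernel when the next `Ext` of the quotient vanishes. -/
lemma exists_extend_of_subsingleton_ext [IsNoetherianRing R] [Module.Finite R M]
    (hM : ∀ a ∈ I, ∀ x : M, a • x = 0)
    (hI : ∀ j < i, Subsingleton (Abelian.Ext (ModuleCat.of R (R ⧸ I)) Y j))
    {f : M →ₗ[R] N} (hf : Function.Surjective f)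
    [Subsingleton (Abelian.Ext (ModuleCat.of R N) Y (i + 1))]
    (h : LinearMap.ker f →ₗ[R] Abelian.Ext (ModuleCat.of R (R ⧸ I)) Y i) :
    ∃ g : M →ₗ[R] Abelian.Ext (ModuleCat.of R (R ⧸ I)) Y i,
      g ∘ₗ (LinearMap.ker f).subtype = h := by
  have hK : ∀ a ∈ I, ∀ x : LinearMap.ker f, a • x = 0 := fun a ha x ↦ Subtype.ext (hM a ha _)
  obtain ⟨ξ, rfl⟩ := extToHom_surjective hK hI h
  obtain ⟨η, rfl⟩ := extPull_ker_surjective hf ξ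
  exact ⟨extToHom hM η, (extToHom_extPull hK hM _ _).symm⟩

end ExtPull

section RegularSequences

open RingTheory.Sequence TensorProduct

open scoped Pointwise

variable {R : Type*} [CommRing R] {L M N : Type*} [AddCommGroup L] [AddCommGroup M]
  [AddCommGroup N] [Module R L] [Module R M] [Module R N]

lemma quotSMulTop_mk_eq_zero_iff (x : R) (m : M) :
    (Submodule.Quotient.mk m : QuotSMulTop x M) = 0 ↔ ∃ m', x • m' = m := by
  rw [Submodule.Quotient.mk_eq_zero, Submodule.mem_smul_pointwise_iff_exists]
  simp

lemma quotSMulTop_map_injective {f : L →ₗ[R] M} {g : M →ₗ[R] N} (hf : Function.Injective f)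
    (hfg : Function.Exact f g) {x : R} (hN : IsSMulRegular N x) :
    Function.Injective (QuotSMulTop.map x f) := by
  refine (injective_iff_map_eq_zero _).mpr fun l hl ↦ ?_
  obtain ⟨l, rfl⟩ := Submodule.Quotient.mk_surjective _ l
  obtain ⟨m, hm⟩ := (quotSMulTop_mk_eq_zero_iff x (f l)).mp hl
  have : g m = 0 := hN.right_eq_zero_of_smul (by rw [← map_smul, hm, hfg.apply_apply_eq_zero])
  obtain ⟨l', rfl⟩ := (hfg m).mp this
  exact (quotSMulTop_mk_eq_zero_iff x l).mpr ⟨l', hf (by rw [map_smul, hm])⟩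

lemma isWeaklyRegular_of_exact {f : L →ₗ[R] M} {g : M →ₗ[R] N} (hf : Function.Injective f)
    (hfg : Function.Exact f g) (hg : Function.Surjective g) {rs : List R}
    (hL : IsWeaklyRegular L rs) (hN : IsWeaklyRegular N rs) : IsWeaklyRegular M rs := by
  induction rs generalizing L M N with
  | nil => exact .nil R M
  | cons x xs ih =>
    rw [isWeaklyRegular_cons_iff] at hL hN ⊢
    refine ⟨isSMulRegular_of_range_eq_ker hf hfg.linearMap_ker_eq.symm hL.1 hN.1, ?_⟩
    exact ih (quotSMulTop_map_injective hf hfg hN.1) (QuotSMulTop.map_exact x hfg hg)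
      (QuotSMulTop.map_surjective x hg) hL.2 hN.2

lemma isWeaklyRegular_ker_of_exact {f : L →ₗ[R] M} {g : M →ₗ[R] N} (hf : Function.Injective f)
    (hfg : Function.Exact f g) (hg : Function.Surjective g) {rs : List R}
    (hM : IsWeaklyRegular M rs) (hN : IsWeaklyRegular N rs.dropLast) : IsWeaklyRegular L rs := by
  induction rs generalizing L M N with
  | nil => exact .nil R L
  | cons x xs ih =>
    rw [isWeaklyRegular_cons_iff] at hM ⊢
    refine ⟨hM.1.of_injective f hf, ?_⟩
    cases xs with
    | nil => exact .nil R _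
    | cons y ys =>
      rw [List.dropLast_cons_cons, isWeaklyRegular_cons_iff] at hN
      exact ih (quotSMulTop_map_injective hf hfg hN.1) (QuotSMulTop.map_exact x hfg hg)
        (QuotSMulTop.map_surjective x hg) hM.2 hN.2

lemma isWeaklyRegular_quotSMulTop_pow {x : R} {xs : List R} (hx : IsSMulRegular M x)
    (h : IsWeaklyRegular (QuotSMulTop x M) xs) (q : ℕ) :
    IsWeaklyRegular (QuotSMulTop (x ^ q) M) xs := by
  induction q with
  | zero =>
    have : Subsingleton (QuotSMulTop (x ^ 0) M) := subsingleton_of_forall_eq 0 fun y ↦ by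
      obtain ⟨y, rfl⟩ := Submodule.Quotient.mk_surjective _ y
      exact (quotSMulTop_mk_eq_zero_iff _ y).mpr ⟨y, by simp⟩
    refine ⟨fun i hi a b _ ↦ ?_⟩
    obtain ⟨a, rfl⟩ := Submodule.Quotient.mk_surjective _ a
    obtain ⟨b, rfl⟩ := Submodule.Quotient.mk_surjective _ b
    rw [Subsingleton.elim a b]
  | succ q ih =>
    let f : QuotSMulTop (x ^ q) M →ₗ[R] QuotSMulTop (x ^ (q + 1)) M :=
      Submodule.mapQ _ _ (LinearMap.lsmul R M x) fun m hm ↦ by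
        obtain ⟨m', -, rfl⟩ := (Submodule.mem_smul_pointwise_iff_exists _ _ _).mp hm
        rw [Submodule.mem_comap, Submodule.mem_smul_pointwise_iff_exists]
        exact ⟨m', trivial, by simp [pow_succ', mul_smul, smul_comm x]⟩
    let g : QuotSMulTop (x ^ (q + 1)) M →ₗ[R] QuotSMulTop x M :=
      Submodule.mapQ _ _ LinearMap.id fun m hm ↦ by
        obtain ⟨m', -, rfl⟩ := (Submodule.mem_smul_pointwise_iff_exists _ _ _).mp hm
        rw [Submodule.mem_comap, Submodule.mem_smul_pointwise_iff_exists]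
        exact ⟨x ^ q • m', trivial, by simp [pow_succ', mul_smul]⟩
    refine isWeaklyRegular_of_exact (f := f) (g := g) ?_ ?_ ?_ ih h
    · refine (injective_iff_map_eq_zero _).mpr fun l hl ↦ ?_
      obtain ⟨l, rfl⟩ := Submodule.Quotient.mk_surjective _ l
      obtain ⟨m, hm⟩ := (quotSMulTop_mk_eq_zero_iff _ (x • l)).mp hl
      refine (quotSMulTop_mk_eq_zero_iff _ l).mpr ⟨m, hx ?_⟩
      simpa [pow_succ', mul_smul] using hm
    · intro y
      obtain ⟨y, rfl⟩ := Submodule.Quotient.mk_surjective _ y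
      refine (quotSMulTop_mk_eq_zero_iff x y).trans ⟨?_, ?_⟩
      · rintro ⟨m, rfl⟩
        exact ⟨Submodule.Quotient.mk m, rfl⟩
      · rintro ⟨m, hm⟩
        obtain ⟨m, rfl⟩ := Submodule.Quotient.mk_surjective _ m
        have h1 : (Submodule.Quotient.mk (x • m - y) : QuotSMulTop (x ^ (q + 1)) M) = 0 :=
          (Submodule.Quotient.mk_sub _).trans (sub_eq_zero.mpr hm)
        obtain ⟨m', hm'⟩ := (quotSMulTop_mk_eq_zero_iff _ _).mp h1
        refine ⟨m - x ^ q • m', ?_⟩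
        rw [smul_sub, smul_smul, ← pow_succ', hm']
        abel
    · intro y
      obtain ⟨y, rfl⟩ := Submodule.Quotient.mk_surjective _ y
      exact ⟨Submodule.Quotient.mk y, rfl⟩

lemma isWeaklyRegular_map_pow {rs : List R} (h : IsWeaklyRegular M rs) (q : ℕ) :
    IsWeaklyRegular M (rs.map (· ^ q)) := by
  induction rs generalizing M with
  | nil => exact .nil R M
  | cons x xs ih =>
    rw [List.map_cons, isWeaklyRegular_cons_iff]
    rw [isWeaklyRegular_cons_iff] at h
    exact ⟨h.1.pow q, ih (isWeaklyRegular_quotSMulTop_pow h.1 h.2 q)⟩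

lemma rTensor_ofList_subtype_injective {rs : List R} (h : IsWeaklyRegular M rs) :
    Function.Injective ((Ideal.ofList rs).subtype.rTensor M) := by
  induction rs using List.reverseRecOn with
  | nil =>
    have : Subsingleton (Ideal.ofList ([] : List R)) := by
      rw [Ideal.ofList_nil]; infer_instance
    exact Function.injective_of_subsingleton _
  | append_singleton rs x ih =>
    rw [isWeaklyRegular_append_iff, isWeaklyRegular_singleton_iff] at h
    have hle : Ideal.ofList rs ≤ Ideal.ofList (rs ++ [x]) := by
      rw [Ideal.ofList_append]; exact le_sup_left
    have hx : x ∈ Ideal.ofList (rs ++ [x]) := by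
      rw [Ideal.ofList_append, Ideal.ofList_singleton]
      exact Ideal.mem_sup_right (Ideal.mem_span_singleton_self x)
    have hcomp : (Ideal.ofList (rs ++ [x])).subtype.rTensor M ∘ₗ
        (Submodule.inclusion hle).rTensor M = (Ideal.ofList rs).subtype.rTensor M := by
      rw [← LinearMap.rTensor_comp]; rfl
    have hdec (z : Ideal.ofList (rs ++ [x]) ⊗[R] M) : ∃ a m,
        z = (Submodule.inclusion hle).rTensor M a + (⟨x, hx⟩ : Ideal.ofList (rs ++ [x])) ⊗ₜ m := by
      induction z with
      | zero => exact ⟨0, 0, by simp⟩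
      | add z w hz hw =>
        obtain ⟨a, m, rfl⟩ := hz
        obtain ⟨b, m', rfl⟩ := hw
        exact ⟨a + b, m + m', by rw [map_add, tmul_add]; abel⟩
      | tmul j m =>
        obtain ⟨j, hj⟩ := j
        have hj' := hj
        rw [Ideal.ofList_append, Ideal.ofList_singleton] at hj'
        obtain ⟨a, ha, b, hb, rfl⟩ := Submodule.mem_sup.mp hj'
        obtain ⟨r, rfl⟩ := Ideal.mem_span_singleton'.mp hb
        refine ⟨⟨a, ha⟩ ⊗ₜ m, r • m, ?_⟩
        rw [LinearMap.rTensor_tmul, ← smul_tmul, ← add_tmul]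
        rfl
    have hrange (m : M) (hm : m ∈ Ideal.ofList rs • (⊤ : Submodule R M)) : ∃ a,
        (⟨x, hx⟩ : Ideal.ofList (rs ++ [x])) ⊗ₜ m = (Submodule.inclusion hle).rTensor M a := by
      induction hm using Submodule.smul_induction_on' with
      | smul j hj m _ =>
        refine ⟨⟨j, hj⟩ ⊗ₜ (x • m), ?_⟩
        rw [LinearMap.rTensor_tmul, ← smul_tmul, ← smul_tmul]
        congr 1
        exact Subtype.ext (mul_comm _ _)
      | add m _ m' _ h h' =>
        obtain ⟨a, ha⟩ := h
        obtain ⟨b, hb⟩ := h'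
        exact ⟨a + b, by rw [tmul_add, ha, hb, map_add]⟩
    have hmem (a : Ideal.ofList rs ⊗[R] M) :
        TensorProduct.lid R M ((Ideal.ofList rs).subtype.rTensor M a) ∈
          Ideal.ofList rs • (⊤ : Submodule R M) := by
      induction a with
      | zero => simp
      | add a b ha hb => rw [map_add, map_add]; exact add_mem ha hb
      | tmul j m => simpa using Submodule.smul_mem_smul j.2 (Submodule.mem_top (x := m))
    refine (injective_iff_map_eq_zero _).mpr fun z hz ↦ ?_
    obtain ⟨a, m, rfl⟩ := hdec z
    have h0 : TensorProduct.lid R M ((Ideal.ofList rs).subtype.rTensor M a) + x • m = 0 := by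
      rw [map_add, ← LinearMap.comp_apply, hcomp] at hz
      simpa using congrArg (TensorProduct.lid R M) hz
    have hm : m ∈ Ideal.ofList rs • (⊤ : Submodule R M) := by
      refine mem_of_isSMulRegular_quotient_of_smul_mem h.2 ?_
      rw [← neg_mem_iff, ← eq_neg_of_add_eq_zero_left h0]
      exact hmem a
    obtain ⟨b, hb⟩ := hrange m hm
    rw [hb, ← map_add] at hz ⊢
    rw [← LinearMap.comp_apply, hcomp] at hz
    rw [(injective_iff_map_eq_zero _).mp (ih h.1) _ hz, map_zero]

lemma free_of_isWeaklyRegular {R M : Type*} [CommRing R] [IsLocalRing R] [AddCommGroup M]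
    [Module R M] [Module.FinitePresentation R M] {rs : List R}
    (h : IsWeaklyRegular M rs) (hrs : Ideal.ofList rs = IsLocalRing.maximalIdeal R) :
    Module.Free R M := by
  have := rTensor_ofList_subtype_injective h
  rw [hrs] at this
  exact Module.free_of_maximalIdeal_rTensor_injective this

end RegularSequences

section ExtVanishing

open CategoryTheory Abelian RingTheory.Sequence IsLocalRing

open scoped Pointwise

variable {R : Type} [CommRing R] {L M N : Type} [AddCommGroup L] [AddCommGroup M] [AddCommGroup N]
  [Module R L] [Module R M] [Module R N]

lemma smul_ext_eq_zero_of_smul_eq_zero {r : R} (hr : ∀ x : N, r • x = 0) {Y : ModuleCat.{0} R}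
    {i : ℕ} (ξ : Abelian.Ext (ModuleCat.of R N) Y i) : r • ξ = 0 := by
  rw [← extPull_id ξ, ← extPull_smul, show r • (LinearMap.id : N →ₗ[R] N) = 0 by ext x; exact hr x]
  exact map_zero (extPullFlip ξ)

/-- Rees' lemma: `Ext` from a module killed by powers of a weakly regular sequence vanishes
below the length of the sequence. -/
lemma subsingleton_ext_of_isWeaklyRegular {xs : List R} (hL : IsWeaklyRegular L xs)
    (hN : ∀ x ∈ xs, ∃ t : ℕ, ∀ y : N, x ^ t • y = 0) {i : ℕ} (hi : i < xs.length) :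
    Subsingleton (Abelian.Ext (ModuleCat.of R N) (ModuleCat.of R L) i) := by
  induction xs generalizing L i with
  | nil => simp at hi
  | cons x xs ih =>
    rw [isWeaklyRegular_cons_iff] at hL
    have hinj : ∀ ξ : Abelian.Ext (ModuleCat.of R N) (ModuleCat.of R L) i, x • ξ = 0 → ξ = 0 := by
      intro ξ hξ
      have hS := IsSMulRegular.smulShortComplex_shortExact (M := ModuleCat.of R L) hL.1
      have hξ' : ξ.comp (Ext.mk₀ ((ModuleCat.of R L).smulShortComplex x).f) (add_zero i) = 0 :=
        (Ext.smul_eq_comp_mk₀ ξ x).symm.trans hξ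
      cases i with
      | zero =>
        have := hS.mono_f
        exact (injective_iff_map_eq_zero _).mp (Ext.postcomp_mk₀_injective_of_mono
          (ModuleCat.of R N) ((ModuleCat.of R L).smulShortComplex x).f) ξ hξ'
      | succ j =>
        obtain ⟨η, rfl⟩ := Ext.covariant_sequence_exact₁ _ hS ξ hξ' (n₀ := j) rfl
        have := ih hL.2 (fun y hy ↦ hN y (List.mem_cons_of_mem _ hy)) (i := j) (by simpa using hi)
        have h0 : η = 0 := Subsingleton.elim
          (α := Abelian.Ext (ModuleCat.of R N) (ModuleCat.of R (QuotSMulTop x L)) j) _ _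
        subst h0
        exact Ext.zero_comp ..
    obtain ⟨t, ht⟩ := hN x List.mem_cons_self
    refine subsingleton_of_forall_eq 0 fun ξ ↦ ?_
    have hpow : ∀ s : ℕ, x ^ s • ξ = 0 → ξ = 0 := fun s ↦ by
      induction s with
      | zero => simp
      | succ s ihs => exact fun h ↦ ihs (hinj _ (by rwa [smul_smul, ← pow_succ']))
    exact hpow t (smul_ext_eq_zero_of_smul_eq_zero ht ξ)

lemma subsingleton_ext_of_linearEquiv (f : N ≃ₗ[R] M) {Y : ModuleCat.{0} R} {i : ℕ}
    [Subsingleton (Abelian.Ext (ModuleCat.of R N) Y i)] :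
    Subsingleton (Abelian.Ext (ModuleCat.of R M) Y i) :=
  (extPull_injective (f := f.toLinearMap) f.surjective fun j hj ↦ by
    rw [LinearEquiv.ker]
    refine subsingleton_of_forall_eq 0 fun ξ ↦ ?_
    rw [← one_smul R ξ]
    exact smul_ext_eq_zero_of_smul_eq_zero (fun x ↦ Subsingleton.elim _ _) ξ).subsingleton

lemma subsingleton_ext_of_quotient [IsLocalRing R] [IsNoetherianRing R] [Module.Finite R M]
    [Module.Finite R L] {rs : List R} (hM : IsWeaklyRegular M rs)
    (hrs : ∀ x ∈ rs, x ∈ maximalIdeal R) {n : ℕ}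
    (h : ∀ i < n, Subsingleton (Abelian.Ext
      (ModuleCat.of R (M ⧸ Ideal.ofList rs • (⊤ : Submodule R M))) (ModuleCat.of R L) i))
    {i : ℕ} (hi : i < n - rs.length) :
    Subsingleton (Abelian.Ext (ModuleCat.of R M) (ModuleCat.of R L) i) := by
  induction rs generalizing M i with
  | nil =>
    have := h i (by simpa using hi)
    exact subsingleton_ext_of_linearEquiv (Submodule.quotEquivOfEqBot
      (Ideal.ofList ([] : List R) • (⊤ : Submodule R M))
      (by rw [Ideal.ofList_nil, Submodule.bot_smul]))
  | cons x xs ih =>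
    rw [isWeaklyRegular_cons_iff] at hM
    have hx := hrs x List.mem_cons_self
    have h' : ∀ i < n, Subsingleton (Abelian.Ext (ModuleCat.of R
        (QuotSMulTop x M ⧸ Ideal.ofList xs • (⊤ : Submodule R (QuotSMulTop x M))))
        (ModuleCat.of R L) i) := fun i hi ↦ by
      have := h i hi
      exact subsingleton_ext_of_linearEquiv
        (Submodule.quotOfListConsSMulTopEquivQuotSMulTopInner M x xs)
    have key : ∀ i < n - xs.length, Subsingleton (Abelian.Ext (ModuleCat.of R (QuotSMulTop x M))
        (ModuleCat.of R L) i) := fun i hi ↦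
      ih hM.2 (fun y hy ↦ hrs y (List.mem_cons_of_mem _ hy)) h' hi
    by_contra! hnt
    have hjac : x ∈ (Module.annihilator R
        (Abelian.Ext (ModuleCat.of R M) (ModuleCat.of R L) i)).jacobson :=
      (maximalIdeal_le_jacobson _) hx
    refine absurd ?_ (Submodule.top_ne_pointwise_smul_of_mem_jacobson_annihilator hjac)
    rw [eq_comm, eq_top_iff]
    intro ξ _
    have hS := IsSMulRegular.smulShortComplex_shortExact (M := ModuleCat.of R M) hM.1
    have hlen : i + 1 < n - xs.length := by rw [List.length_cons] at hi; lia
    have := key (i + 1) hlen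
    obtain ⟨η, hη⟩ : ∃ η : Abelian.Ext (ModuleCat.of R M) (ModuleCat.of R L) i,
        extPull (ModuleCat.of R L) i (x • (LinearMap.id : M →ₗ[R] M)) η = ξ :=
      Ext.contravariant_sequence_exact₁ hS (ModuleCat.of R L) ξ
        (n₁ := i + 1) (add_comm 1 i) (Subsingleton.elim
          (α := Abelian.Ext (ModuleCat.of R (QuotSMulTop x M)) (ModuleCat.of R L) (i + 1)) _ _)
    refine (Submodule.mem_smul_pointwise_iff_exists _ _ _).mpr ⟨η, trivial, ?_⟩
    rw [← hη, extPull_smul, extPull_id]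

lemma isWeaklyRegular_fin_fun {xs : List R} (h : IsWeaklyRegular R xs) (s : ℕ) :
    IsWeaklyRegular (Fin s → R) xs := by
  exact ((TensorProduct.rid R (Fin s → R)).isWeaklyRegular_congr xs).mp
    h.isWeaklyRegular_lTensor

lemma hasProjectiveDimensionLE_of_isWeaklyRegular [IsLocalRing R] [IsNoetherianRing R]
    {xs : List R} (hR : IsWeaklyRegular R xs) (hxs : Ideal.ofList xs = maximalIdeal R) (j : ℕ) :
    ∀ (M : Type) [AddCommGroup M] [Module R M] [Module.Finite R M],
      IsWeaklyRegular M (xs.take (xs.length - j)) →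
      HasProjectiveDimensionLE (ModuleCat.of R M) j := by
  induction j with
  | zero =>
    intro M _ _ _ hM
    rw [Nat.sub_zero, List.take_length] at hM
    have : Module.FinitePresentation R M := Module.finitePresentation_of_finite R M
    have := free_of_isWeaklyRegular hM hxs
    rw [← projective_iff_hasProjectiveDimensionLE_zero]
    exact (IsProjective.iff_projective M).mp inferInstance
  | succ j ih =>
    intro M _ _ _ hM
    obtain ⟨s, f, hf⟩ := Module.Finite.exists_fin' R M
    have hS := LinearMap.shortExact_shortComplexKer hf
    have hG : IsWeaklyRegular (Fin s → R) xs := isWeaklyRegular_fin_fun hR s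
    have h1 : HasProjectiveDimensionLE (ModuleCat.of R (LinearMap.ker f)) j := by
      refine ih _ (isWeaklyRegular_ker_of_exact (LinearMap.ker f).injective_subtype
        (LinearMap.exact_subtype_ker_map f) hf ?_ ?_)
      · rw [← List.take_append_drop (xs.length - j) xs, isWeaklyRegular_append_iff] at hG
        exact hG.1
      · rwa [List.dropLast_eq_take, List.length_take, List.take_take,
          show min (min (xs.length - j) xs.length - 1) (xs.length - j) = xs.length - (j + 1) by lia]
    have h2 : Projective (ModuleCat.of R (Fin s → R)) :=
      (IsProjective.iff_projective (Fin s → R)).mp inferInstance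
    exact hS.hasProjectiveDimensionLT_X₃ (j + 1) h1 
      (hasProjectiveDimensionLT_of_ge _ 1 (j + 2) (by lia))

end ExtVanishing

section FrobeniusTrace

open MvPowerSeries

variable {k : Type} [Field k] {p : ℕ} [ExpChar k p] {n e : ℕ}

/-- The exponent vector with entries `a i < q`. -/
noncomputable def digitExp {q : ℕ} (a : Fin n → Fin q) : Fin n →₀ ℕ :=
  Finsupp.equivFunOnFinite.symm fun i ↦ (a i : ℕ)

@[simp]
lemma digitExp_apply {q : ℕ} (a : Fin n → Fin q) (i : Fin n) : digitExp a i = a i := rfl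

lemma coeff_pow_expChar_smul (g : MvPowerSeries (Fin n) k) (m : Fin n →₀ ℕ) :
    coeff (p ^ e • m) (g ^ p ^ e) = coeff m g ^ p ^ e := by
  rw [← map_iterateFrobenius_expand p (expChar_ne_zero k p) g e, coeff_map, coeff_expand_smul,
    iterateFrobenius_def]

lemma coeff_pow_expChar_of_not_dvd (g : MvPowerSeries (Fin n) k) {m : Fin n →₀ ℕ} {i : Fin n}
    (h : ¬ p ^ e ∣ m i) : coeff m (g ^ p ^ e) = 0 := by
  rw [← map_iterateFrobenius_expand p (expChar_ne_zero k p) g e, coeff_map,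
    coeff_expand_of_not_dvd _ _ _ h, map_zero]

lemma coeff_sum_monomial_mul_pow (G : (Fin n → Fin (p ^ e)) → MvPowerSeries (Fin n) k)
    (a : Fin n → Fin (p ^ e)) (m : Fin n →₀ ℕ) :
    coeff (p ^ e • m + digitExp a) (∑ b, monomial (digitExp b) (1 : k) * G b ^ p ^ e) =
      coeff m (G a) ^ p ^ e := by
  rw [map_sum, Finset.sum_eq_single a]
  · rw [add_comm, coeff_add_monomial_mul, one_mul, coeff_pow_expChar_smul]
  · intro b _ hb
    rw [coeff_monomial_mul]
    split_ifs with h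
    · obtain ⟨i, hi⟩ : ∃ i, b i ≠ a i := by
        by_contra! hc
        exact hb (funext hc)
      rw [one_mul]
      refine coeff_pow_expChar_of_not_dvd (i := i) _ fun hd ↦ hi ?_
      have hbi := h i
      simp only [Finsupp.coe_add, Finsupp.coe_smul, Pi.add_apply, Pi.smul_apply, digitExp_apply,
        smul_eq_mul, Finsupp.coe_tsub, Pi.sub_apply] at hd hbi
      have h1 : (b i : ℕ) ≡ p ^ e * m i + a i [MOD p ^ e] := (Nat.modEq_iff_dvd' hbi).mpr hd
      have h2 : (b i : ℕ) ≡ a i [MOD p ^ e] := h1.trans (by simp [Nat.ModEq])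
      exact Fin.ext (h2.eq_of_lt_of_lt (b i).2 (a i).2)
    · rfl
  · simp

variable [PerfectRing k p]

/-- The coefficient of `f` along `x ^ a` in the basis of monomials over the `q`-th powers. -/
noncomputable def frobTrace (a : Fin n → Fin (p ^ e)) (f : MvPowerSeries (Fin n) k) :
    MvPowerSeries (Fin n) k :=
  fun m ↦ (iterateFrobeniusEquiv k p e).symm (coeff (p ^ e • m + digitExp a) f)

lemma coeff_frobTrace (a : Fin n → Fin (p ^ e)) (f : MvPowerSeries (Fin n) k) (m : Fin n →₀ ℕ) :
    coeff m (frobTrace a f) = (iterateFrobeniusEquiv k p e).symm (coeff (p ^ e • m + digitExp a) f) :=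
  rfl

lemma frobTrace_add (a : Fin n → Fin (p ^ e)) (f g : MvPowerSeries (Fin n) k) :
    frobTrace a (f + g) = frobTrace a f + frobTrace a g := by
  ext m
  simp [coeff_frobTrace]

lemma frobTrace_sum_monomial (G : (Fin n → Fin (p ^ e)) → MvPowerSeries (Fin n) k)
    (a : Fin n → Fin (p ^ e)) :
    frobTrace a (∑ b, monomial (digitExp b) (1 : k) * G b ^ p ^ e) = G a := by
  ext m
  rw [coeff_frobTrace, coeff_sum_monomial_mul_pow, ← iterateFrobeniusEquiv_def,
    RingEquiv.symm_apply_apply]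

lemma sum_frobTrace (p : ℕ) [ExpChar k p] [PerfectRing k p] (e : ℕ) (f : MvPowerSeries (Fin n) k) :
    ∑ b : Fin n → Fin (p ^ e), monomial (digitExp b) (1 : k) * frobTrace b f ^ p ^ e = f := by
  ext N
  have hq : 0 < p ^ e := pow_pos (expChar_pos k p) e
  have hN : N = p ^ e • N.mapRange (· / p ^ e) (Nat.zero_div _) +
      digitExp fun i ↦ ⟨N i % p ^ e, Nat.mod_lt _ hq⟩ := by
    ext i
    simp [Nat.div_add_mod]
  rw [hN, coeff_sum_monomial_mul_pow, coeff_frobTrace, ← iterateFrobeniusEquiv_def,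
    RingEquiv.apply_symm_apply]

lemma frobTrace_pow_mul (a : Fin n → Fin (p ^ e)) (g f : MvPowerSeries (Fin n) k) :
    frobTrace a (g ^ p ^ e * f) = g * frobTrace a f := by
  conv_lhs => rw [← sum_frobTrace p e f, Finset.mul_sum]
  rw [← frobTrace_sum_monomial (fun b ↦ g * frobTrace b f) a]
  congr 1
  exact Finset.sum_congr rfl fun b _ ↦ by ring

end FrobeniusTrace

section Splitting

/-- `c` is sent to `1` by some `p⁻ᵉ`-linear endomorphism of `A`. -/
def FSplits (p : ℕ) {A : Type} [CommRing A] (c : A) : Prop :=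
  ∃ (e : ℕ) (ψ : A →+ A), 1 ≤ e ∧ (∀ a x : A, ψ (a ^ p ^ e * x) = a * ψ x) ∧ ψ c = 1

variable {p : ℕ} {A : Type} [CommRing A]

lemma FSplits.of_map {r s : A} (hs : FSplits p s) {e : ℕ} (φ : A →+ A)
    (hφ : ∀ a x : A, φ (a ^ p ^ e * x) = a * φ x) (h : φ r = s) : FSplits p r := by
  obtain ⟨e', ψ, he, hψ, hψs⟩ := hs
  refine ⟨e + e', ψ.comp φ, by lia, fun a x ↦ ?_, by simp [h, hψs]⟩
  rw [AddMonoidHom.comp_apply, show a ^ p ^ (e + e') = (a ^ p ^ e') ^ p ^ e by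
    rw [← pow_mul, pow_add, mul_comm], hφ, hψ, AddMonoidHom.comp_apply]

lemma FSplits.of_mul_right {r s : A} (h : FSplits p (r * s)) : FSplits p r :=
  h.of_map (e := 0) (AddMonoidHom.mulRight s) (fun a x ↦ by simp [mul_assoc]) rfl

lemma FSplits.mul (hp : p ≠ 0) {r s : A} (hr : FSplits p r) (hs : FSplits p s) :
    FSplits p (r * s) := by
  obtain ⟨e, φ, he, hφ, hφr⟩ := hr
  have h : FSplits p (s ^ p ^ e * r) := hs.of_map φ hφ (by rw [hφ, hφr, mul_one])
  obtain ⟨m, hm⟩ := Nat.exists_eq_succ_of_ne_zero (pow_ne_zero e hp)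
  rw [hm, pow_succ, show s ^ m * s * r = r * s * s ^ m by ring] at h
  exact h.of_mul_right

lemma FSplits.of_add [IsLocalRing A] {r s : A} (h : FSplits p (r + s)) :
    FSplits p r ∨ FSplits p s := by
  obtain ⟨e, φ, he, hφ, h1⟩ := h
  have key : ∀ t, IsUnit (φ t) → FSplits p t := by
    rintro t ⟨u, hu⟩
    refine (FSplits.of_mul_right (s := (↑u⁻¹ : A) ^ p ^ e) ⟨e, φ, he, hφ, ?_⟩)
    rw [mul_comm, hφ, ← hu, Units.inv_mul]
  rw [map_add] at h1
  exact (IsLocalRing.isUnit_or_isUnit_of_add_one h1).imp (key r) (key s)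

lemma FSplits.eq_zero_of_mul_eq_zero (hp : p ≠ 0) {s c : A} (hs : FSplits p s) (h : s * c = 0) :
    c = 0 := by
  obtain ⟨e, φ, he, hφ, h1⟩ := hs
  rw [← mul_one c, ← h1, ← hφ]
  obtain ⟨m, hm⟩ := Nat.exists_eq_succ_of_ne_zero (pow_ne_zero e hp)
  rw [hm, pow_succ, mul_assoc, mul_comm c, h, mul_zero, map_zero]

/-- The prime ideal of elements which are not sent to `1` by any `p⁻ᵉ`-linear endomorphism. -/
def nonFSplitIdeal (p : ℕ) (A : Type) [CommRing A] [IsLocalRing A] : Ideal A where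
  carrier := {c | ¬ FSplits p c}
  zero_mem' := by
    rintro ⟨e, φ, -, -, h⟩
    simp at h
  add_mem' ha hb h := h.of_add.elim ha hb
  smul_mem' c x hx h := hx (FSplits.of_mul_right (s := c) (by rwa [mul_comm]))

@[simp]
lemma mem_nonFSplitIdeal [IsLocalRing A] {c : A} : c ∈ nonFSplitIdeal p A ↔ ¬ FSplits p c := Iff.rfl

lemma nonFSplitIdeal_isPrime [IsLocalRing A] (hp : p ≠ 0) {c : A} (hc : FSplits p c) :
    (nonFSplitIdeal p A).IsPrime where
  ne_top' h := by
    have : (1 : A) ∈ nonFSplitIdeal p A := h ▸ trivial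
    exact this (FSplits.of_mul_right (s := c) (by rwa [one_mul]))
  mem_or_mem' {x y} h := by
    by_contra! hc
    rw [mem_nonFSplitIdeal, mem_nonFSplitIdeal, not_not, not_not] at hc
    exact h (hc.1.mul hp hc.2)

end Splitting

section Twist

variable {R : Type} [CommRing R]

/-- The `R`-module obtained from `C` by restriction of scalars along an endomorphism of `R`. -/
def Twist (_F : R →+* R) (C : Type) : Type := C

variable (F : R →+* R) (C : Type) [AddCommGroup C] [Module R C]

instance : AddCommGroup (Twist F C) := inferInstanceAs (AddCommGroup C)

instance : Module R (Twist F C) := Module.compHom C F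

/-- The identity map, as an additive equivalence. -/
def toTwist : C ≃+ Twist F C := AddEquiv.refl C

variable {C}

lemma smul_toTwist (r : R) (x : C) : r • toTwist F C x = toTwist F C (F r • x) := rfl

lemma toTwist_symm_smul (r : R) (x : Twist F C) :
    (toTwist F C).symm (r • x) = F r • (toTwist F C).symm x := rfl

end Twist

section PowerSeries

open MvPowerSeries

variable {k : Type} [Field k] {p : ℕ} [ExpChar k p] {n : ℕ}

instance expChar_mvPowerSeries : ExpChar (MvPowerSeries (Fin n) k) p :=
  expChar_of_injective_algebraMap (algebraMap k (MvPowerSeries (Fin n) k)).injective p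

variable [PerfectRing k p]

instance finite_twist_quotient (e : ℕ) (J : Ideal (MvPowerSeries (Fin n) k)) :
    Module.Finite (MvPowerSeries (Fin n) k)
      (Twist (iterateFrobenius (MvPowerSeries (Fin n) k) p e) (MvPowerSeries (Fin n) k ⧸ J)) := by
  classical
  set F := iterateFrobenius (MvPowerSeries (Fin n) k) p e
  refine ⟨⟨Finset.univ.image fun b : Fin n → Fin (p ^ e) ↦
    toTwist F _ (Ideal.Quotient.mk J (monomial (digitExp b) (1 : k))), ?_⟩⟩
  rw [eq_top_iff]
  rintro x -
  obtain ⟨f, rfl⟩ : ∃ f, toTwist F _ (Ideal.Quotient.mk J f) = x := by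
    obtain ⟨y, rfl⟩ := (toTwist F _).surjective x
    obtain ⟨f, rfl⟩ := Ideal.Quotient.mk_surjective y
    exact ⟨f, rfl⟩
  rw [← sum_frobTrace p e f, map_sum, map_sum]
  refine Submodule.sum_mem _ fun b _ ↦ ?_
  have h : toTwist F _ (Ideal.Quotient.mk J (monomial (digitExp b) (1 : k) * frobTrace b f ^ p ^ e))
      = frobTrace b f • toTwist F _ (Ideal.Quotient.mk J (monomial (digitExp b) (1 : k))) := by
    rw [smul_toTwist, mul_comm]
    rfl
  rw [h]
  exact Submodule.smul_mem _ _ (Submodule.subset_span (by simp))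

lemma frobTrace_mem_of_mem_frobPow {e : ℕ} {J : Ideal (MvPowerSeries (Fin n) k)}
    {f : MvPowerSeries (Fin n) k} (hf : f ∈ frobPow (p ^ e) J) (a : Fin n → Fin (p ^ e)) :
    frobTrace a f ∈ J := by
  have hzero : frobTrace a (0 : MvPowerSeries (Fin n) k) = 0 := by
    ext m
    simp [coeff_frobTrace]
  refine Submodule.span_induction (p := fun y _ ↦ ∀ r, frobTrace a (r * y) ∈ J) ?_ ?_ ?_ ?_ hf 1
    |> fun h ↦ by simpa using h
  · rintro _ ⟨x, hx, rfl⟩ r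
    rw [mul_comm]
    change frobTrace a (x ^ p ^ e * r) ∈ J
    rw [frobTrace_pow_mul]
    exact J.mul_mem_right _ hx
  · intro r
    rw [mul_zero, hzero]
    exact J.zero_mem
  · intro x y _ _ hx hy r
    rw [mul_add, frobTrace_add]
    exact J.add_mem (hx r) (hy r)
  · intro c x _ hx r
    rw [smul_eq_mul, ← mul_assoc]
    exact hx _

lemma exists_fsplits_X (J : Ideal (MvPowerSeries (Fin n) k))
    (h : ¬ Submodule.colon (frobPow p J) J ≤
      frobPow p (IsLocalRing.maximalIdeal (MvPowerSeries (Fin n) k)) ⊔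
        Ideal.span {(∏ i : Fin n, MvPowerSeries.X i) ^ (p - 1)}) :
    ∃ j : Fin n, FSplits p (Ideal.Quotient.mk J (X j)) := by
  classical
  obtain ⟨f, hf, hfn⟩ := SetLike.not_le_iff_exists.mp h
  have hp := expChar_pos k p
  have hp1 : p ^ 1 = p := pow_one p
  obtain ⟨a, ha, hu⟩ : ∃ a : Fin n → Fin (p ^ 1), (∃ j, (a j : ℕ) + 1 < p ^ 1) ∧
      frobTrace a f ∉ IsLocalRing.maximalIdeal (MvPowerSeries (Fin n) k) := by
    by_contra! hc
    refine hfn ?_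
    rw [← sum_frobTrace p 1 f]
    refine Submodule.sum_mem _ fun b _ ↦ ?_
    by_cases hb : ∃ j, (b j : ℕ) + 1 < p ^ 1
    · refine Ideal.mem_sup_left (Ideal.mul_mem_left _ _ (Ideal.subset_span ⟨_, hc b hb, ?_⟩))
      simp
    · refine Ideal.mem_sup_right (Ideal.mul_mem_right _ _ (Ideal.mem_span_singleton.mpr ?_))
      have : monomial (digitExp b) (1 : k) = (∏ i : Fin n, X i) ^ (p - 1) := by
        rw [monomial_eq', map_one, one_mul, ← Finset.prod_pow, Finsupp.prod_fintype _ _ (by simp)]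
        refine Finset.prod_congr rfl fun i _ ↦ ?_
        push Not at hb
        have h1 := hb i
        have h2 := (b i).2
        rw [digitExp_apply]
        congr 1
        lia
      rw [this]
  obtain ⟨j, hj⟩ := ha
  rw [IsLocalRing.mem_maximalIdeal, mem_nonunits_iff, not_not] at hu
  obtain ⟨u, hu⟩ := hu
  set b : Fin n → Fin (p ^ 1) := Function.update a j ⟨a j + 1, hj⟩ with hb
  have hXf : frobTrace b (X j * f) = frobTrace a f := by
    ext m
    rw [coeff_frobTrace, coeff_frobTrace, X, show p ^ 1 • m + digitExp b =
      Finsupp.single j 1 + (p ^ 1 • m + digitExp a) from ?_, coeff_add_monomial_mul, one_mul]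
    ext i
    by_cases hij : i = j
    · subst hij
      simp [hb]
      ring
    · simp [hb, hij]
  let φ₀ : MvPowerSeries (Fin n) k →+ MvPowerSeries (Fin n) k ⧸ J :=
    { toFun := fun y ↦ Ideal.Quotient.mk J (↑u⁻¹ * frobTrace b (y * f))
      map_zero' := by
        rw [zero_mul, Ideal.Quotient.eq_zero_iff_mem]
        exact J.mul_mem_left _ (frobTrace_mem_of_mem_frobPow (Submodule.zero_mem _) b)
      map_add' := fun x y ↦ by rw [add_mul, frobTrace_add, mul_add, map_add] }
  have hφ₀ : ∀ y ∈ J, φ₀ y = 0 := fun y hy ↦ by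
    refine Ideal.Quotient.eq_zero_iff_mem.mpr (J.mul_mem_left _ (frobTrace_mem_of_mem_frobPow ?_ b))
    rw [pow_one, mul_comm]
    exact Submodule.mem_colon.mp hf y hy
  refine ⟨j, 1, QuotientAddGroup.lift _ φ₀ hφ₀, le_rfl, fun x y ↦ ?_, ?_⟩
  · obtain ⟨x, rfl⟩ := Ideal.Quotient.mk_surjective x
    obtain ⟨y, rfl⟩ := Ideal.Quotient.mk_surjective y
    change φ₀ (x ^ p ^ 1 * y) = Ideal.Quotient.mk J x * φ₀ y
    change Ideal.Quotient.mk J _ = Ideal.Quotient.mk J x * Ideal.Quotient.mk J _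
    rw [← map_mul, mul_assoc, frobTrace_pow_mul, mul_left_comm]
  · change φ₀ (X j) = 1
    change Ideal.Quotient.mk J _ = 1
    rw [hXf, ← hu, Units.inv_mul, map_one]

end PowerSeries

section PowerSeriesRegular

open MvPowerSeries RingTheory.Sequence

variable {k : Type} [Field k] {n : ℕ}

lemma mem_ofList_map_X_iff (l : List (Fin n)) (f : MvPowerSeries (Fin n) k) :
    f ∈ Ideal.ofList (l.map (X : Fin n → MvPowerSeries (Fin n) k)) ↔
      ∀ m : Fin n →₀ ℕ, (∀ j ∈ l, m j = 0) → coeff m f = 0 := by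
  classical
  induction l generalizing f with
  | nil => simp [MvPowerSeries.ext_iff]
  | cons j l ih =>
    rw [List.map_cons, Ideal.ofList_cons]
    constructor
    · intro h m hm
      obtain ⟨a, ha, b, hb, rfl⟩ := Submodule.mem_sup.mp h
      rw [map_add, (ih b).mp hb m fun i hi ↦ hm i (List.mem_cons_of_mem _ hi), add_zero]
      exact X_dvd_iff.mp (Ideal.mem_span_singleton.mp ha) m (hm j List.mem_cons_self)
    · intro h
      let g : MvPowerSeries (Fin n) k := fun m ↦ if m j = 0 then coeff m f else 0
      have hg : ∀ m, coeff m g = if m j = 0 then coeff m f else 0 := fun _ ↦ rfl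
      rw [← sub_add_cancel f g]
      refine Submodule.add_mem_sup (Ideal.mem_span_singleton.mpr (X_dvd_iff.mpr fun m hm ↦ ?_))
        ((ih g).mpr fun m hm ↦ ?_)
      · rw [map_sub, hg, if_pos hm, sub_self]
      · rw [hg]
        split_ifs with hj
        · exact h m (List.forall_mem_cons.mpr ⟨hj, hm⟩)
        · rfl

lemma isWeaklyRegular_map_X {l : List (Fin n)} (hl : l.Nodup) :
    IsWeaklyRegular (MvPowerSeries (Fin n) k) (l.map (X : Fin n → MvPowerSeries (Fin n) k)) where
  regular_mod_prev i hi := by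
    rw [isSMulRegular_quotient_iff_mem_of_smul_mem, smul_eq_mul, Ideal.mul_top, List.getElem_map,
      ← List.map_take]
    intro f hf
    rw [mem_ofList_map_X_iff] at hf ⊢
    intro m hm
    rw [List.length_map] at hi
    have := hf (Finsupp.single l[i] 1 + m) fun j hj ↦ by
      have hne : l[i] ≠ j := by
        rintro rfl
        obtain ⟨i', hi', h⟩ := List.mem_take_iff_getElem.mp hj
        have := (hl.getElem_inj_iff).mp h
        lia
      simp [hne, hm j hj]
    rwa [smul_eq_mul, X, coeff_add_monomial_mul, one_mul] at this

lemma ofList_map_X_finRange :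
    Ideal.ofList ((List.finRange n).map (X : Fin n → MvPowerSeries (Fin n) k)) =
      IsLocalRing.maximalIdeal (MvPowerSeries (Fin n) k) := by
  ext f
  rw [mem_ofList_map_X_iff, IsLocalRing.mem_maximalIdeal, mem_nonunits_iff,
    isUnit_iff_constantCoeff, isUnit_iff_ne_zero, not_not]
  constructor
  · intro h
    exact h 0 (by simp)
  · intro h m hm
    obtain rfl : m = 0 := Finsupp.ext fun i ↦ hm i (List.mem_finRange i)
    exact h

end PowerSeriesRegular

section CohenMacaulay

open RingTheory.Sequence IsLocalRing CategoryTheory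

variable {R : Type} [CommRing R]

lemma isWeaklyRegular_twist (p e : ℕ) [ExpChar R p] {A : Type} [AddCommGroup A] [Module R A]
    {rs : List R} (h : IsWeaklyRegular A rs) :
    IsWeaklyRegular (Twist (iterateFrobenius R p e) A) rs := by
  refine (AddEquiv.isWeaklyRegular_congr (e := toTwist (iterateFrobenius R p e) A) ?_).mp
    (isWeaklyRegular_map_pow h (p ^ e))
  exact List.forall₂_map_left_iff.mpr (List.forall₂_same.mpr fun r _ x ↦ rfl)

variable [IsLocalRing R]

lemma exists_pow_smul_eq_zero_of_supportDim_eq_zero {N : Type} [AddCommGroup N] [Module R N]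
    [Module.Finite R N] (h : Module.supportDim R N = 0) {x : R} (hx : x ∈ maximalIdeal R) :
    ∃ t : ℕ, ∀ y : N, x ^ t • y = 0 := by
  rw [Module.supportDim_eq_ringKrullDim_quotient_annihilator] at h
  have : Ring.KrullDimLE 0 (R ⧸ Module.annihilator R N) :=
    Ring.krullDimLE_iff.mpr h.le
  have hrad : x ∈ (Module.annihilator R N).radical := by
    rw [Ideal.radical_eq_sInf, Submodule.mem_sInf]
    intro P hP
    have hPp : Ideal.IsPrime P := hP.2
    have hsurj := Ideal.Quotient.mk_surjective (I := Module.annihilator R N)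
    have hQ : (Ideal.map (Ideal.Quotient.mk (Module.annihilator R N)) P).IsPrime :=
      Ideal.map_isPrime_of_surjective hsurj (by rw [Ideal.mk_ker]; exact hP.1)
    have hmax := Ideal.IsPrime.isMaximal' 
      (I := Ideal.map (Ideal.Quotient.mk (Module.annihilator R N)) P)
    have h' := Ideal.comap_isMaximal_of_surjective _ hsurj
      (K := Ideal.map (Ideal.Quotient.mk (Module.annihilator R N)) P)
    rw [Ideal.comap_map_of_surjective _ hsurj, ← RingHom.ker_eq_comap_bot, Ideal.mk_ker,
      sup_eq_left.mpr hP.1] at h'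
    rwa [IsLocalRing.eq_maximalIdeal h']
  obtain ⟨t, ht⟩ := hrad
  exact ⟨t, fun y ↦ Module.mem_annihilator.mp ht y⟩

variable [IsNoetherianRing R]

lemma subsingleton_ext_quotient_of_isWeaklyRegular {xs : List R} (hxs : IsWeaklyRegular R xs)
    (hx : ∀ x ∈ xs, x ∈ maximalIdeal R) {I : Ideal R} [Nontrivial (R ⧸ I)] {rs : List R}
    (hrs : ∀ x ∈ rs, x ∈ maximalIdeal R) (hA : IsWeaklyRegular (R ⧸ I) rs)
    (hdim : ringKrullDim (R ⧸ I) = rs.length) {i : ℕ} (hi : i < xs.length - rs.length) :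
    Subsingleton (Abelian.Ext (ModuleCat.of R (R ⧸ I)) (ModuleCat.of R R) i) := by
  refine subsingleton_ext_of_quotient hA hrs (n := xs.length) (fun j hj ↦ ?_) hi
  have hreg : IsRegular (R ⧸ I) rs :=
    (isRegular_iff_isWeaklyRegular_of_subset_maximalIdeal hrs).mpr hA
  have h := Module.supportDim_add_length_eq_supportDim_of_isRegular rs hreg
  rw [Module.supportDim_quotient_eq_ringKrullDim, hdim] at h
  have h0 : Module.supportDim R ((R ⧸ I) ⧸ Ideal.ofList rs • (⊤ : Submodule R (R ⧸ I))) = 0 := by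
    revert h
    generalize Module.supportDim R ((R ⧸ I) ⧸ Ideal.ofList rs • (⊤ : Submodule R (R ⧸ I))) = a
    intro h
    cases a with
    | bot => simp at h
    | coe a =>
      cases a with
      | top =>
        have h' : ((⊤ + (rs.length : ℕ∞) : ℕ∞) : WithBot ℕ∞) = ((rs.length : ℕ∞) : WithBot ℕ∞) := h
        rw [top_add, WithBot.coe_inj] at h'
        exact absurd h' (ENat.top_ne_natCast _)
      | coe a => norm_cast at h ⊢; lia
  exact subsingleton_ext_of_isWeaklyRegular hxs
    (fun x hx' ↦ exists_pow_smul_eq_zero_of_supportDim_eq_zero h0 (hx x hx')) hj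

lemma hasProjectiveDimensionLE_of_isWeaklyRegular_sub {xs : List R} (hR : IsWeaklyRegular R xs)
    (hxs : Ideal.ofList xs = maximalIdeal R) {M : Type} [AddCommGroup M] [Module R M]
    [Module.Finite R M] [Nontrivial M] {rs : List R} (hrs : ∀ x ∈ rs, x ∈ maximalIdeal R)
    (hM : IsWeaklyRegular M rs) :
    HasProjectiveDimensionLE (ModuleCat.of R M) (xs.length - rs.length) := by
  have h1 := hasProjectiveDimensionLE_of_isWeaklyRegular hR hxs xs.length
    (M ⧸ Ideal.ofList rs • (⊤ : Submodule R M)) (by simp)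
  have h2 := ModuleCat.projectiveDimension_quotient_eq_add_length_of_isWeaklyRegular
    (ModuleCat.of R M) rs hM hrs
  rw [← projectiveDimension_le_iff] at h1 ⊢
  rw [h2] at h1
  revert h1
  generalize projectiveDimension (ModuleCat.of R M) = a
  intro h1
  cases a with
  | bot => exact bot_le
  | coe a =>
    cases a with
    | top => norm_cast at h1
    | coe a =>
      norm_cast at h1
      exact WithBot.coe_le_coe.mpr (Nat.cast_le.mpr (show a ≤ xs.length - rs.length by lia))

end CohenMacaulay

section Lifting

open CategoryTheory

variable {R : Type} [CommRing R]

lemma LinearMap.exists_comp_eq_of_ker_le {G M N : Type} [AddCommGroup G] [AddCommGroup M]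
    [AddCommGroup N] [Module R G] [Module R M] [Module R N] {f : G →ₗ[R] M}
    (hf : Function.Surjective f) (h : G →ₗ[R] N) (hk : LinearMap.ker f ≤ LinearMap.ker h) :
    ∃ φ : M →ₗ[R] N, φ ∘ₗ f = h := by
  refine ⟨(LinearMap.ker f).liftQ h hk ∘ₗ (f.quotKerEquivOfSurjective hf).symm.toLinearMap, ?_⟩
  ext x
  have : (f.quotKerEquivOfSurjective hf).symm (f x) = Submodule.Quotient.mk x := by
    rw [LinearEquiv.symm_apply_eq]
    rfl
  simp [this]

lemma exists_pi_quot_lift {I J : Ideal R} (hIJ : I ≤ J) {s : ℕ}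
    (g : (Fin s → R ⧸ I) →ₗ[R] R ⧸ J) :
    ∃ h : (Fin s → R ⧸ I) →ₗ[R] R ⧸ I, Submodule.factor hIJ ∘ₗ h = g := by
  have hb : ∀ i, ∃ b : R, Submodule.Quotient.mk (p := J) b = g (Pi.single i (Submodule.Quotient.mk 1)) :=
    fun i ↦ Submodule.Quotient.mk_surjective _ _
  choose b hb using hb
  refine ⟨∑ i, b i • LinearMap.proj i, ?_⟩
  refine LinearMap.pi_ext' fun i ↦ Submodule.linearMap_qext _ (LinearMap.ext_ring ?_)
  simp only [LinearMap.comp_apply, LinearMap.sum_apply, LinearMap.smul_apply, LinearMap.proj_apply,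
    LinearMap.coe_single, Submodule.mkQ_apply]
  rw [Finset.sum_eq_single i (fun j _ hj ↦ by simp [hj]) (by simp), Pi.single_eq_same, map_smul,
    show Submodule.factor hIJ (Submodule.Quotient.mk 1) = Submodule.Quotient.mk 1 from rfl, ← hb, ← Submodule.Quotient.mk_smul, smul_eq_mul, mul_one]

/-- Maps into `R ⧸ Ω` lift to `R ⧸ I` when the obstruction in `Ext` vanishes. -/
lemma exists_lift_of_isCanonicalIdeal [IsNoetherianRing R] {I Ω : Ideal R} (hIΩ : I ≤ Ω) {c : ℕ}
    (hΩ : IsCanonicalIdeal R c I Ω)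
    (hI : ∀ j < c, Subsingleton (Abelian.Ext (ModuleCat.of R (R ⧸ I)) (ModuleCat.of R R) j))
    {M : Type} [AddCommGroup M] [Module R M] [Module.Finite R M]
    (hM : ∀ a ∈ I, ∀ x : M, a • x = 0)
    [Subsingleton (Abelian.Ext (ModuleCat.of R M) (ModuleCat.of R R) (c + 1))]
    (g : M →ₗ[R] R ⧸ Ω) :
    ∃ φ : M →ₗ[R] R ⧸ I, Submodule.factor hIΩ ∘ₗ φ = g := by
  obtain ⟨s, f, hf⟩ := exists_pi_quot_surjective hM
  obtain ⟨h0, hh0⟩ := exists_pi_quot_lift hIΩ (g ∘ₗ f)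
  obtain ⟨⟨e₁⟩, ⟨e₂⟩⟩ := hΩ.2, nonempty_ext_linearEquiv (ModuleCat.of R (R ⧸ I)) (ModuleCat.of R R) c
  let e := e₁.trans e₂
  let ι₀ : (↥Ω ⧸ (Submodule.comap Ω.subtype (I : Submodule R R))) →ₗ[R] R ⧸ I :=
    Submodule.mapQ _ _ Ω.subtype le_rfl
  have hι₀ : Function.Injective ι₀ := by
    rw [← LinearMap.ker_eq_bot]
    exact Submodule.ker_liftQ_eq_bot _ _ _ (by rw [LinearMap.ker_comp, Submodule.ker_mkQ])
  have hrange : ∀ y : R ⧸ I, Submodule.factor hIΩ y = 0 ↔ y ∈ LinearMap.range ι₀ := by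
    intro y
    obtain ⟨r, rfl⟩ := Submodule.Quotient.mk_surjective _ y
    rw [show Submodule.factor hIΩ (Submodule.Quotient.mk r) = Submodule.Quotient.mk r from rfl,
      Submodule.Quotient.mk_eq_zero]
    constructor
    · exact fun hr ↦ ⟨Submodule.Quotient.mk ⟨r, hr⟩, rfl⟩
    · rintro ⟨w, hw⟩
      obtain ⟨w, rfl⟩ := Submodule.Quotient.mk_surjective _ w
      change Submodule.Quotient.mk (w : R) = _ at hw
      rw [Submodule.Quotient.eq] at hw
      exact (Submodule.sub_mem_iff_right _ w.2).mp (hIΩ hw)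
  have hker : ∀ x : LinearMap.ker f, h0 x ∈ LinearMap.range ι₀ := fun x ↦ by
    rw [← hrange]
    exact (LinearMap.congr_fun hh0 x).trans (by simp [LinearMap.mem_ker.mp x.2])
  let h : LinearMap.ker f →ₗ[R] (↥Ω ⧸ (Submodule.comap Ω.subtype (I : Submodule R R))) :=
    (LinearEquiv.ofInjective ι₀ hι₀).symm.toLinearMap ∘ₗ
      (h0 ∘ₗ (LinearMap.ker f).subtype).codRestrict _ hker
  have hh : ∀ x, ι₀ (h x) = h0 x := fun x ↦
    congrArg Subtype.val ((LinearEquiv.ofInjective ι₀ hι₀).apply_symm_apply ⟨h0 x, hker x⟩)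
  obtain ⟨g', hg'⟩ := exists_extend_of_subsingleton_ext (Y := ModuleCat.of R R) (i := c)
    (smul_quot_pi_eq_zero s) hI hf (e.toLinearMap ∘ₗ h)
  obtain ⟨φ, hφ⟩ := LinearMap.exists_comp_eq_of_ker_le hf (h0 - ι₀ ∘ₗ e.symm.toLinearMap ∘ₗ g')
    fun x hx ↦ by
      have h1 := LinearMap.congr_fun hg' ⟨x, hx⟩
      have h2 := hh ⟨x, hx⟩
      simp only [LinearMap.comp_apply, Submodule.subtype_apply, LinearEquiv.coe_coe] at h1
      simp [h1, h2]
  refine ⟨φ, ?_⟩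
  rw [← LinearMap.cancel_right hf, LinearMap.comp_assoc, hφ, ← hh0, LinearMap.comp_sub,
    sub_eq_self]
  ext x
  exact (hrange _).mpr ⟨_, rfl⟩

end Lifting

section RegularLocalRing

open RingTheory.Sequence IsLocalRing

lemma exists_mem_maximalIdeal_notMem_sq {S : Type} [CommRing S] [IsLocalRing S] [IsNoetherianRing S]
    (h : ringKrullDim S ≠ 0) :
    ∃ x ∈ maximalIdeal S, x ∉ maximalIdeal S ^ 2 ∧ ∀ P ∈ minimalPrimes S, x ∉ P := by
  by_contra! hcon
  have hfin := minimalPrimes.finite_of_isNoetherianRing S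
  have hsub : ((maximalIdeal S : Ideal S) : Set S) ⊆ (id (maximalIdeal S ^ 2) : Ideal S) ∪
      (id (maximalIdeal S ^ 2) : Ideal S) ∪ ⋃ i ∈ (↑hfin.toFinset : Set (Ideal S)),
        ((id i : Ideal S) : Set S) := by
    intro x hx
    by_cases hx2 : x ∈ maximalIdeal S ^ 2
    · exact Or.inl (Or.inl hx2)
    · obtain ⟨P, hP, hxP⟩ := hcon x hx hx2
      refine Or.inr (Set.mem_iUnion₂.2 ⟨P, ?_, hxP⟩)
      simpa using hP
  have hP (P : Ideal S) (hP : P ∈ minimalPrimes S) (hle : maximalIdeal S ≤ P) : False := by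
    have hprime : P.IsPrime := hP.1.1
    have hPm : P = maximalIdeal S := le_antisymm (le_maximalIdeal hprime.ne_top) hle
    apply h
    rw [← maximalIdeal_height_eq_ringKrullDim, ← hPm]
    rw [Ideal.height_eq_zero_iff.2 hP]; rfl
  rw [Ideal.subset_union_prime' (f := id)] at hsub
  · have hsq : maximalIdeal S ≤ maximalIdeal S ^ 2 → False := by
      intro hle
      have hbot : maximalIdeal S = ⊥ := by
        refine Submodule.eq_bot_of_le_smul_of_le_jacobson_bot (maximalIdeal S) _
          (IsNoetherian.noetherian _) ?_ (maximalIdeal_le_jacobson _)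
        rw [smul_eq_mul, ← sq]; exact hle
      obtain ⟨P, hP1, -⟩ := Ideal.exists_minimalPrimes_le (I := (⊥ : Ideal S)) (J := maximalIdeal S)
        bot_le
      exact hP P hP1 (hbot ▸ bot_le)
    rcases hsub with h1 | h1 | ⟨P, h1, h2⟩
    · exact hsq h1
    · exact hsq h1
    · exact hP P (by simpa using h1) h2
  · intro i hi
    have : i ∈ minimalPrimes S := by simpa using hi
    exact this.1.1

lemma isDomain_of_isPrime_span_singleton {S : Type} [CommRing S] [IsLocalRing S]
    [IsNoetherianRing S] {x : S} (hx : x ∈ maximalIdeal S) (hprime : (Ideal.span {x}).IsPrime)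
    (hmin : ∀ P ∈ minimalPrimes S, x ∉ P) : IsDomain S := by
  obtain ⟨P, hP1, hP2⟩ := Ideal.exists_minimalPrimes_le (I := (⊥ : Ideal S)) (J := Ideal.span {x})
    bot_le
  have hPprime : P.IsPrime := hP1.1.1
  have hbot : P = ⊥ := by
    refine Submodule.eq_bot_of_le_smul_of_le_jacobson_bot (maximalIdeal S) _
      (IsNoetherian.noetherian _) ?_ (maximalIdeal_le_jacobson _)
    intro z hz
    obtain ⟨w, rfl⟩ := Ideal.mem_span_singleton'.1 (hP2 hz)
    have hw : w ∈ P := (hPprime.mem_or_mem hz).resolve_right (hmin P hP1)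
    rw [mul_comm]
    exact Submodule.smul_mem_smul hx hw
  exact @IsDomain.of_bot_isPrime S _ (hbot ▸ hPprime)

lemma exists_generators_quotient_span_singleton {S : Type} [CommRing S] [IsLocalRing S] {r : ℕ}
    {s : Finset S} (hs : s.card ≤ r + 1) (hspan : Ideal.span (s : Set S) = maximalIdeal S)
    {x : S} (hx : x ∈ maximalIdeal S) (hx2 : x ∉ maximalIdeal S ^ 2) :
    ∃ t : Finset (S ⧸ Ideal.span {x}), t.card ≤ r ∧
      Ideal.span (t : Set (S ⧸ Ideal.span {x})) =
        (maximalIdeal S).map (Ideal.Quotient.mk (Ideal.span {x})) := by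
  classical
  have hmem : x ∈ Submodule.span S (s : Set S) := by rw [← hspan] at hx; exact hx
  obtain ⟨a, -, hax⟩ := Submodule.mem_span_finset.1 hmem
  have hy : ∃ y ∈ s, a y ∉ maximalIdeal S := by
    by_contra! hcon
    apply hx2
    rw [← hax, sq]
    refine Ideal.sum_mem _ fun y hy => Ideal.mul_mem_mul (hcon y hy) ?_
    rw [← hspan]; exact Ideal.subset_span hy
  obtain ⟨y, hys, hay⟩ := hy
  refine ⟨(s.erase y).image (Ideal.Quotient.mk (Ideal.span {x})), ?_, ?_⟩
  · refine Finset.card_image_le.trans ?_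
    rw [Finset.card_erase_of_mem hys]; omega
  · rw [← hspan, Ideal.map_span, Finset.coe_image]
    refine le_antisymm (Ideal.span_mono (Set.image_mono (by simp))) ?_
    rw [Ideal.span_le]
    rintro _ ⟨z, hz, rfl⟩
    by_cases hzy : z = y
    · subst hzy
      have hu : IsUnit (a z) := by simpa using hay
      have h0 : Ideal.Quotient.mk (Ideal.span {x}) (∑ y ∈ s, a y • y) = 0 := by
        rw [hax, Ideal.Quotient.eq_zero_iff_mem]; exact Ideal.mem_span_singleton_self x
      rw [← Finset.add_sum_erase _ _ hys, map_add, smul_eq_mul, map_mul] at h0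
      have h1 := eq_neg_of_add_eq_zero_left h0
      rw [SetLike.mem_coe, ← (Ideal.unit_mul_mem_iff_mem _ (hu.map (Ideal.Quotient.mk _))), h1,
        map_sum]
      refine neg_mem (Ideal.sum_mem _ fun w hw => ?_)
      rw [smul_eq_mul, map_mul]
      exact Ideal.mul_mem_left _ _ (Ideal.subset_span ⟨w, hw, rfl⟩)
    · exact Ideal.subset_span ⟨z, by simpa [hzy] using hz, rfl⟩

theorem isDomain_and_exists_isWeaklyRegular (r : ℕ) : ∀ (S : Type) [CommRing S] [IsLocalRing S]
    [IsNoetherianRing S] (s : Finset S), s.card ≤ r → Ideal.span (s : Set S) = maximalIdeal S →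
    (r : WithBot ℕ∞) = ringKrullDim S →
    IsDomain S ∧ ∃ ys : List S, IsWeaklyRegular S ys ∧ Ideal.ofList ys = maximalIdeal S := by
  induction r with
  | zero =>
    intro S _ _ _ s hs hspan _
    have hs0 : s = ∅ := by simpa using hs
    have hm : maximalIdeal S = ⊥ := by rw [← hspan, hs0]; simp
    have hf : IsField S := (isField_iff_maximalIdeal_eq).2 hm
    exact ⟨hf.isDomain, [], IsWeaklyRegular.nil _ _, by simp [hm]⟩
  | succ r ih =>
    intro S _ _ _ s hs hspan hdim
    obtain ⟨x, hx, hx2, hmin⟩ := exists_mem_maximalIdeal_notMem_sq (S := S)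
      (by rw [← hdim]; exact_mod_cast Nat.succ_ne_zero r)
    obtain ⟨t, htc, htspan⟩ := exists_generators_quotient_span_singleton hs hspan hx hx2
    have hne : Ideal.span {x} ≠ ⊤ := fun h =>
      (mem_maximalIdeal x).1 hx (Ideal.span_singleton_eq_top.1 h)
    have : Nontrivial (S ⧸ Ideal.span {x}) := Ideal.Quotient.nontrivial_iff.2 hne
    have : IsLocalRing (S ⧸ Ideal.span {x}) :=
      .of_surjective' (Ideal.Quotient.mk _) Ideal.Quotient.mk_surjective
    have hmap : (maximalIdeal S).map (Ideal.Quotient.mk (Ideal.span {x})) =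
        maximalIdeal (S ⧸ Ideal.span {x}) :=
      IsLocalRing.map_maximalIdeal_of_surjective _ Ideal.Quotient.mk_surjective
    have hdim' : (r : WithBot ℕ∞) = ringKrullDim (S ⧸ Ideal.span {x}) := by
      apply le_antisymm
      · have h1 := ringKrullDim_le_ringKrullDim_quotient_add_card ({x} : Finset S) (by
          rw [ringJacobson_eq_maximalIdeal]; simpa using hx)
        rw [← hdim, Finset.coe_singleton, Finset.card_singleton] at h1
        push_cast at h1
        exact (WithBot.add_le_add_iff_right' (c := (1 : WithBot ℕ∞)) WithBot.one_ne_bot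
          fun h => ENat.one_ne_top (WithBot.coe_injective h)).1 h1
      · refine (ringKrullDim_le_spanFinrank_maximalIdeal _).trans ?_
        rw [← hmap, ← htspan]
        have := Submodule.spanFinrank_span_le_ncard_of_finite (R := S ⧸ Ideal.span {x})
          t.finite_toSet
        rw [Set.ncard_coe_finset] at this
        exact_mod_cast this.trans htc
    obtain ⟨hdom, ys', hys', hysm⟩ := ih _ t htc (htspan.trans hmap) hdim'
    have hprime : (Ideal.span {x}).IsPrime := (Ideal.Quotient.isDomain_iff_prime _).1 hdom
    have hS : IsDomain S := isDomain_of_isPrime_span_singleton hx hprime hmin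
    obtain ⟨ys, rfl⟩ := (Ideal.Quotient.mk_surjective (I := Ideal.span {x})).list_map ys'
    refine ⟨hS, x :: ys, ?_, ?_⟩
    · rw [isWeaklyRegular_cons_iff]
      constructor
      · have hx0 : x ≠ 0 := by rintro rfl; exact hx2 (Ideal.zero_mem _)
        exact IsSMulRegular.of_ne_zero hx0
      · have h1 : IsWeaklyRegular (S ⧸ Ideal.span {x}) ys :=
          (isWeaklyRegular_map_algebraMap_iff (S := S ⧸ Ideal.span {x}) _ ys).1 hys'
        refine (LinearEquiv.isWeaklyRegular_congr (Submodule.quotEquivOfEq _ _ ?_) ys).2 h1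
        rw [← Submodule.ideal_span_singleton_smul, smul_eq_mul, Ideal.mul_top]
    · rw [Ideal.ofList_cons]
      rw [← Ideal.map_ofList, ← hmap] at hysm
      have := congrArg (Ideal.comap (Ideal.Quotient.mk (Ideal.span {x}))) hysm
      rw [Ideal.comap_map_of_surjective _ Ideal.Quotient.mk_surjective,
        Ideal.comap_map_of_surjective _ Ideal.Quotient.mk_surjective, ← RingHom.ker_eq_comap_bot,
        Ideal.mk_ker] at this
      rw [sup_comm, this, sup_eq_left, Ideal.span_le]
      simpa using hx

lemma IsRegularLocalRing'.isLocalRing {S : Type} [CommRing S] (h : IsRegularLocalRing' S) :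
    IsLocalRing S := by
  obtain ⟨-, M, hM, huniq, -⟩ := h
  exact IsLocalRing.of_unique_max_ideal ⟨M, hM, huniq⟩

lemma IsRegularLocalRing'.exists_isWeaklyRegular {S : Type} [CommRing S] [IsLocalRing S]
    (h : IsRegularLocalRing' S) :
    ∃ ys : List S, IsWeaklyRegular S ys ∧ Ideal.ofList ys = maximalIdeal S := by
  obtain ⟨hN, M, hM, -, s, hs, hcard⟩ := h
  exact (isDomain_and_exists_isWeaklyRegular s.card S s le_rfl
    (hs.trans (eq_maximalIdeal hM)) hcard).2

end RegularLocalRing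

section LocalizedQuotient

open IsLocalRing

variable {R : Type} [CommRing R]

/-- `C` is the localization of `R ⧸ J` at the multiplicative set `S`. -/
structure IsLocalizedQuotient (S : Submonoid R) (J : Ideal R) (C : Type) [CommRing C]
    [Algebra R C] : Prop where
  isUnit : ∀ s ∈ S, IsUnit (algebraMap R C s)
  surj : ∀ y : C, ∃ x : R, ∃ s ∈ S, algebraMap R C s * y = algebraMap R C x
  exists_mul_mem : ∀ x : R, algebraMap R C x = 0 → ∃ s ∈ S, s * x ∈ J
  eq_zero_of_mem : ∀ x ∈ J, algebraMap R C x = 0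

lemma isLocalizedQuotient_map (J P : Ideal R) [P.IsPrime] :
    IsLocalizedQuotient P.primeCompl J
      (Localization.AtPrime P ⧸ J.map (algebraMap R (Localization.AtPrime P))) where
  isUnit s hs := (IsLocalization.map_units (Localization.AtPrime P)
    (⟨s, hs⟩ : P.primeCompl)).map (Ideal.Quotient.mk _)
  surj y := by
    obtain ⟨z, rfl⟩ := Ideal.Quotient.mk_surjective y
    obtain ⟨⟨x, s⟩, hxs⟩ := IsLocalization.surj P.primeCompl z
    refine ⟨x, s, s.2, ?_⟩
    have := congrArg (Ideal.Quotient.mk (J.map (algebraMap R (Localization.AtPrime P)))) hxs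
    rw [map_mul, mul_comm] at this
    exact this
  exists_mul_mem x hx :=
    (IsLocalization.algebraMap_mem_map_algebraMap_iff P.primeCompl _ _ _).1
      (Ideal.Quotient.eq_zero_iff_mem.1 hx)
  eq_zero_of_mem x hx := Ideal.Quotient.eq_zero_iff_mem.2 (Ideal.mem_map_of_mem _ hx)

namespace IsLocalizedQuotient

variable {J : Ideal R} {C : Type} [CommRing C] [Algebra R C]

lemma isUnit_iff {P : Ideal R} [P.IsPrime] (h : IsLocalizedQuotient P.primeCompl J C)
    (hJ : J ≤ P) {x : R} : IsUnit (algebraMap R C x) ↔ x ∉ P := by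
  refine ⟨fun hu hx => ?_, h.isUnit x⟩
  obtain ⟨v, hv⟩ := hu.exists_right_inv
  obtain ⟨x', s, hs, hxs⟩ := h.surj v
  obtain ⟨t, ht, hmem⟩ := h.exists_mul_mem (x * x' - s) (by
    rw [map_sub, map_mul, ← hxs, mul_left_comm, hv, mul_one, sub_self])
  rcases Ideal.IsPrime.mem_or_mem ‹_› (hJ hmem) with h1 | h1
  · exact ht h1
  · refine hs ?_
    have := P.sub_mem (P.mul_mem_right x' hx) h1
    rwa [sub_sub_cancel] at this

lemma residueField {P : Ideal R} [P.IsPrime] [IsLocalRing C]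
    (h : IsLocalizedQuotient P.primeCompl J C) (hJ : J ≤ P) :
    IsLocalizedQuotient P.primeCompl P (ResidueField C) where
  isUnit s hs := (h.isUnit s hs).map (residue C)
  surj y := by
    obtain ⟨z, rfl⟩ := residue_surjective y
    obtain ⟨x, s, hs, hxs⟩ := h.surj z
    refine ⟨x, s, hs, ?_⟩
    have := congrArg (residue C) hxs
    rw [map_mul] at this
    exact this
  exists_mul_mem x hx := by
    refine ⟨1, one_mem _, ?_⟩
    rw [one_mul]
    by_contra hxP
    have h1 : residue C (algebraMap R C x) = 0 := hx
    rw [residue_eq_zero_iff, mem_maximalIdeal] at h1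
    exact h1 (h.isUnit x hxP)
  eq_zero_of_mem x hx := by
    have h1 : residue C (algebraMap R C x) = 0 := by
      rw [residue_eq_zero_iff, mem_maximalIdeal]
      exact fun hu => (h.isUnit_iff hJ).1 hu hx
    exact h1

variable {S : Submonoid R}

/-- The localization map `R ⧸ J → C`. -/
noncomputable def map (h : IsLocalizedQuotient S J C) : (R ⧸ J) →ₐ[R] C :=
  Ideal.Quotient.liftₐ J (Algebra.ofId R C) h.eq_zero_of_mem

lemma map_mk (h : IsLocalizedQuotient S J C) (x : R) :
    h.map (Ideal.Quotient.mk J x) = algebraMap R C x := rfl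

lemma isLocalizedModule (h : IsLocalizedQuotient S J C) :
    IsLocalizedModule S h.map.toLinearMap where
  map_units s := by
    rw [Module.End.isUnit_iff]
    have hu := h.isUnit s s.2
    have : ⇑((algebraMap R (Module.End R C)) (s : R)) = fun y => algebraMap R C s * y := by
      ext y; exact Algebra.smul_def _ _
    rw [this]
    exact hu.unit.mulLeft_bijective
  surj y := by
    obtain ⟨x, s, hs, hxs⟩ := h.surj y
    refine ⟨⟨Ideal.Quotient.mk J x, ⟨s, hs⟩⟩, ?_⟩
    exact (Algebra.smul_def s y).trans hxs
  exists_of_eq {x₁ x₂} hx := by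
    obtain ⟨x₁, rfl⟩ := Ideal.Quotient.mk_surjective x₁
    obtain ⟨x₂, rfl⟩ := Ideal.Quotient.mk_surjective x₂
    have hx' : algebraMap R C x₁ = algebraMap R C x₂ := hx
    obtain ⟨s, hs, hmem⟩ := h.exists_mul_mem (x₁ - x₂) (by rw [map_sub, hx', sub_self])
    refine ⟨⟨s, hs⟩, ?_⟩
    rw [mul_sub] at hmem
    exact Ideal.Quotient.eq.2 hmem

lemma exists_descent (h : IsLocalizedQuotient S J C) {M : Type} [AddCommGroup M] [Module R M]
    [Module.FinitePresentation R M] (g : M →ₗ[R] C) :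
    ∃ φ : M →ₗ[R] R ⧸ J, ∃ s ∈ S, ∀ x, h.map (φ x) = algebraMap R C s * g x := by
  have := h.isLocalizedModule
  obtain ⟨φ, s, hφ⟩ :=
    Module.FinitePresentation.exists_lift_of_isLocalizedModule S h.map.toLinearMap g
  refine ⟨φ, s, s.2, fun x => ?_⟩
  have := LinearMap.congr_fun hφ x
  exact this.trans (Algebra.smul_def (s : R) (g x))

lemma finite_twist (h : IsLocalizedQuotient S J C) {p e : ℕ} (hp : p ≠ 0) [ExpChar R p]
    [ExpChar C p]
    [Module.Finite R (Twist (iterateFrobenius R p e) (R ⧸ J))] :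
    Module.Finite C (Twist (iterateFrobenius C p e) C) := by
  classical
  obtain ⟨t, ht⟩ := (Module.finite_def (R := R)
    (M := Twist (iterateFrobenius R p e) (R ⧸ J))).1 inferInstance
  let f : Twist (iterateFrobenius R p e) (R ⧸ J) →ₛₗ[algebraMap R C]
      Twist (iterateFrobenius C p e) C :=
    { toFun x := toTwist _ C (h.map ((toTwist _ _).symm x))
      map_add' x y := by simp
      map_smul' r x := by
        rw [toTwist_symm_smul, smul_toTwist, map_smul, iterateFrobenius_def, iterateFrobenius_def,
          ← map_pow, algebraMap_smul] }
  refine ⟨⟨t.image f, ?_⟩⟩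
  rw [eq_top_iff]
  set N := Submodule.span C ((t.image f : Finset _) : Set (Twist (iterateFrobenius C p e) C))
  have hf (x) : f x ∈ N := by
    have : Submodule.span R (t : Set (Twist (iterateFrobenius R p e) (R ⧸ J))) ≤
        N.comap f := by
      rw [Submodule.span_le]
      intro y hy
      exact Submodule.subset_span (Finset.mem_coe.2 (Finset.mem_image_of_mem f hy))
    rw [ht] at this
    exact this trivial
  rintro y -
  obtain ⟨y, rfl⟩ := (toTwist (iterateFrobenius C p e) C).surjective y
  obtain ⟨x, s, hs, hxs⟩ := h.surj y
  have hu := h.isUnit s hs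
  have hq : p ^ e = p ^ e - 1 + 1 := (Nat.sub_add_cancel (Nat.pos_of_ne_zero (pow_ne_zero e hp))).symm
  rw [← Submodule.smul_mem_iff_of_isUnit N hu, smul_toTwist, iterateFrobenius_def, smul_eq_mul]
  have h1 : algebraMap R C s ^ p ^ e * y = h.map (Ideal.Quotient.mk J (s ^ (p ^ e - 1) * x)) := by
    rw [map_mk, map_mul, map_pow, ← hxs, ← mul_assoc, ← pow_succ, ← hq]
  rw [h1]
  exact hf (toTwist _ _ (Ideal.Quotient.mk J (s ^ (p ^ e - 1) * x)))

/-- Restriction along `R ⧸ J → C` of a linear form on a Frobenius twist of `C`. -/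
noncomputable def restrictTwist (h : IsLocalizedQuotient S J C) (p e : ℕ) [ExpChar R p]
    [ExpChar C p] {D : Type} [AddCommGroup D] [Module R D] [Module C D] [IsScalarTower R C D]
    (g : Twist (iterateFrobenius C p e) C →ₗ[C] D) :
    Twist (iterateFrobenius R p e) (R ⧸ J) →ₗ[R] D where
  toFun x := g (toTwist _ C (h.map ((toTwist _ _).symm x)))
  map_add' x y := by simp
  map_smul' r x := by
    rw [toTwist_symm_smul, map_smul, iterateFrobenius_def, RingHom.id_apply,
      ← algebraMap_smul C r, ← map_smul g, smul_toTwist, iterateFrobenius_def, ← map_pow,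
      algebraMap_smul]

end IsLocalizedQuotient

end LocalizedQuotient

section LocalFunctional

open IsLocalRing

variable {C : Type} [CommRing C] [IsLocalRing C]

lemma exists_toTwist_notMem_smul_top [IsNoetherianRing C] {p : ℕ} (hp : 1 < p) [ExpChar C p]
    {c : C} (hc : c ≠ 0) :
    ∃ e, toTwist (iterateFrobenius C p e) C c ∉
      (maximalIdeal C • ⊤ : Submodule C (Twist (iterateFrobenius C p e) C)) := by
  have hbot := Ideal.iInf_pow_eq_bot_of_isLocalRing (maximalIdeal C) Ideal.IsPrime.ne_top'
  obtain ⟨i, hi⟩ : ∃ i, c ∉ maximalIdeal C ^ i := by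
    by_contra! hcon
    apply hc
    rw [← Ideal.mem_bot, ← hbot, Ideal.mem_iInf]
    exact hcon
  refine ⟨i + 1, fun hmem => hi ?_⟩
  have hle : i ≤ p ^ (i + 1) := ((Nat.lt_pow_self hp).le.trans (Nat.pow_le_pow_right hp.le (by omega)))
  refine Ideal.pow_le_pow_right hle ?_
  have key : ∀ x ∈ (maximalIdeal C • ⊤ : Submodule C (Twist (iterateFrobenius C p (i + 1)) C)),
      (toTwist (iterateFrobenius C p (i + 1)) C).symm x ∈ maximalIdeal C ^ p ^ (i + 1) := by
    intro x hx
    refine Submodule.smul_induction_on hx ?_ ?_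
    · intro r hr y _
      rw [toTwist_symm_smul, iterateFrobenius_def]
      exact Ideal.mul_mem_right _ _ (Ideal.pow_mem_pow hr _)
    · intro x y hx hy
      rw [map_add]
      exact add_mem hx hy
  exact key _ hmem

lemma exists_residueField_linearMap_apply_ne_zero {M : Type} [AddCommGroup M] [Module C M] {x : M}
    (hx : x ∉ (maximalIdeal C • ⊤ : Submodule C M)) :
    ∃ g : M →ₗ[C] ResidueField C, g x ≠ 0 := by
  let _ : Field (C ⧸ maximalIdeal C) := Ideal.Quotient.field _
  have hne : (maximalIdeal C • ⊤ : Submodule C M).mkQ x ≠ 0 := by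
    rwa [Submodule.mkQ_apply, Ne, Submodule.Quotient.mk_eq_zero]
  have h := mt (Module.forall_dual_apply_eq_zero_iff (C ⧸ maximalIdeal C)
    ((maximalIdeal C • ⊤ : Submodule C M).mkQ x)).1 hne
  push Not at h
  obtain ⟨f, hf⟩ := h
  let g : M →ₗ[C] C ⧸ maximalIdeal C :=
    (f.restrictScalars C) ∘ₗ (maximalIdeal C • ⊤ : Submodule C M).mkQ
  exact ⟨g, hf⟩

lemma exists_linearMap_isUnit_apply {M : Type} [AddCommGroup M] [Module C M] [Module.Free C M]
    {x : M} (hx : x ∉ (maximalIdeal C • ⊤ : Submodule C M)) :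
    ∃ g : M →ₗ[C] C, IsUnit (g x) := by
  by_contra! hcon
  apply hx
  let b := Module.Free.chooseBasis C M
  rw [← b.linearCombination_repr x, Finsupp.linearCombination_apply]
  refine Submodule.sum_mem _ fun i _ => Submodule.smul_mem_smul ?_ trivial
  exact (mem_maximalIdeal _).2 (hcon (b.coord i))

end LocalFunctional

section FSplitting

open IsLocalRing RingTheory.Sequence

lemma expChar_of_ringHom {p : ℕ} (hp : p.Prime) {R C : Type} [CommRing R] [CommRing C]
    [Nontrivial C] [ExpChar R p] (f : R →+* C) : ExpChar C p := by
  have : CharP R p := by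
    rcases ‹ExpChar R p›
    · exact absurd hp Nat.not_prime_one
    · assumption
  have := (CharP.charP_iff_prime_eq_zero (R := C) hp).mpr
    (by rw [← map_natCast f, CharP.cast_eq_zero, map_zero])
  exact ExpChar.prime hp

lemma isPrime_of_fsplits {R : Type} [CommRing R] {p : ℕ} (hp : p.Prime) {J : Ideal R} (hJ : J ≠ ⊤)
    (h : ∀ c ∉ J, FSplits p (Ideal.Quotient.mk J c)) : J.IsPrime := by
  refine ⟨hJ, fun {x y} hxy => ?_⟩
  by_contra! hcon
  apply hcon.2
  rw [← Ideal.Quotient.eq_zero_iff_mem] at hxy ⊢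
  exact (h x hcon.1).eq_zero_of_mul_eq_zero hp.ne_zero (by rwa [← map_mul])

variable {R : Type} [CommRing R] {p : ℕ} [ExpChar R p]

lemma map_toTwist_pow_mul {J : Ideal R} {e : ℕ}
    (φ : Twist (iterateFrobenius R p e) (R ⧸ J) →ₗ[R] R ⧸ J) (a x : R ⧸ J) :
    φ (toTwist _ _ (a ^ p ^ e * x)) = a * φ (toTwist _ _ x) := by
  obtain ⟨r, rfl⟩ := Ideal.Quotient.mk_surjective a
  have h1 : toTwist (iterateFrobenius R p e) (R ⧸ J) (Ideal.Quotient.mk J r ^ p ^ e * x) =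
      r • toTwist (iterateFrobenius R p e) (R ⧸ J) x := by
    rw [smul_toTwist, iterateFrobenius_def, ← map_pow]
    rfl
  rw [h1, φ.map_smul]
  rfl

lemma FSplits.of_linearMap {J : Ideal R} {c s : R ⧸ J} (hs : FSplits p s) {e : ℕ}
    (φ : Twist (iterateFrobenius R p e) (R ⧸ J) →ₗ[R] R ⧸ J) (h : φ (toTwist _ _ c) = s) :
    FSplits p c := by
  exact hs.of_map (φ.toAddMonoidHom.comp (toTwist (iterateFrobenius R p e) (R ⧸ J)).toAddMonoidHom)
    (e := e) (map_toTwist_pow_mul φ) h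

lemma nontrivial_localization_quotient {J P : Ideal R} [P.IsPrime] (hJ : J ≤ P) :
    Nontrivial (Localization.AtPrime P ⧸ J.map (algebraMap R (Localization.AtPrime P))) := by
  refine ⟨0, 1, fun h => ?_⟩
  have h1 := ((isLocalizedQuotient_map J P).isUnit_iff hJ (x := 1)).2
    (fun h => Ideal.IsPrime.ne_top ‹_› ((Ideal.eq_top_iff_one P).2 h))
  obtain ⟨s, hs, hmem⟩ := (isLocalizedQuotient_map J P).exists_mul_mem 1
    ((map_one _).trans h.symm)
  exact hs (by simpa using hJ hmem)

lemma fsplits_of_fsplits_quotient [IsLocalRing R] {I J : Ideal R} (hIJ : I ≤ J) (hJ : J ≠ ⊤)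
    (hlift : ∀ (e : ℕ) (g : Twist (iterateFrobenius R p e) (R ⧸ I) →ₗ[R] R ⧸ J),
      ∃ φ : Twist (iterateFrobenius R p e) (R ⧸ I) →ₗ[R] R ⧸ I,
        Submodule.factor hIJ ∘ₗ φ = g) {c : R} (hc : FSplits p (Ideal.Quotient.mk J c)) :
    FSplits p (Ideal.Quotient.mk I c) := by
  obtain ⟨e, ψ, he, hψ, hψc⟩ := hc
  let g : Twist (iterateFrobenius R p e) (R ⧸ I) →ₗ[R] R ⧸ J :=
    { toFun x := ψ (Ideal.Quotient.factor hIJ ((toTwist _ _).symm x))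
      map_add' x y := by simp
      map_smul' r x := by
        rw [toTwist_symm_smul, iterateFrobenius_def, RingHom.id_apply, Algebra.smul_def,
          Algebra.smul_def, map_mul, ← hψ, map_pow, map_pow]
        rfl }
  obtain ⟨φ, hφ⟩ := hlift e g
  set u := φ (toTwist _ _ (Ideal.Quotient.mk I c)) with hu
  obtain ⟨u', hu'⟩ := Ideal.Quotient.mk_surjective u
  have h1 : Ideal.Quotient.mk J u' = 1 := by
    have h2 := LinearMap.congr_fun hφ (toTwist _ _ (Ideal.Quotient.mk I c))
    rw [LinearMap.comp_apply, ← hu, ← hu'] at h2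
    exact h2.trans hψc
  have hunit : IsUnit u' := by
    by_contra hcon
    have h3 : 1 - u' ∈ J := by
      rw [← Ideal.Quotient.eq, h1, map_one]
    have h4 := (maximalIdeal R).add_mem (le_maximalIdeal hJ h3) ((mem_maximalIdeal u').2 hcon)
    rw [sub_add_cancel] at h4
    exact (maximalIdeal.isMaximal R).ne_top ((Ideal.eq_top_iff_one _).2 h4)
  have hux : IsUnit u := hu' ▸ hunit.map (Ideal.Quotient.mk I)
  obtain ⟨v, hv⟩ := Ideal.Quotient.mk_surjective (↑hux.unit⁻¹ : R ⧸ I)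
  have hvu : v • u = 1 := by
    rw [Algebra.smul_def]
    change Ideal.Quotient.mk I v * u = 1
    rw [hv, hux.val_inv_mul]
  exact ⟨e, (v • φ).toAddMonoidHom.comp
    (toTwist (iterateFrobenius R p e) (R ⧸ I)).toAddMonoidHom, he, map_toTwist_pow_mul (v • φ), hvu⟩

variable [IsNoetherianRing R]

lemma exists_linearMap_of_isRegularLocalRing (hp : p.Prime)
    [hfin : ∀ (e : ℕ) (J : Ideal R), Module.Finite R (Twist (iterateFrobenius R p e) (R ⧸ J))]
    {J P : Ideal R} [P.IsPrime] (hJ : J ≤ P)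
    (hreg : IsRegularLocalRing'
      (Localization.AtPrime P ⧸ J.map (algebraMap R (Localization.AtPrime P))))
    {c : R} (hc : ∀ s ∉ P, s * c ∉ J) :
    ∃ (e : ℕ) (φ : Twist (iterateFrobenius R p e) (R ⧸ J) →ₗ[R] R ⧸ J), ∃ s ∉ P,
      φ (toTwist _ _ (Ideal.Quotient.mk J c)) = Ideal.Quotient.mk J s := by
  set C := Localization.AtPrime P ⧸ J.map (algebraMap R (Localization.AtPrime P))
  have hloc : IsLocalizedQuotient P.primeCompl J C := isLocalizedQuotient_map J P
  have : IsLocalRing C := hreg.isLocalRing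
  have : IsNoetherianRing C := hreg.1
  have : ExpChar C p := expChar_of_ringHom hp (algebraMap R C)
  obtain ⟨ys, hys, hysm⟩ := hreg.exists_isWeaklyRegular
  obtain ⟨e, he⟩ := exists_toTwist_notMem_smul_top (C := C) hp.one_lt (c := algebraMap R C c) (by
    intro h0
    obtain ⟨s, hs, hmem⟩ := hloc.exists_mul_mem c h0
    exact hc s hs hmem)
  have : Module.Finite C (Twist (iterateFrobenius C p e) C) := hloc.finite_twist hp.ne_zero
  have : Module.FinitePresentation C (Twist (iterateFrobenius C p e) C) :=
    Module.finitePresentation_of_finite C _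
  have : Module.Free C (Twist (iterateFrobenius C p e) C) :=
    free_of_isWeaklyRegular (isWeaklyRegular_twist p e hys) hysm
  obtain ⟨g, hg⟩ := exists_linearMap_isUnit_apply he
  have : Module.FinitePresentation R (Twist (iterateFrobenius R p e) (R ⧸ J)) :=
    Module.finitePresentation_of_finite R _
  obtain ⟨φ, s, hs, hφ⟩ := hloc.exists_descent (hloc.restrictTwist p e g)
  obtain ⟨s', hs'⟩ := Ideal.Quotient.mk_surjective
    (φ (toTwist _ _ (Ideal.Quotient.mk J c)))
  refine ⟨e, φ, s', ?_, hs'.symm⟩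
  have h1 := hφ (toTwist _ _ (Ideal.Quotient.mk J c))
  rw [← hs', hloc.map_mk] at h1
  rw [← hloc.isUnit_iff hJ, h1]
  exact (hloc.isUnit s hs).mul hg

lemma exists_linearMap_apply_ne_zero (hp : p.Prime)
    [hfin : ∀ (e : ℕ) (J : Ideal R), Module.Finite R (Twist (iterateFrobenius R p e) (R ⧸ J))]
    {I P : Ideal R} [P.IsPrime] (hI : I ≤ P) {c : R} (hc : ∀ s ∉ P, s * c ∉ I) :
    ∃ (e : ℕ) (g : Twist (iterateFrobenius R p e) (R ⧸ I) →ₗ[R] R ⧸ P),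
      g (toTwist _ _ (Ideal.Quotient.mk I c)) ≠ 0 := by
  set C := Localization.AtPrime P ⧸ I.map (algebraMap R (Localization.AtPrime P))
  have hloc : IsLocalizedQuotient P.primeCompl I C := isLocalizedQuotient_map I P
  have : Nontrivial C := nontrivial_localization_quotient hI
  have : IsLocalRing C := .of_surjective' (Ideal.Quotient.mk _) Ideal.Quotient.mk_surjective
  have : IsNoetherianRing (Localization.AtPrime P) :=
    IsLocalization.isNoetherianRing P.primeCompl _ inferInstance
  have : IsNoetherianRing C := inferInstance
  have : ExpChar C p := expChar_of_ringHom hp (algebraMap R C)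
  obtain ⟨e, he⟩ := exists_toTwist_notMem_smul_top (C := C) hp.one_lt (c := algebraMap R C c) (by
    intro h0
    obtain ⟨s, hs, hmem⟩ := hloc.exists_mul_mem c h0
    exact hc s hs hmem)
  obtain ⟨g, hg⟩ := exists_residueField_linearMap_apply_ne_zero he
  have : Module.FinitePresentation R (Twist (iterateFrobenius R p e) (R ⧸ I)) :=
    Module.finitePresentation_of_finite R _
  have hres := hloc.residueField hI
  obtain ⟨φ, s, hs, hφ⟩ := hres.exists_descent (hloc.restrictTwist p e g)
  refine ⟨e, φ, fun h0 => ?_⟩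
  have h1 := hφ (toTwist _ _ (Ideal.Quotient.mk I c))
  rw [h0, map_zero] at h1
  exact hg ((hres.isUnit s hs).mul_right_eq_zero.1 h1.symm)

variable [IsLocalRing R]

lemma fsplits_of_isRegularLocalRing (hp : p.Prime)
    [hfin : ∀ (e : ℕ) (J : Ideal R), Module.Finite R (Twist (iterateFrobenius R p e) (R ⧸ J))]
    {J : Ideal R} (hJ : J ≠ ⊤)
    (hreg : ∀ (P : Ideal R) [P.IsPrime], J ≤ P → P ≠ maximalIdeal R → IsRegularLocalRing'
      (Localization.AtPrime P ⧸ J.map (algebraMap R (Localization.AtPrime P))))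
    {x : R} (hx : x ∈ maximalIdeal R) (hxs : FSplits p (Ideal.Quotient.mk J x))
    {c : R} (hc : c ∉ J) : FSplits p (Ideal.Quotient.mk J c) := by
  have : Nontrivial (R ⧸ J) := Ideal.Quotient.nontrivial_iff.2 hJ
  have : IsLocalRing (R ⧸ J) :=
    .of_surjective' (Ideal.Quotient.mk _) Ideal.Quotient.mk_surjective
  have hprime : (nonFSplitIdeal p (R ⧸ J)).IsPrime := nonFSplitIdeal_isPrime hp.ne_zero hxs
  let P : Ideal R := (nonFSplitIdeal p (R ⧸ J)).comap (Ideal.Quotient.mk J)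
  have hmem (y : R) : y ∈ P ↔ ¬ FSplits p (Ideal.Quotient.mk J y) := mem_nonFSplitIdeal
  have : P.IsPrime := Ideal.IsPrime.comap _
  have hJP : J ≤ P := fun y hy => by
    change Ideal.Quotient.mk J y ∈ nonFSplitIdeal p (R ⧸ J)
    rw [Ideal.Quotient.eq_zero_iff_mem.2 hy]
    exact Ideal.zero_mem _
  have hPm : P ≠ maximalIdeal R := fun h => (hmem x).1 (h ▸ hx) hxs
  by_contra hcs
  obtain ⟨e, φ, s, hs, hφ⟩ := exists_linearMap_of_isRegularLocalRing hp hJP (hreg P hJP hPm)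
    (c := c) (by
      intro s hs hsc
      have hs' : FSplits p (Ideal.Quotient.mk J s) := by simpa [hmem] using hs
      apply hc
      rw [← Ideal.Quotient.eq_zero_iff_mem]
      refine hs'.eq_zero_of_mul_eq_zero hp.ne_zero ?_
      rw [← map_mul, Ideal.Quotient.eq_zero_iff_mem]
      exact hsc)
  have hs' : FSplits p (Ideal.Quotient.mk J s) := by simpa [hmem] using hs
  exact hcs (hs'.of_linearMap φ hφ)

theorem fsplits_of_notMem (hp : p.Prime)
    [hfin : ∀ (e : ℕ) (J : Ideal R), Module.Finite R (Twist (iterateFrobenius R p e) (R ⧸ J))]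
    {I J : Ideal R} (hIJ : I ≤ J) (hJ : J ≠ ⊤)
    (hlift : ∀ (e : ℕ) (g : Twist (iterateFrobenius R p e) (R ⧸ I) →ₗ[R] R ⧸ J),
      ∃ φ : Twist (iterateFrobenius R p e) (R ⧸ I) →ₗ[R] R ⧸ I,
        Submodule.factor hIJ ∘ₗ φ = g)
    (h : ∀ c ∉ J, FSplits p (Ideal.Quotient.mk J c)) {c : R} (hc : c ∉ I) :
    FSplits p (Ideal.Quotient.mk I c) := by
  have hI (r : R) (hr : r ∉ J) : FSplits p (Ideal.Quotient.mk I r) :=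
    fsplits_of_fsplits_quotient hIJ hJ hlift (h r hr)
  have : J.IsPrime := isPrime_of_fsplits hp hJ h
  obtain ⟨e, g, hg⟩ := exists_linearMap_apply_ne_zero hp hIJ (c := c) (by
    intro s hs hsc
    apply hc
    rw [← Ideal.Quotient.eq_zero_iff_mem] at hsc ⊢
    exact (hI s hs).eq_zero_of_mul_eq_zero hp.ne_zero (by rwa [← map_mul]))
  obtain ⟨φ, hφ⟩ := hlift e g
  obtain ⟨s, hs⟩ := Ideal.Quotient.mk_surjective (φ (toTwist _ _ (Ideal.Quotient.mk I c)))
  refine (hI s fun hsJ => hg ?_).of_linearMap φ hs.symm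
  rw [← hφ, LinearMap.comp_apply, ← hs]
  exact Ideal.Quotient.eq_zero_iff_mem.2 hsJ

end FSplitting

section FrobeniusLifting

open IsLocalRing RingTheory.Sequence

lemma exists_lift_twist {k : Type} [Field k] {p : ℕ} [ExpChar k p] [PerfectRing k p] {n d : ℕ}
    {I Ω : Ideal (MvPowerSeries (Fin n) k)}
    (hCM : IsCohenMacaulayLocalOfDim (MvPowerSeries (Fin n) k ⧸ I)
      ((maximalIdeal (MvPowerSeries (Fin n) k)).map (Ideal.Quotient.mk I)) d)
    (hΩ : IsCanonicalIdeal (MvPowerSeries (Fin n) k) (n - d) I Ω) (hΩne : Ω ≠ ⊤) (e : ℕ)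
    (g : Twist (iterateFrobenius (MvPowerSeries (Fin n) k) p e) (MvPowerSeries (Fin n) k ⧸ I)
      →ₗ[MvPowerSeries (Fin n) k] MvPowerSeries (Fin n) k ⧸ Ω) :
    ∃ φ : Twist (iterateFrobenius (MvPowerSeries (Fin n) k) p e) (MvPowerSeries (Fin n) k ⧸ I)
        →ₗ[MvPowerSeries (Fin n) k] MvPowerSeries (Fin n) k ⧸ I,
      Submodule.factor hΩ.1 ∘ₗ φ = g := by
  set R := MvPowerSeries (Fin n) k
  have hnt : Nontrivial (R ⧸ I) :=
    Ideal.Quotient.nontrivial_iff.2 fun h => hΩne (top_le_iff.1 (h ▸ hΩ.1))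
  obtain ⟨hdim, rs', hlen, hmem, hreg⟩ := hCM
  obtain ⟨rs, hrs, hrsm⟩ : ∃ rs : List R, rs.map (Ideal.Quotient.mk I) = rs' ∧
      ∀ x ∈ rs, x ∈ maximalIdeal R := by
    have h1 : ∀ x ∈ rs', ∃ y ∈ maximalIdeal R, Ideal.Quotient.mk I y = x := fun x hx =>
      (Ideal.mem_map_iff_of_surjective _ Ideal.Quotient.mk_surjective).1 (hmem x hx)
    clear hlen hmem hreg
    induction rs' with
    | nil => exact ⟨[], rfl, by simp⟩
    | cons x l ih =>
      obtain ⟨rs, hrs, hm⟩ := ih fun y hy => h1 y (List.mem_cons_of_mem _ hy)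
      obtain ⟨y, hy, hyx⟩ := h1 x List.mem_cons_self
      refine ⟨y :: rs, by rw [List.map_cons, hyx, hrs], ?_⟩
      intro z hz
      rcases List.mem_cons.1 hz with rfl | hz
      · exact hy
      · exact hm z hz
  have hlen' : rs.length = d := by rw [← hlen, ← hrs, List.length_map]
  have hw : IsWeaklyRegular (R ⧸ I) rs :=
    (isWeaklyRegular_map_algebraMap_iff (S := R ⧸ I) _ rs).1 (hrs ▸ hreg.toIsWeaklyRegular)
  let xs : List R := (List.finRange n).map MvPowerSeries.X
  have hxs : IsWeaklyRegular R xs := isWeaklyRegular_map_X (List.nodup_finRange n)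
  have hxsm : Ideal.ofList xs = maximalIdeal R := ofList_map_X_finRange
  have hxslen : xs.length = n := by simp [xs]
  have hI : ∀ j < n - d, Subsingleton (CategoryTheory.Abelian.Ext
      (ModuleCat.of R (R ⧸ I)) (ModuleCat.of R R) j) := fun j hj =>
    subsingleton_ext_quotient_of_isWeaklyRegular hxs
      (fun x hx => hxsm ▸ Ideal.subset_span hx) hrsm hw (by rw [hdim, hlen'])
      (by rwa [hxslen, hlen'])
  have hntT : Nontrivial (Twist (iterateFrobenius R p e) (R ⧸ I)) := hnt
  have hpd := hasProjectiveDimensionLE_of_isWeaklyRegular_sub hxs hxsm hrsm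
    (isWeaklyRegular_twist p e hw)
  rw [hxslen, hlen'] at hpd
  have hExt : Subsingleton (CategoryTheory.Abelian.Ext
      (ModuleCat.of R (Twist (iterateFrobenius R p e) (R ⧸ I))) (ModuleCat.of R R)
      (n - d + 1)) :=
    CategoryTheory.HasProjectiveDimensionLT.subsingleton _ (n - d + 1) _ le_rfl _
  refine exists_lift_of_isCanonicalIdeal hΩ.1 hΩ hI ?_ g
  intro a ha x
  obtain ⟨y, rfl⟩ := (toTwist (iterateFrobenius R p e) (R ⧸ I)).surjective x
  obtain ⟨z, rfl⟩ := Ideal.Quotient.mk_surjective y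
  rw [smul_toTwist, iterateFrobenius_def]
  have h0 : (a ^ p ^ e) • Ideal.Quotient.mk I z = 0 := by
    have : a ^ p ^ e * z ∈ I := I.mul_mem_right _ (Ideal.pow_mem_of_mem I ha _ (expChar_pow_pos k p e))
    exact Ideal.Quotient.eq_zero_iff_mem.2 this
  rw [h0, map_zero]

end FrobeniusLifting
/-- If `k` is perfect, `d ≥ 2`, `Ω ≠ R` is a canonical ideal of `A`, `R/Ω` is locally
regular on the punctured spectrum, and `Ω^{[p]} : Ω ⊄ 𝔪^{[p]} + ((x₁⋯xₙ)^{p-1})`, then `A`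
is strongly `F`-regular. -/
theorem stmt5 (p : ℕ) (hp : p.Prime) (k : Type) [Field k] [CharP k p]
    (hperf : Function.Surjective fun x : k => x ^ p)
    (n d : ℕ) (hd : 2 ≤ d)
    (I : Ideal (MvPowerSeries (Fin n) k))
    (hred : IsReduced (MvPowerSeries (Fin n) k ⧸ I))
    (hCM : IsCohenMacaulayLocalOfDim (MvPowerSeries (Fin n) k ⧸ I)
      ((IsLocalRing.maximalIdeal (MvPowerSeries (Fin n) k)).map (Ideal.Quotient.mk I)) d)
    (Ω : Ideal (MvPowerSeries (Fin n) k))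
    (hΩ : IsCanonicalIdeal (MvPowerSeries (Fin n) k) (n - d) I Ω)
    (hΩne : Ω ≠ ⊤)
    (hpunct : ∀ (𝔭 : Ideal (MvPowerSeries (Fin n) k)) [𝔭.IsPrime], Ω ≤ 𝔭 →
      𝔭 ≠ IsLocalRing.maximalIdeal (MvPowerSeries (Fin n) k) →
      IsRegularLocalRing'
        (Localization.AtPrime 𝔭 ⧸
          Ω.map (algebraMap (MvPowerSeries (Fin n) k) (Localization.AtPrime 𝔭))))
    (hmain : ¬ Submodule.colon (frobPow p Ω) Ω ≤
      frobPow p (IsLocalRing.maximalIdeal (MvPowerSeries (Fin n) k)) ⊔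
        Ideal.span {(∏ i : Fin n, MvPowerSeries.X i) ^ (p - 1)}) :
    StronglyFRegular p (MvPowerSeries (Fin n) k ⧸ I) := by
  have : Fact p.Prime := ⟨hp⟩
  have : ExpChar k p := ExpChar.prime hp
  have : PerfectRing k p := PerfectRing.ofSurjective k p hperf
  obtain ⟨j, hj⟩ := exists_fsplits_X Ω hmain
  have hX : (MvPowerSeries.X j : MvPowerSeries (Fin n) k) ∈
      IsLocalRing.maximalIdeal (MvPowerSeries (Fin n) k) := by
    rw [← ofList_map_X_finRange]
    exact Ideal.subset_span (List.mem_map.2 ⟨j, List.mem_finRange j, rfl⟩)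
  have hΩs : ∀ c ∉ Ω, FSplits p (Ideal.Quotient.mk Ω c) := fun c hc =>
    fsplits_of_isRegularLocalRing hp hΩne hpunct hX hj hc
  intro c hc
  obtain ⟨r, rfl⟩ := Ideal.Quotient.mk_surjective c
  refine fsplits_of_notMem hp hΩ.1 hΩne (exists_lift_twist hCM hΩ hΩne) hΩs fun hr => ?_
  have : Nontrivial (MvPowerSeries (Fin n) k ⧸ I) :=
    Ideal.Quotient.nontrivial_iff.2 fun h => hΩne (top_le_iff.1 (h ▸ hΩ.1))
  obtain ⟨P, hP⟩ := Ideal.nonempty_minimalPrimes (bot_ne_top (α := Ideal (MvPowerSeries (Fin n) k ⧸ I)))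
  apply hc P hP
  rw [Ideal.Quotient.eq_zero_iff_mem.2 hr]
  exact P.zero_mem
end

section
/- For every n ≥ 2, one has the equality of ideals (I^{[p]} : I) ∩ (Ω^{[p]} : Ω) = I^{[p]} + ((G_n G_{n−1})^{p−1}) in R = k[[X]]; that is, the class of (G_n G_{n−1})^{p−1} generates the cyclic R-module ((I^{[p]} : I) ∩ (Ω^{[p]} : Ω)) / I^{[p]}. -/
/-- For the generic `n × (n-1)` matrix `X` (with `n = m + 2`) over `R = k[[X]]`,
`Gmin k m i` is the maximal minor obtained by deleting the `i`-th row. -/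
noncomputable def Gmin (k : Type) [Field k] (m : ℕ) (i : Fin (m + 2)) :
    MvPowerSeries (Fin (m + 2) × Fin (m + 1)) k :=
  (Matrix.of fun r c : Fin (m + 1) =>
    (MvPowerSeries.X (i.succAbove r, c) : MvPowerSeries (Fin (m + 2) × Fin (m + 1)) k)).det

/-- `gmin k m j` is the `(n-2) × (n-2)` minor of the submatrix `X'` formed by the first
`n - 2` rows of `X`, obtained by deleting the `j`-th column. -/
noncomputable def gmin (k : Type) [Field k] (m : ℕ) (j : Fin (m + 1)) :
    MvPowerSeries (Fin (m + 2) × Fin (m + 1)) k :=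
  (Matrix.of fun r c : Fin m =>
    (MvPowerSeries.X (Fin.castAdd 2 r, j.succAbove c) :
      MvPowerSeries (Fin (m + 2) × Fin (m + 1)) k)).det

/-- `I = I_{n-1}(X)`, the ideal of maximal minors. -/
noncomputable def Imax (k : Type) [Field k] (m : ℕ) :
    Ideal (MvPowerSeries (Fin (m + 2) × Fin (m + 1)) k) :=
  Ideal.span (Set.range (Gmin k m))

/-- `P = I_{n-2}(X')` (equal to `R` when `n = 2`). -/
noncomputable def Psub (k : Type) [Field k] (m : ℕ) :
    Ideal (MvPowerSeries (Fin (m + 2) × Fin (m + 1)) k) :=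
  Ideal.span (Set.range (gmin k m))

/-- `Ω = I + P`. -/
noncomputable def Omeg (k : Type) [Field k] (m : ℕ) :
    Ideal (MvPowerSeries (Fin (m + 2) × Fin (m + 1)) k) :=
  Imax k m ⊔ Psub k m



section HilbertBurch

variable {R : Type*} [CommRing R] {m : ℕ}

/-- The signed maximal minors of an `(m + 2) × (m + 1)` matrix. -/
def signedMaxMinor (Y : Matrix (Fin (m + 2)) (Fin (m + 1)) R) (i : Fin (m + 2)) : R :=
  (-1) ^ (i : ℕ) * (Y.submatrix i.succAbove id).det

/-- The signed maximal minors of the first `m` rows of an `(m + 2) × (m + 1)` matrix. -/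
def signedTopMinor (Y : Matrix (Fin (m + 2)) (Fin (m + 1)) R) (j : Fin (m + 1)) : R :=
  (-1) ^ (j : ℕ) * (Y.submatrix (Fin.castAdd 2) j.succAbove).det

/-- The signed minor omitting the last row. -/
def minorLast (Y : Matrix (Fin (m + 2)) (Fin (m + 1)) R) : R :=
  (-1) ^ m * (Y.submatrix (Fin.last (m + 1)).succAbove id).det

/-- The signed minor omitting the last row but one. -/
def minorPenult (Y : Matrix (Fin (m + 2)) (Fin (m + 1)) R) : R :=
  (-1) ^ m * (Y.submatrix (Fin.last m).castSucc.succAbove id).det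

variable (Y : Matrix (Fin (m + 2)) (Fin (m + 1)) R)

theorem signedMaxMinor_penult : signedMaxMinor Y (Fin.last m).castSucc = minorPenult Y := by
  simp [signedMaxMinor, minorPenult]

theorem signedMaxMinor_last : signedMaxMinor Y (Fin.last (m + 1)) = -minorLast Y := by
  simp [signedMaxMinor, minorLast, pow_succ]

theorem signedMaxMinor_vecMul : Matrix.vecMul (signedMaxMinor Y) Y = 0 := by
  ext j
  let N : Matrix (Fin (m + 2)) (Fin (m + 2)) R :=
    Matrix.of fun i => (Fin.cons (Y i j) (Y i) : Fin (m + 2) → R)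
  have hN : N.det = 0 := Matrix.det_zero_of_column_eq (i := 0) (j := j.succ)
    (Fin.succ_ne_zero j).symm (fun i => by simp [N])
  rw [Matrix.det_succ_column_zero] at hN
  rw [Matrix.vecMul, dotProduct, Pi.zero_apply, ← hN]
  refine Finset.sum_congr rfl fun i _ => ?_
  have : N.submatrix i.succAbove Fin.succ = Y.submatrix i.succAbove id := by
    ext a b; simp [N]
  rw [this]
  simp only [signedMaxMinor, N, Matrix.of_apply, Fin.cons_zero]
  ring

theorem dotProduct_signedTopMinor (r : Fin (m + 1) → R) :
    r ⬝ᵥ signedTopMinor Y =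
      (-1) ^ m * (Matrix.of (Fin.snoc (α := fun _ => Fin (m + 1) → R)
        (fun i : Fin m => Y (Fin.castAdd 2 i)) r) :
        Matrix (Fin (m + 1)) (Fin (m + 1)) R).det := by
  rw [Matrix.det_succ_row _ (Fin.last m), Finset.mul_sum]
  refine Finset.sum_congr rfl fun j _ => ?_
  have : (Matrix.of (Fin.snoc (α := fun _ => Fin (m + 1) → R)
      (fun i : Fin m => Y (Fin.castAdd 2 i)) r) :
      Matrix (Fin (m + 1)) (Fin (m + 1)) R).submatrix (Fin.last m).succAbove j.succAbove =
      Y.submatrix (Fin.castAdd 2) j.succAbove := by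
    ext a b; simp [Fin.succAbove_last]
  rw [this]
  have h1 : ((-1 : R) ^ m) * (-1) ^ m = 1 := by rw [← mul_pow]; simp
  simp only [signedTopMinor, Matrix.of_apply, Fin.snoc_last, Fin.val_last, pow_add]
  linear_combination (-(r j * (-1) ^ (j : ℕ) *
    (Y.submatrix (Fin.castAdd 2) j.succAbove).det)) * h1

theorem mulVec_signedTopMinor :
    Y.mulVec (signedTopMinor Y) =
      Pi.single (Fin.last m).castSucc (minorLast Y) +
        Pi.single (Fin.last (m + 1)) (minorPenult Y) := by
  ext i
  rw [Matrix.mulVec, dotProduct_signedTopMinor]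
  induction i using Fin.lastCases with
  | last =>
    have h : (Fin.last (m + 1)) ≠ (Fin.last m).castSucc := (Fin.castSucc_lt_last _).ne'
    simp only [Pi.add_apply, Pi.single_eq_same, Pi.single_eq_of_ne h, zero_add, minorPenult]
    congr 2
    ext a b
    induction a using Fin.lastCases with
    | last => simp
    | cast a =>
      have : (Fin.last m).castSucc.succAbove a.castSucc = Fin.castAdd 2 a := by
        rw [Fin.succAbove_of_castSucc_lt _ _ (by simp [Fin.lt_def])]; rfl
      simp [this]
  | cast i =>
    simp only [Pi.add_apply, Pi.single_eq_of_ne (Fin.castSucc_lt_last i).ne, add_zero]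
    induction i using Fin.lastCases with
    | last =>
      simp only [Pi.single_eq_same, minorLast]
      congr 2
      ext a b
      induction a using Fin.lastCases with
      | last => simp
      | cast a =>
        simp only [Fin.succAbove_last, Matrix.of_apply, Fin.snoc_castSucc, Matrix.submatrix_apply, id]
        rfl
    | cast i =>
      rw [Pi.single_eq_of_ne (by simp [Fin.ext_iff, i.2.ne])]
      rw [Matrix.det_zero_of_row_eq (i := i.castSucc) (j := Fin.last m)
        (Fin.castSucc_lt_last i).ne, mul_zero]
      ext b
      rw [Matrix.of_apply, Matrix.of_apply, Fin.snoc_castSucc, Fin.snoc_last]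
      rfl

theorem minorLast_mem_span_signedTopMinor :
    minorLast Y ∈ Ideal.span (Set.range (signedTopMinor Y)) := by
  have := congrFun (mulVec_signedTopMinor Y) (Fin.last m).castSucc
  rw [Pi.add_apply, Pi.single_eq_same, Pi.single_eq_of_ne (Fin.castSucc_lt_last _).ne,
    add_zero] at this
  rw [← this, Matrix.mulVec, dotProduct]
  exact Ideal.sum_mem _ fun j _ => Ideal.mul_mem_left _ _ (Ideal.subset_span (Set.mem_range_self j))

theorem minorPenult_mem_span_signedTopMinor :
    minorPenult Y ∈ Ideal.span (Set.range (signedTopMinor Y)) := by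
  have := congrFun (mulVec_signedTopMinor Y) (Fin.last (m + 1))
  rw [Pi.add_apply, Pi.single_eq_same, Pi.single_eq_of_ne (Fin.castSucc_lt_last _).ne',
    zero_add] at this
  rw [← this, Matrix.mulVec, dotProduct]
  exact Ideal.sum_mem _ fun j _ => Ideal.mul_mem_left _ _ (Ideal.subset_span (Set.mem_range_self j))

theorem minorLast_mem_span_signedMaxMinor :
    minorLast Y ∈ Ideal.span (Set.range (signedMaxMinor Y)) := by
  rw [← neg_neg (minorLast Y), ← signedMaxMinor_last]
  exact Ideal.neg_mem_iff _ |>.2 (Ideal.subset_span (Set.mem_range_self _))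

theorem minorPenult_mem_span_signedMaxMinor :
    minorPenult Y ∈ Ideal.span (Set.range (signedMaxMinor Y)) := by
  rw [← signedMaxMinor_penult]
  exact Ideal.subset_span (Set.mem_range_self _)

theorem dvd_of_dvd_pow_mul {x y : R} (h : ∀ c, x ∣ y * c → x ∣ c) (n : ℕ) (c : R)
    (hc : x ∣ y ^ n * c) : x ∣ c := by
  induction n with
  | zero => simpa using hc
  | succ n ih => exact ih (h _ (by rwa [← mul_assoc, ← pow_succ']))

variable [IsDomain R]

theorem dvd_of_dvd_mul_symm {x y : R} (hx : x ≠ 0)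
    (h : ∀ c, x ∣ y * c → x ∣ c) (c : R) (hc : y ∣ x * c) : y ∣ c := by
  obtain ⟨d, hd⟩ := hc
  obtain ⟨e, rfl⟩ := h d ⟨c, hd.symm⟩
  exact ⟨e, mul_left_cancel₀ hx (by linear_combination hd)⟩

theorem pow_dvd_of_pow_dvd_pow_mul {x y : R} (hx : x ≠ 0) (hy : y ≠ 0)
    (h : ∀ c, x ∣ y * c → x ∣ c) (n : ℕ) (c : R) (hc : x ^ n ∣ y ^ n * c) : x ^ n ∣ c := by
  have h1 := dvd_of_dvd_mul_symm hx fun c => dvd_of_dvd_pow_mul h n c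
  exact dvd_of_dvd_mul_symm (pow_ne_zero n hy)
    (fun c => dvd_of_dvd_pow_mul h1 n c) c hc

theorem mem_span_pow_left_of_mul_mem {x y θ : R} (hx : x ≠ 0)
    (h : ∀ c, x ∣ y * c → x ∣ c)
    (hθ : ∀ c, θ * c ∈ Ideal.span {x, y} → c ∈ Ideal.span {x, y}) (n : ℕ) (c : R)
    (hc : θ * c ∈ Ideal.span {x ^ n, y}) : c ∈ Ideal.span {x ^ n, y} := by
  induction n generalizing c with
  | zero => simp [Ideal.mem_span_pair]; exact ⟨c, 0, by simp⟩
  | succ n ih =>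
    obtain ⟨α, β, hαβ⟩ := Ideal.mem_span_pair.1 hc
    obtain ⟨γ, ε, rfl⟩ := Ideal.mem_span_pair.1
      (ih c (Ideal.mem_span_pair.2 ⟨α * x, β, by rw [← hαβ]; ring⟩))
    obtain ⟨δ, hδ⟩ : y ∣ θ * γ - α * x :=
      dvd_of_dvd_pow_mul (dvd_of_dvd_mul_symm hx h) n _
        ⟨β - θ * ε, by linear_combination -hαβ⟩
    obtain ⟨μ, ν, rfl⟩ := Ideal.mem_span_pair.1
      (hθ γ (Ideal.mem_span_pair.2 ⟨α, δ, by linear_combination -hδ⟩))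
    exact Ideal.mem_span_pair.2 ⟨μ, ν * x ^ n + ε, by ring⟩

theorem mem_span_pow_pair_of_mul_mem {x y θ : R} (hx : x ≠ 0) (hy : y ≠ 0)
    (h : ∀ c, x ∣ y * c → x ∣ c)
    (hθ : ∀ c, θ * c ∈ Ideal.span {x, y} → c ∈ Ideal.span {x, y}) (n : ℕ) (c : R)
    (hc : θ * c ∈ Ideal.span {x ^ n, y ^ n}) : c ∈ Ideal.span {x ^ n, y ^ n} := by
  have h1 := mem_span_pow_left_of_mul_mem hx h hθ n
  have h2 := dvd_of_dvd_mul_symm (pow_ne_zero n hx)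
    (dvd_of_dvd_mul_symm hy
      (dvd_of_dvd_pow_mul (dvd_of_dvd_mul_symm hx h) n))
  rw [Set.pair_comm] at hc ⊢
  refine mem_span_pow_left_of_mul_mem hy
    (dvd_of_dvd_pow_mul (dvd_of_dvd_mul_symm hx h) n) (fun c => ?_) n c hc
  rw [Set.pair_comm]
  exact h1 c

theorem mem_span_pow_pair_of_pow_mul_mem {x y θ : R} (hx : x ≠ 0) (hy : y ≠ 0)
    (h : ∀ c, x ∣ y * c → x ∣ c)
    (hθ : ∀ c, θ * c ∈ Ideal.span {x, y} → c ∈ Ideal.span {x, y}) (n k : ℕ) (c : R)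
    (hc : θ ^ k * c ∈ Ideal.span {x ^ n, y ^ n}) : c ∈ Ideal.span {x ^ n, y ^ n} := by
  induction k with
  | zero => simpa using hc
  | succ k ih =>
    exact ih (mem_span_pow_pair_of_mul_mem hx hy h hθ n _ (by rwa [← mul_assoc, ← pow_succ']))

variable {Y}

theorem eq_zero_of_mulVec_eq_zero_of_minorLast (hx : minorLast Y ≠ 0) {b : Fin (m + 1) → R}
    (hb : Y.mulVec b = 0) : b = 0 := by
  refine Matrix.eq_zero_of_mulVec_eq_zero (right_ne_zero_of_mul hx) ?_
  ext i
  exact congrFun hb ((Fin.last (m + 1)).succAbove i)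

theorem exists_mulVec_eq_minor_smul {r : Fin (m + 2)} (hr : signedMaxMinor Y r ≠ 0)
    {u : Fin (m + 2) → R} (hu : signedMaxMinor Y ⬝ᵥ u = 0) :
    ∃ b, Y.mulVec b = (Y.submatrix r.succAbove id).det • u := by
  set A := Y.submatrix r.succAbove id with hA
  refine ⟨A.adjugate.mulVec fun i => u (r.succAbove i), ?_⟩
  set b := A.adjugate.mulVec fun i => u (r.succAbove i)
  have h1 : ∀ i, Y.mulVec b (r.succAbove i) = A.det * u (r.succAbove i) := by
    intro i
    have : A.mulVec b = A.det • fun i => u (r.succAbove i) := by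
      rw [Matrix.mulVec_mulVec, Matrix.mul_adjugate, Matrix.smul_mulVec, Matrix.one_mulVec]
    exact congrFun this i
  have h2 : signedMaxMinor Y ⬝ᵥ (Y.mulVec b - A.det • u) = 0 := by
    rw [dotProduct_sub, Matrix.dotProduct_mulVec, signedMaxMinor_vecMul, zero_dotProduct,
      dotProduct_smul, hu, smul_zero, sub_zero]
  rw [← sub_eq_zero]
  ext i
  obtain rfl | ⟨j, rfl⟩ := Fin.eq_self_or_eq_succAbove r i
  · rw [dotProduct, Fin.sum_univ_succAbove _ i, Finset.sum_eq_zero, add_zero] at h2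
    · exact (mul_eq_zero.1 h2).resolve_left hr
    · intro j _
      simp [h1]
  · simp [h1]

theorem exists_eq_mulVec_of_dotProduct_eq_zero (hx : minorLast Y ≠ 0) (hy : minorPenult Y ≠ 0)
    (hxy : ∀ c, minorLast Y ∣ minorPenult Y * c → minorLast Y ∣ c)
    {u : Fin (m + 2) → R} (hu : signedMaxMinor Y ⬝ᵥ u = 0) : ∃ b, u = Y.mulVec b := by
  obtain ⟨b₀, hb₀⟩ := exists_mulVec_eq_minor_smul (r := Fin.last (m + 1))
    (by rwa [signedMaxMinor_last, neg_ne_zero]) hu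
  obtain ⟨b₁, hb₁⟩ := exists_mulVec_eq_minor_smul (r := (Fin.last m).castSucc)
    (by rwa [signedMaxMinor_penult]) hu
  have h0 : Y.mulVec ((-1 : R) ^ m • b₀) = minorLast Y • u := by
    rw [Matrix.mulVec_smul, hb₀, smul_smul]; rfl
  have h1 : Y.mulVec ((-1 : R) ^ m • b₁) = minorPenult Y • u := by
    rw [Matrix.mulVec_smul, hb₁, smul_smul]; rfl
  have h2 : minorPenult Y • ((-1 : R) ^ m • b₀) - minorLast Y • ((-1 : R) ^ m • b₁) = 0 := by
    refine eq_zero_of_mulVec_eq_zero_of_minorLast hx ?_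
    rw [Matrix.mulVec_sub, Matrix.mulVec_smul Y (minorPenult Y), Matrix.mulVec_smul Y (minorLast Y),
      h0, h1, smul_comm, sub_self]
  have h3 : ∀ j, minorLast Y ∣ ((-1 : R) ^ m • b₀) j := fun j =>
    hxy _ ⟨_, sub_eq_zero.1 (congrFun h2 j)⟩
  choose b hb using h3
  refine ⟨b, ?_⟩
  have h4 : (-1 : R) ^ m • b₀ = minorLast Y • b := funext hb
  rw [h4, Matrix.mulVec_smul] at h0
  exact (smul_right_injective _ hx h0).symm

theorem signedMaxMinor_mul_signedTopMinor_mem (hx : minorLast Y ≠ 0) (hy : minorPenult Y ≠ 0)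
    (hxy : ∀ c, minorLast Y ∣ minorPenult Y * c → minorLast Y ∣ c) (i : Fin (m + 2))
    (j : Fin (m + 1)) :
    signedMaxMinor Y i * signedTopMinor Y j ∈ Ideal.span {minorLast Y, minorPenult Y} := by
  obtain ⟨b, hb⟩ := exists_eq_mulVec_of_dotProduct_eq_zero hx hy hxy
    (u := Pi.single (Fin.last m).castSucc (signedMaxMinor Y i) - Pi.single i (minorPenult Y))
    (by rw [dotProduct_sub, dotProduct_single, dotProduct_single, signedMaxMinor_penult]; ring)
  obtain ⟨c, hc⟩ := exists_eq_mulVec_of_dotProduct_eq_zero hx hy hxy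
    (u := Pi.single (Fin.last (m + 1)) (signedMaxMinor Y i) + Pi.single i (minorLast Y))
    (by rw [dotProduct_add, dotProduct_single, dotProduct_single, signedMaxMinor_last]; ring)
  have h : minorLast Y • b + minorPenult Y • c - signedMaxMinor Y i • signedTopMinor Y = 0 := by
    refine eq_zero_of_mulVec_eq_zero_of_minorLast hx ?_
    rw [Matrix.mulVec_sub, Matrix.mulVec_add, Matrix.mulVec_smul, Matrix.mulVec_smul,
      Matrix.mulVec_smul, ← hb, ← hc, mulVec_signedTopMinor]
    simp only [smul_add, smul_sub, ← Pi.single_smul, smul_eq_mul]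
    rw [mul_comm (minorLast Y) (signedMaxMinor Y i), mul_comm (minorPenult Y) (signedMaxMinor Y i),
      mul_comm (minorPenult Y) (minorLast Y)]
    abel
  have := congrFun h j
  simp only [Pi.sub_apply, Pi.add_apply, Pi.smul_apply, smul_eq_mul, Pi.zero_apply] at this
  exact Ideal.mem_span_pair.2 ⟨b j, c j, by linear_combination this⟩

theorem mem_span_signedMaxMinor_of_mul_mem (hy : minorPenult Y ≠ 0) (hx : minorLast Y ≠ 0)
    (hxy : ∀ c, minorLast Y ∣ minorPenult Y * c → minorLast Y ∣ c) {f : R}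
    (hf : ∀ j, f * signedTopMinor Y j ∈ Ideal.span {minorLast Y, minorPenult Y}) :
    f ∈ Ideal.span (Set.range (signedMaxMinor Y)) := by
  choose α β hαβ using fun j => Ideal.mem_span_pair.1 (hf j)
  have h1 : minorLast Y • (Pi.single (Fin.last m).castSucc f - Y.mulVec α) =
      minorPenult Y • (Y.mulVec β - Pi.single (Fin.last (m + 1)) f) := by
    have : minorLast Y • α + minorPenult Y • β = f • signedTopMinor Y := by
      ext j
      simp only [Pi.add_apply, Pi.smul_apply, smul_eq_mul]
      linear_combination hαβ j
    have := congrArg Y.mulVec this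
    rw [Matrix.mulVec_add, Matrix.mulVec_smul, Matrix.mulVec_smul, Matrix.mulVec_smul,
      mulVec_signedTopMinor, smul_add] at this
    simp only [← Pi.single_smul, smul_eq_mul] at this
    rw [smul_sub, smul_sub, sub_eq_sub_iff_add_eq_add, ← Pi.single_smul, ← Pi.single_smul,
      smul_eq_mul, smul_eq_mul, mul_comm _ f, mul_comm _ f, ← this]
    exact add_comm _ _
  have h2 : ∀ i, minorPenult Y ∣
      ((Pi.single (Fin.last m).castSucc f : Fin (m + 2) → R) - Y.mulVec α) i := fun i =>
    dvd_of_dvd_mul_symm hx hxy _ ⟨_, congrFun h1 i⟩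
  choose z hz using h2
  have h3 : Pi.single (Fin.last m).castSucc f - Y.mulVec α = minorPenult Y • z := funext hz
  have h4 := congrArg (signedMaxMinor Y ⬝ᵥ ·) h3
  simp only [dotProduct_sub, Matrix.dotProduct_mulVec, signedMaxMinor_vecMul, zero_dotProduct,
    dotProduct_smul, dotProduct_single, signedMaxMinor_penult, sub_zero, smul_eq_mul] at h4
  rw [mul_left_cancel₀ hy h4]
  exact Ideal.sum_mem _ fun i _ => Ideal.mul_mem_right _ _ (Ideal.subset_span (Set.mem_range_self i))

theorem mem_span_signedTopMinor_of_mul_mem (hx : minorLast Y ≠ 0) (hy : minorPenult Y ≠ 0)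
    (hxy : ∀ c, minorLast Y ∣ minorPenult Y * c → minorLast Y ∣ c) {f : R}
    (hf : ∀ i, f * signedMaxMinor Y i ∈ Ideal.span {minorLast Y, minorPenult Y}) :
    f ∈ Ideal.span (Set.range (signedTopMinor Y)) := by
  have hne : (Fin.last m).castSucc ≠ Fin.last (m + 1) := (Fin.castSucc_lt_last _).ne
  have key : ∀ i, ∃ α β : R, α * minorLast Y + β * minorPenult Y = f * signedMaxMinor Y i ∧
      (i = (Fin.last m).castSucc → α = 0 ∧ β = f) ∧ (i = Fin.last (m + 1) → α = -f ∧ β = 0) := by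
    intro i
    by_cases h : i = (Fin.last m).castSucc
    · subst h
      exact ⟨0, f, by rw [signedMaxMinor_penult]; ring, by simp, fun h => absurd h hne⟩
    by_cases h' : i = Fin.last (m + 1)
    · subst h'
      exact ⟨-f, 0, by rw [signedMaxMinor_last]; ring, fun h => absurd h.symm hne, by simp⟩
    obtain ⟨α, β, h1⟩ := Ideal.mem_span_pair.1 (hf i)
    exact ⟨α, β, h1, fun h'' => absurd h'' h, fun h'' => absurd h'' h'⟩
  choose α β hαβ hpen hlast using key
  obtain ⟨hα, hβ⟩ := hpen _ rfl
  obtain ⟨hα', hβ'⟩ := hlast _ rfl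
  have h1 : minorLast Y • Matrix.vecMul α Y = -(minorPenult Y • Matrix.vecMul β Y) := by
    have : minorLast Y • α + minorPenult Y • β = f • signedMaxMinor Y := by
      ext j
      simp only [Pi.add_apply, Pi.smul_apply, smul_eq_mul]
      linear_combination hαβ j
    have := congrArg (Matrix.vecMul · Y) this
    simp only [Matrix.add_vecMul, Matrix.smul_vecMul, signedMaxMinor_vecMul, smul_zero] at this
    exact eq_neg_of_add_eq_zero_left this
  have h2 : ∀ j, minorPenult Y ∣ Matrix.vecMul α Y j := fun j =>
    dvd_of_dvd_mul_symm hx hxy _ ⟨-Matrix.vecMul β Y j, by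
      have := congrFun h1 j
      simp only [Pi.smul_apply, Pi.neg_apply, smul_eq_mul] at this
      linear_combination this⟩
  choose z hz using h2
  have h3 : Matrix.vecMul α Y = minorPenult Y • z := funext hz
  have h4 := congrArg (· ⬝ᵥ signedTopMinor Y) h3
  simp only [← Matrix.dotProduct_mulVec, mulVec_signedTopMinor, dotProduct_add,
    dotProduct_single, hα, hα', smul_dotProduct, smul_eq_mul] at h4
  have h5 : f = -(z ⬝ᵥ signedTopMinor Y) := mul_left_cancel₀ hy (by linear_combination -h4)
  rw [h5]
  exact neg_mem (Ideal.sum_mem _ fun i _ =>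
    Ideal.mul_mem_left _ _ (Ideal.subset_span (Set.mem_range_self i)))

/-- A vector whose image under `Y` vanishes modulo the `(n + 1)`-st powers of the two minors
is a multiple of the vector of top minors modulo these powers. -/
theorem exists_sub_mul_signedTopMinor_mem (hx : minorLast Y ≠ 0) (hy : minorPenult Y ≠ 0)
    (hxy : ∀ c, minorLast Y ∣ minorPenult Y * c → minorLast Y ∣ c) (n : ℕ)
    {a : Fin (m + 1) → R}
    (ha : ∀ i, Y.mulVec a i ∈ Ideal.span {minorLast Y ^ (n + 1), minorPenult Y ^ (n + 1)}) :
    ∃ τ, ∀ j, a j - τ * (minorLast Y * minorPenult Y) ^ n * signedTopMinor Y j ∈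
      Ideal.span {minorLast Y ^ (n + 1), minorPenult Y ^ (n + 1)} := by
  choose u v huv using fun i => Ideal.mem_span_pair.1 (ha i)
  set x := minorLast Y with hx_def
  set y := minorPenult Y with hy_def
  have h1 : x ^ (n + 1) • u + y ^ (n + 1) • v = Y.mulVec a := by
    ext i
    simp only [Pi.add_apply, Pi.smul_apply, smul_eq_mul]
    linear_combination huv i
  have h2 := congrArg (signedMaxMinor Y ⬝ᵥ ·) h1
  simp only [dotProduct_add, dotProduct_smul, Matrix.dotProduct_mulVec, signedMaxMinor_vecMul,
    zero_dotProduct, smul_eq_mul] at h2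
  obtain ⟨τ, hτ⟩ : x ^ (n + 1) ∣ signedMaxMinor Y ⬝ᵥ v :=
    pow_dvd_of_pow_dvd_pow_mul hx hy hxy _ _
      ⟨-(signedMaxMinor Y ⬝ᵥ u), by linear_combination h2⟩
  have hτ' : signedMaxMinor Y ⬝ᵥ u = -(y ^ (n + 1) * τ) :=
    mul_left_cancel₀ (pow_ne_zero (n + 1) hx) (by rw [hτ] at h2; linear_combination h2)
  obtain ⟨b, hb⟩ := exists_eq_mulVec_of_dotProduct_eq_zero hx hy hxy
    (u := u + Pi.single (Fin.last m).castSucc (y ^ n * τ))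
    (by rw [dotProduct_add, dotProduct_single, signedMaxMinor_penult, hτ']; ring)
  obtain ⟨c, hc⟩ := exists_eq_mulVec_of_dotProduct_eq_zero hx hy hxy
    (u := v + Pi.single (Fin.last (m + 1)) (x ^ n * τ))
    (by rw [dotProduct_add, dotProduct_single, signedMaxMinor_last, hτ]; ring)
  have h3 : a - (x ^ (n + 1) • b + y ^ (n + 1) • c - (τ * (x * y) ^ n) • signedTopMinor Y) = 0 := by
    refine eq_zero_of_mulVec_eq_zero_of_minorLast hx ?_
    rw [Matrix.mulVec_sub, Matrix.mulVec_sub, Matrix.mulVec_add, Matrix.mulVec_smul,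
      Matrix.mulVec_smul, Matrix.mulVec_smul, ← hb, ← hc, mulVec_signedTopMinor, ← h1]
    simp only [smul_add, ← Pi.single_smul, smul_eq_mul]
    rw [← hx_def, ← hy_def,
      show x ^ (n + 1) * (y ^ n * τ) = τ * (x * y) ^ n * x by rw [mul_pow]; ring,
      show y ^ (n + 1) * (x ^ n * τ) = τ * (x * y) ^ n * y by rw [mul_pow]; ring]
    abel
  refine ⟨-τ, fun j => Ideal.mem_span_pair.2 ⟨b j, c j, ?_⟩⟩
  have := congrFun h3 j
  simp only [Pi.sub_apply, Pi.add_apply, Pi.smul_apply, smul_eq_mul, Pi.zero_apply] at this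
  linear_combination -this

end HilbertBurch
section Frobenius

variable {R : Type} [CommRing R] {m : ℕ} (p : ℕ) [ExpChar R p]

theorem frobPow_eq_map (a : Ideal R) : frobPow p a = a.map (frobenius R p) := rfl

theorem frobPow_sup (a b : Ideal R) : frobPow p (a ⊔ b) = frobPow p a ⊔ frobPow p b := by
  rw [frobPow_eq_map, frobPow_eq_map, frobPow_eq_map, Ideal.map_sup]

theorem signedMaxMinor_map_frobenius (Y : Matrix (Fin (m + 2)) (Fin (m + 1)) R) (i) :
    signedMaxMinor (Y.map (frobenius R p)) i = signedMaxMinor Y i ^ p := by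
  rw [← frobenius_def, signedMaxMinor, signedMaxMinor, map_mul, map_pow, map_neg, map_one,
    RingHom.map_det]
  rfl

theorem signedTopMinor_map_frobenius (Y : Matrix (Fin (m + 2)) (Fin (m + 1)) R) (j) :
    signedTopMinor (Y.map (frobenius R p)) j = signedTopMinor Y j ^ p := by
  rw [← frobenius_def, signedTopMinor, signedTopMinor, map_mul, map_pow, map_neg, map_one,
    RingHom.map_det]
  rfl

theorem minorLast_map_frobenius (Y : Matrix (Fin (m + 2)) (Fin (m + 1)) R) :
    minorLast (Y.map (frobenius R p)) = minorLast Y ^ p := by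
  rw [← frobenius_def, minorLast, minorLast, map_mul, map_pow, map_neg, map_one,
    RingHom.map_det]
  rfl

theorem minorPenult_map_frobenius (Y : Matrix (Fin (m + 2)) (Fin (m + 1)) R) :
    minorPenult (Y.map (frobenius R p)) = minorPenult Y ^ p := by
  rw [← frobenius_def, minorPenult, minorPenult, map_mul, map_pow, map_neg, map_one,
    RingHom.map_det]
  rfl

theorem frobPow_span_signedMaxMinor (Y : Matrix (Fin (m + 2)) (Fin (m + 1)) R) :
    frobPow p (Ideal.span (Set.range (signedMaxMinor Y))) =
      Ideal.span (Set.range (signedMaxMinor (Y.map (frobenius R p)))) := by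
  rw [frobPow_eq_map, Ideal.map_span, ← Set.range_comp]
  congr 2
  ext i
  exact (signedMaxMinor_map_frobenius p Y i).symm

theorem frobPow_span_signedTopMinor (Y : Matrix (Fin (m + 2)) (Fin (m + 1)) R) :
    frobPow p (Ideal.span (Set.range (signedTopMinor Y))) =
      Ideal.span (Set.range (signedTopMinor (Y.map (frobenius R p)))) := by
  rw [frobPow_eq_map, Ideal.map_span, ← Set.range_comp]
  congr 2
  ext i
  exact (signedTopMinor_map_frobenius p Y i).symm

theorem pow_mul_mem_span_pow_pair {x y f : R} {n : ℕ} (hf : f ∈ Ideal.span {x, y}) :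
    (x * y) ^ n * f ∈ Ideal.span {x ^ (n + 1), y ^ (n + 1)} := by
  obtain ⟨α, β, rfl⟩ := Ideal.mem_span_pair.1 hf
  exact Ideal.mem_span_pair.2 ⟨α * y ^ n, β * x ^ n, by rw [mul_pow]; ring⟩

variable [IsDomain R]

theorem colon_frobPow_inf_colon_frobPow (hp : p ≠ 0) (Y : Matrix (Fin (m + 2)) (Fin (m + 1)) R)
    (hx : minorLast Y ≠ 0) (hy : minorPenult Y ≠ 0)
    (hxy : ∀ c, minorLast Y ∣ minorPenult Y * c → minorLast Y ∣ c) {I P : Ideal R}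
    (hI : I = Ideal.span (Set.range (signedMaxMinor Y)))
    (hP : P = Ideal.span (Set.range (signedTopMinor Y))) {θ : R} (hθ : θ ∈ I ⊔ P)
    (hθreg : ∀ c, θ * c ∈ Ideal.span {minorLast Y, minorPenult Y} →
      c ∈ Ideal.span {minorLast Y, minorPenult Y}) :
    Submodule.colon (frobPow p I) I ⊓ Submodule.colon (frobPow p (I ⊔ P)) (I ⊔ P : Ideal R) =
      frobPow p I ⊔ Ideal.span {(minorLast Y * minorPenult Y) ^ (p - 1)} := by
  obtain ⟨n, hn⟩ : ∃ n, p = n + 1 := Nat.exists_eq_succ_of_ne_zero hp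
  rw [show p - 1 = n by omega]
  set Z := Y.map (frobenius R p) with hZ
  have hZx : minorLast Z = minorLast Y ^ p := minorLast_map_frobenius p Y
  have hZy : minorPenult Z = minorPenult Y ^ p := minorPenult_map_frobenius p Y
  have hsZ : ∀ i, signedMaxMinor Z i = signedMaxMinor Y i ^ p := signedMaxMinor_map_frobenius p Y
  have htZ : ∀ i, signedTopMinor Z i = signedTopMinor Y i ^ p := signedTopMinor_map_frobenius p Y
  have hIq : frobPow p I = Ideal.span (Set.range (signedMaxMinor Z)) := by
    rw [hI, frobPow_span_signedMaxMinor]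
  have hPq : frobPow p P = Ideal.span (Set.range (signedTopMinor Z)) := by
    rw [hP, frobPow_span_signedTopMinor]
  have hΩq : frobPow p (I ⊔ P) = frobPow p I ⊔ frobPow p P := frobPow_sup p I P
  set J := Ideal.span {minorLast Y, minorPenult Y}
  set Jq := Ideal.span {minorLast Y ^ p, minorPenult Y ^ p} with hJq
  have hJZ : Ideal.span {minorLast Z, minorPenult Z} = Jq := by rw [hZx, hZy]
  have hxZ : minorLast Z ≠ 0 := by rw [hZx]; exact pow_ne_zero _ hx
  have hyZ : minorPenult Z ≠ 0 := by rw [hZy]; exact pow_ne_zero _ hy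
  have hxyZ : ∀ c, minorLast Z ∣ minorPenult Z * c → minorLast Z ∣ c := by
    rw [hZx, hZy]; exact pow_dvd_of_pow_dvd_pow_mul hx hy hxy p
  have hs : ∀ i, signedMaxMinor Y i ∈ I := fun i => hI ▸ Ideal.subset_span (Set.mem_range_self i)
  have ht : ∀ j, signedTopMinor Y j ∈ P := fun j => hP ▸ Ideal.subset_span (Set.mem_range_self j)
  have hJqI : Jq ≤ frobPow p I := by
    rw [hIq, ← hJZ, Ideal.span_le]
    rintro _ (rfl | rfl)
    exacts [minorLast_mem_span_signedMaxMinor Z, minorPenult_mem_span_signedMaxMinor Z]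
  have hJqP : Jq ≤ frobPow p P := by
    rw [hPq, ← hJZ, Ideal.span_le]
    rintro _ (rfl | rfl)
    exacts [minorLast_mem_span_signedTopMinor Z, minorPenult_mem_span_signedTopMinor Z]
  have hst := signedMaxMinor_mul_signedTopMinor_mem hx hy hxy
  have hstZ := signedMaxMinor_mul_signedTopMinor_mem hxZ hyZ hxyZ
  rw [hJZ] at hstZ
  have hIP : frobPow p I ≤ Submodule.colon Jq (frobPow p P) := by
    rw [hIq, hPq, Ideal.span_le]
    rintro _ ⟨i, rfl⟩
    refine Submodule.mem_colon.2 fun f hf => ?_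
    refine Submodule.span_induction ?_ ?_ ?_ ?_ hf
    · rintro _ ⟨j, rfl⟩
      exact hstZ i j
    · simp
    · intro a b _ _ ha hb
      rw [smul_add]; exact add_mem ha hb
    · intro a b _ hb
      rw [smul_comm]; exact Ideal.mul_mem_left _ _ hb
  have hinf : frobPow p I ⊓ frobPow p P ≤ Jq := by
    rintro f ⟨hfI, hfP⟩
    refine mem_span_pow_pair_of_pow_mul_mem hx hy hxy hθreg p p f ?_
    have hθq : θ ^ p ∈ frobPow p (I ⊔ P) := Ideal.subset_span ⟨θ, hθ, rfl⟩
    rw [hΩq] at hθq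
    obtain ⟨a, ha, b, hb, hab⟩ := Submodule.mem_sup.1 hθq
    rw [← hab, add_mul]
    refine add_mem (Submodule.mem_colon.1 (hIP ha) f hfP) ?_
    rw [mul_comm]
    exact Submodule.mem_colon.1 (hIP hfI) b hb
  have hcolonI : ∀ f, (∀ j, f * signedTopMinor Y j ^ p ∈ Jq) → f ∈ frobPow p I := by
    intro f hf
    rw [hIq]
    refine mem_span_signedMaxMinor_of_mul_mem hyZ hxZ hxyZ fun j => ?_
    rw [htZ, hJZ]
    exact hf j
  have hcolonP : ∀ f, (∀ i, f * signedMaxMinor Y i ^ p ∈ Jq) → f ∈ frobPow p P := by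
    intro f hf
    rw [hPq]
    refine mem_span_signedTopMinor_of_mul_mem hxZ hyZ hxyZ fun i => ?_
    rw [hsZ, hJZ]
    exact hf i
  have htq : ∀ j, signedTopMinor Y j ^ p ∈ frobPow p P := fun j =>
    Ideal.subset_span ⟨_, ht j, rfl⟩
  have hsq : ∀ i, signedMaxMinor Y i ^ p ∈ frobPow p I := fun i =>
    Ideal.subset_span ⟨_, hs i, rfl⟩
  obtain ⟨g, hg⟩ : ∃ g, g = (minorLast Y * minorPenult Y) ^ n := ⟨_, rfl⟩
  rw [← hg]
  have hgst : ∀ i j, g * (signedMaxMinor Y i * signedTopMinor Y j) ∈ Jq := fun i j => by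
    rw [hg, hJq, hn]
    exact pow_mul_mem_span_pow_pair (hst i j)
  have hgs : ∀ i, g * signedMaxMinor Y i ∈ frobPow p I := fun i => hcolonI _ fun j => by
    have := Ideal.mul_mem_left _ (signedTopMinor Y j ^ n) (hgst i j)
    rw [hn, pow_succ]
    convert this using 1
    ring
  have hgt : ∀ j, g * signedTopMinor Y j ∈ frobPow p P := fun j => hcolonP _ fun i => by
    have := Ideal.mul_mem_left _ (signedMaxMinor Y i ^ n) (hgst i j)
    rw [hn, pow_succ]
    convert this using 1
    ring
  have hgI : ∀ f ∈ I, g * f ∈ frobPow p I := by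
    intro f hf
    rw [hI] at hf
    refine Submodule.span_induction ?_ ?_ ?_ ?_ hf
    · rintro _ ⟨i, rfl⟩
      exact hgs i
    · simp
    · intro a b _ _ ha hb
      rw [mul_add]; exact add_mem ha hb
    · intro a b _ hb
      rw [smul_eq_mul, mul_left_comm]; exact Ideal.mul_mem_left _ _ hb
  have hgP : ∀ f ∈ P, g * f ∈ frobPow p P := by
    intro f hf
    rw [hP] at hf
    refine Submodule.span_induction ?_ ?_ ?_ ?_ hf
    · rintro _ ⟨i, rfl⟩
      exact hgt i
    · simp
    · intro a b _ _ ha hb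
      rw [mul_add]; exact add_mem ha hb
    · intro a b _ hb
      rw [smul_eq_mul, mul_left_comm]; exact Ideal.mul_mem_left _ _ hb
  apply le_antisymm
  · rintro h ⟨hhI, hhΩ⟩
    have hhI' : ∀ f ∈ I, h * f ∈ frobPow p I := fun f hf => Submodule.mem_colon.1 hhI f hf
    have hht : ∀ j, ∃ φ ∈ frobPow p P, h * signedTopMinor Y j - φ ∈ frobPow p I := by
      intro j
      have := Submodule.mem_colon.1 hhΩ _ (show signedTopMinor Y j ∈ I ⊔ P from
        le_sup_right (a := I) (ht j))
      rw [hΩq] at this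
      obtain ⟨a, ha, b, hb, hab⟩ := Submodule.mem_sup.1 this
      exact ⟨b, hb, by rw [← smul_eq_mul, ← hab]; simpa using ha⟩
    choose φ hφP hφI using hht
    have hYt : ∀ i, Y.mulVec (signedTopMinor Y) i ∈ I := by
      intro i
      rw [mulVec_signedTopMinor, hI]
      refine add_mem ?_ ?_
      · rw [Pi.single_apply]
        split_ifs
        exacts [minorLast_mem_span_signedMaxMinor Y, zero_mem _]
      · rw [Pi.single_apply]
        split_ifs
        exacts [minorPenult_mem_span_signedMaxMinor Y, zero_mem _]
    have hYφ : ∀ i, Y.mulVec φ i ∈ Jq := by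
      intro i
      refine hinf ⟨?_, ?_⟩
      swap
      · rw [Matrix.mulVec, dotProduct]
        exact Ideal.sum_mem _ fun j _ => Ideal.mul_mem_left _ _ (hφP j)
      have h1 : h * Y.mulVec (signedTopMinor Y) i - ∑ j, Y i j * (h * signedTopMinor Y j - φ j) =
          Y.mulVec φ i := by
        simp only [Matrix.mulVec, dotProduct, Finset.mul_sum, ← Finset.sum_sub_distrib]
        exact Finset.sum_congr rfl fun j _ => by ring
      rw [← h1]
      exact sub_mem (hhI' _ (hYt i)) (Ideal.sum_mem _ fun j _ => Ideal.mul_mem_left _ _ (hφI j))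
    obtain ⟨τ, hτ⟩ := exists_sub_mul_signedTopMinor_mem hx hy hxy n (a := φ)
      (by rwa [← hn])
    rw [← hn, ← hJq, ← hg] at hτ
    have h2 : ∀ j, (h - τ * g) * signedTopMinor Y j ∈ frobPow p I := by
      intro j
      convert add_mem (hφI j) (hJqI (hτ j)) using 1
      ring
    have h3 : h - τ * g ∈ frobPow p I := by
      refine hcolonI _ fun j => hinf ⟨?_, Ideal.mul_mem_left _ _ (htq j)⟩
      rw [show (h - τ * g) * signedTopMinor Y j ^ p =
        (h - τ * g) * signedTopMinor Y j * signedTopMinor Y j ^ n by rw [hn]; ring]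
      exact Ideal.mul_mem_right _ _ (h2 j)
    rw [← sub_add_cancel h (τ * g)]
    exact Submodule.add_mem_sup h3 (Ideal.mul_mem_left _ _ (Ideal.mem_span_singleton_self g))
  · rw [sup_le_iff, Ideal.span_singleton_le_iff_mem]
    refine ⟨fun f hf => ⟨Submodule.mem_colon.2 fun r _ => Ideal.mul_mem_right _ _ hf,
      Submodule.mem_colon.2 fun r _ => Ideal.mul_mem_right _ _ ?_⟩, Submodule.mem_colon.2 hgI,
      Submodule.mem_colon.2 fun r hr => ?_⟩
    · rw [hΩq]; exact Ideal.mem_sup_left hf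
    · obtain ⟨a, ha, b, hb, rfl⟩ := Submodule.mem_sup.1 hr
      rw [hΩq, smul_add]
      exact Submodule.add_mem_sup (hgI a ha) (hgP b hb)

end Frobenius

section RegularSequence

open RingTheory.Sequence

theorem isWeaklyRegular_self_iff {R : Type*} [CommRing R] (rs : List R) :
    IsWeaklyRegular R rs ↔ ∀ i (h : i < rs.length) (c : R),
      rs[i] * c ∈ Ideal.ofList (rs.take i) → c ∈ Ideal.ofList (rs.take i) := by
  rw [isWeaklyRegular_iff]
  refine forall₂_congr fun i hi => ?_
  rw [isSMulRegular_quotient_iff_mem_of_smul_mem]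
  simp [Ideal.mul_top]

end RegularSequence

section Variables

open MvPowerSeries

variable {σ k : Type*} [Field k]

theorem mem_span_X_image_of_coeff_eq_zero (S : Finset σ) (f : MvPowerSeries σ k)
    (hf : ∀ d : σ →₀ ℕ, (∀ s ∈ S, d s = 0) → coeff d f = 0) :
    f ∈ Ideal.span (X (R := k) '' (S : Set σ)) := by
  classical
  induction S using Finset.induction_on generalizing f with
  | empty =>
    have : f = 0 := by ext d; simpa using hf d
    rw [this]
    exact zero_mem _
  | insert t S _ ih =>
    let g : MvPowerSeries σ k := fun d => if d t = 0 then 0 else coeff d f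
    have hg : ∀ d, coeff d g = if d t = 0 then 0 else coeff d f := fun d => rfl
    obtain ⟨g', hg'⟩ : X t ∣ g := X_dvd_iff.2 fun d hd => by rw [hg, if_pos hd]
    have h1 := ih (f - g) fun d hd => by
      rw [map_sub, hg]
      split_ifs with h
      · rw [sub_zero]
        exact hf d (by simpa [h] using hd)
      · exact sub_self _
    rw [Finset.coe_insert, Set.image_insert_eq, Ideal.span_insert]
    rw [← sub_add_cancel f g]
    refine add_mem (Ideal.mem_sup_right h1) (Ideal.mem_sup_left ?_)
    rw [hg']
    exact Ideal.mul_mem_right _ _ (Ideal.mem_span_singleton_self _)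

/-- The power series ring homomorphism killing the variables in `S`. -/
noncomputable def killVars (S : Set σ) :
    MvPowerSeries σ k →ₐ[k] MvPowerSeries {s // s ∉ S} k :=
  killCompl (Function.Embedding.subtype _)

theorem killVars_X_of_mem {S : Set σ} {s : σ} (h : s ∈ S) :
    killVars (k := k) S (X s) = 0 :=
  killCompl_X_eq_zero (by simpa using h)

theorem killVars_X_of_notMem {S : Set σ} {s : σ} (h : s ∉ S) :
    killVars (k := k) S (X s) = X ⟨s, h⟩ :=
  killCompl_X (e := Function.Embedding.subtype _) ⟨s, h⟩

variable [Finite σ]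

theorem ker_killVars (S : Set σ) :
    RingHom.ker (killVars (k := k) S) = Ideal.span (X (R := k) '' S) := by
  apply le_antisymm
  · intro f hf
    have := mem_span_X_image_of_coeff_eq_zero S.toFinite.toFinset f fun d hd => ?_
    · simpa using this
    classical
    obtain ⟨x, rfl⟩ : d ∈ Set.range (Finsupp.embDomain (Function.Embedding.subtype (· ∉ S))) := by
      rw [Finsupp.mem_range_embDomain_iff]
      intro s hs
      simp only [Finset.mem_coe, Finsupp.mem_support_iff] at hs
      have : s ∉ S := fun h => hs (hd s (by simpa using h))
      simpa using this
    exact DFunLike.congr_arg (coeff x) (RingHom.mem_ker.1 hf)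
  · rw [Ideal.span_le]
    rintro _ ⟨s, hs, rfl⟩
    exact RingHom.mem_ker.2 (killVars_X_of_mem hs)

instance isPrime_span_X_image (S : Set σ) : (Ideal.span (X (R := k) '' S)).IsPrime := by
  rw [← ker_killVars]
  have : IsDomain (MvPowerSeries {s // s ∉ S} k) := NoZeroDivisors.to_isDomain _
  exact RingHom.ker_isPrime _

theorem X_notMem_span_X_image {S : Set σ} {s : σ} (h : s ∉ S) :
    X s ∉ Ideal.span (X (R := k) '' S) := by
  rw [← ker_killVars, RingHom.mem_ker, killVars_X_of_notMem h]
  intro h0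
  simpa using congrArg (coeff (Finsupp.single (⟨s, h⟩ : {s // s ∉ S}) 1)) h0

open RingTheory.Sequence

/-- A list of elements of the maximal ideal which is regular modulo some of the variables is
regular. -/
theorem isWeaklyRegular_of_regular_mod_variables (S : Set σ) (rs : List (MvPowerSeries σ k))
    (hrs : ∀ r ∈ rs, constantCoeff r = 0)
    (h : ∀ i (hi : i < rs.length) c,
      rs[i] * c ∈ Ideal.span (X '' S) ⊔ Ideal.ofList (rs.take i) →
        c ∈ Ideal.span (X '' S) ⊔ Ideal.ofList (rs.take i)) :
    IsWeaklyRegular (MvPowerSeries σ k) rs := by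
  have hS : Ideal.ofList (S.toFinite.toFinset.toList.map (X (R := k))) =
      Ideal.span (X (R := k) '' S) := by
    rw [Ideal.ofList]
    congr 1
    ext f
    simp
  have h1 : IsWeaklyRegular (MvPowerSeries σ k)
      (S.toFinite.toFinset.toList.map (X (R := k)) ++ rs) := by
    rw [isWeaklyRegular_self_iff]
    intro i hi c
    rw [List.getElem_append, List.take_append]
    split_ifs with hi'
    · rw [List.length_map] at hi'
      have h2 : Ideal.ofList ((S.toFinite.toFinset.toList.map (X (R := k))).take i) =
          Ideal.span (X (R := k) '' {s | s ∈ S.toFinite.toFinset.toList.take i}) := by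
        rw [Ideal.ofList, ← List.map_take]
        congr 1
        ext f
        simp [-List.map_take]
      rw [List.length_map, Nat.sub_eq_zero_of_le hi'.le, List.take_zero, List.append_nil, h2,
        List.getElem_map]
      intro hc
      refine ((isPrime_span_X_image _).mem_or_mem hc).resolve_left (X_notMem_span_X_image ?_)
      intro hmem
      have h3 := List.nodup_iff_injective_getElem.1 (Finset.nodup_toList S.toFinite.toFinset)
      obtain ⟨j, hj, hji⟩ := List.mem_take_iff_getElem.1 hmem
      have := @h3 ⟨j, by omega⟩ ⟨i, hi'⟩ hji
      simp at this
      omega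
    · rw [List.take_of_length_le (by omega), Ideal.ofList_append, hS]
      exact h _ _ c
  have h2 := IsLocalRing.isWeaklyRegular_of_perm_of_subset_maximalIdeal h1
    (List.perm_append_comm) ?_
  · exact ((isWeaklyRegular_append_iff _ _ _).1 h2).1
  · intro r hr
    rw [IsLocalRing.mem_maximalIdeal, mem_nonunits_iff, isUnit_iff_constantCoeff]
    rw [List.mem_append] at hr
    obtain hr | hr := hr
    · obtain ⟨s, _, rfl⟩ := List.mem_map.1 hr
      simp
    · simp [hrs r hr]

end Variables

theorem mem_sup_span_prod_of_forall_mem {R ι : Type*} [CommRing R] {Q : Ideal R} {x : ι → R}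
    (s : Finset ι)
    (h : ∀ i ∈ s, ∀ l ∈ s, i ≠ l → ∀ u, x l * u ∈ Q ⊔ Ideal.span {x i} → u ∈ Q ⊔ Ideal.span {x i})
    {f : R} (hf : ∀ i ∈ s, f ∈ Q ⊔ Ideal.span {x i}) : f ∈ Q ⊔ Ideal.span {∏ i ∈ s, x i} := by
  classical
  induction s using Finset.induction_on with
  | empty => simp
  | insert t s ht ih =>
    have h1 := ih (fun i hi l hl => h i (Finset.mem_insert_of_mem hi) l (Finset.mem_insert_of_mem hl))
      fun i hi => hf i (Finset.mem_insert_of_mem hi)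
    obtain ⟨q, hq, c, hc, rfl⟩ := Submodule.mem_sup.1 h1
    obtain ⟨c, rfl⟩ := Ideal.mem_span_singleton'.1 hc
    have h2 : (∏ i ∈ s, x i) * c ∈ Q ⊔ Ideal.span {x t} := by
      have := sub_mem (hf t (Finset.mem_insert_self _ _)) (Ideal.mem_sup_left hq)
      rwa [add_sub_cancel_left, mul_comm] at this
    have h3 : ∀ s' ⊆ s, (∏ i ∈ s', x i) * c ∈ Q ⊔ Ideal.span {x t} → c ∈ Q ⊔ Ideal.span {x t} := by
      intro s'
      induction s' using Finset.induction_on with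
      | empty => simp
      | insert l s' hl ih' =>
        intro hs' hc
        rw [Finset.prod_insert hl, mul_assoc] at hc
        have hls : l ∈ s := hs' (Finset.mem_insert_self _ _)
        exact ih' ((Finset.subset_insert _ _).trans hs') (h t (Finset.mem_insert_self _ _) l
          (Finset.mem_insert_of_mem hls) (fun e => ht (e ▸ hls)) _ hc)
    obtain ⟨q', hq', c', hc', rfl⟩ := Submodule.mem_sup.1 (h3 s subset_rfl h2)
    obtain ⟨c', rfl⟩ := Ideal.mem_span_singleton'.1 hc'
    rw [add_mul, ← add_assoc, Finset.prod_insert ht, mul_assoc]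
    exact Submodule.add_mem_sup (add_mem hq (Ideal.mul_mem_right _ _ hq'))
      (Ideal.mul_mem_left _ _ (Ideal.mem_span_singleton_self _))

theorem sup_span_singleton_eq_of_sub_mem {R : Type*} [CommRing R] {Q : Ideal R} {x y ε : R}
    (hε : IsUnit ε) (h : x - ε * y ∈ Q) : Q ⊔ Ideal.span {x} = Q ⊔ Ideal.span {y} := by
  rw [← Ideal.span_singleton_mul_left_unit hε y]
  apply le_antisymm
  · refine sup_le le_sup_left ((Ideal.span_singleton_le_iff_mem _).2 ?_)
    rw [← sub_add_cancel x (ε * y)]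
    exact Submodule.add_mem_sup h (Ideal.mem_span_singleton_self _)
  · refine sup_le le_sup_left ((Ideal.span_singleton_le_iff_mem _).2 ?_)
    rw [← sub_sub_cancel x (ε * y)]
    exact sub_mem (Ideal.mem_sup_right (Ideal.mem_span_singleton_self _)) (Ideal.mem_sup_left h)

theorem sup_span_singleton_le_of_dvd {R : Type*} [CommRing R] {Q : Ideal R} {x y : R}
    (h : x ∣ y) : Q ⊔ Ideal.span {y} ≤ Q ⊔ Ideal.span {x} :=
  sup_le_sup le_rfl (Ideal.span_singleton_le_span_singleton.2 h)

section RegularModVariables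

open MvPowerSeries

variable {σ k ι : Type*} [Field k]

theorem span_X_image_insert (S : Set σ) (s : σ) :
    Ideal.span (X (R := k) '' insert s S) = Ideal.span (X '' S) ⊔ Ideal.span {X s} := by
  rw [Set.image_insert_eq, Ideal.span_insert, sup_comm]

variable [Finite σ] [Fintype ι]

theorem mem_span_X_sup_span_prod_iff {S : Set σ} {a : ι → σ} (ha : a.Injective)
    (haS : ∀ i, a i ∉ S) {f : MvPowerSeries σ k} :
    f ∈ Ideal.span (X '' S) ⊔ Ideal.span {∏ i, X (a i)} ↔
      ∀ i, f ∈ Ideal.span (X '' insert (a i) S) := by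
  constructor
  · intro hf i
    rw [span_X_image_insert]
    exact sup_span_singleton_le_of_dvd
      (Finset.dvd_prod_of_mem (fun i => X (a i)) (Finset.mem_univ i)) hf
  · intro hf
    refine mem_sup_span_prod_of_forall_mem (x := fun i => X (a i)) Finset.univ ?_ ?_
    · intro i _ l _ hil u hu
      rw [← span_X_image_insert] at hu ⊢
      refine ((isPrime_span_X_image _).mem_or_mem hu).resolve_left (X_notMem_span_X_image ?_)
      rintro (h | h)
      exacts [hil (ha h).symm, haS l h]
    · intro i _
      rw [← span_X_image_insert]
      exact hf i

theorem mem_span_X_sup_span_prod_sup_span_prod_iff {S : Set σ} {a b : ι → σ} (ha : a.Injective)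
    (hb : b.Injective) (haS : ∀ i, a i ∉ S) (hbS : ∀ j, b j ∉ S) (hab : ∀ i j, a i ≠ b j)
    {f : MvPowerSeries σ k} :
    f ∈ Ideal.span (X '' S) ⊔ Ideal.span {∏ i, X (a i)} ⊔ Ideal.span {∏ j, X (b j)} ↔
      ∀ i j, f ∈ Ideal.span (X '' insert (a i) (insert (b j) S)) := by
  have key : ∀ j (f : MvPowerSeries σ k),
      f ∈ Ideal.span (X '' S) ⊔ Ideal.span {∏ i, X (a i)} ⊔ Ideal.span {X (b j)} ↔
      ∀ i, f ∈ Ideal.span (X '' insert (a i) (insert (b j) S)) := by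
    intro j f
    rw [sup_right_comm, ← span_X_image_insert, mem_span_X_sup_span_prod_iff ha]
    rintro i (h | h)
    exacts [hab i j h, haS i h]
  constructor
  · intro hf i j
    exact (key j f).1 (sup_span_singleton_le_of_dvd
      (Finset.dvd_prod_of_mem (fun j => X (b j)) (Finset.mem_univ j)) hf) i
  · intro hf
    refine mem_sup_span_prod_of_forall_mem (x := fun j => X (b j)) Finset.univ ?_
      fun j _ => (key j f).2 fun i => hf i j
    intro j _ l _ hjl u hu
    rw [key] at hu ⊢
    intro i
    refine ((isPrime_span_X_image _).mem_or_mem (hu i)).resolve_left (X_notMem_span_X_image ?_)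
    rintro (h | h | h)
    exacts [hab i l h.symm, hjl (hb h).symm, hbS l h]

/-- Two power series which are, modulo some of the variables, products of disjoint sets of the
remaining variables form a regular sequence, which is extended by an element of any ideal not
contained in the minimal primes of the sequence modulo these variables. -/
theorem exists_regular_of_sub_prod_mem [Nonempty ι] {S : Set σ} {a b : ι → σ} (ha : a.Injective)
    (hb : b.Injective) (haS : ∀ i, a i ∉ S) (hbS : ∀ j, b j ∉ S) (hab : ∀ i j, a i ≠ b j)
    {x y ε δ : MvPowerSeries σ k} (hε : IsUnit ε) (hδ : IsUnit δ)
    (hx : x - ε * ∏ i, X (a i) ∈ Ideal.span (X '' S))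
    (hy : y - δ * ∏ j, X (b j) ∈ Ideal.span (X '' S)) {K : Ideal (MvPowerSeries σ k)}
    (hK : ∀ i j, ¬ K ≤ Ideal.span (X '' insert (a i) (insert (b j) S))) :
    x ≠ 0 ∧ y ≠ 0 ∧ (∀ c, x ∣ y * c → x ∣ c) ∧
      ∃ θ ∈ K, ∀ c, θ * c ∈ Ideal.span {x, y} → c ∈ Ideal.span {x, y} := by
  have hVx := sup_span_singleton_eq_of_sub_mem hε hx
  have hVxy : Ideal.span (X '' S) ⊔ Ideal.span {x} ⊔ Ideal.span {y} =
      Ideal.span (X '' S) ⊔ Ideal.span {∏ i, X (a i)} ⊔ Ideal.span {∏ j, X (b j)} := by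
    rw [hVx]
    exact sup_span_singleton_eq_of_sub_mem hδ (Ideal.mem_sup_left hy)
  have hSker : Ideal.span (X '' S) ≤ RingHom.ker (constantCoeff (σ := σ) (R := k)) := by
    rw [Ideal.span_le]
    rintro _ ⟨s, _, rfl⟩
    simp [RingHom.mem_ker]
  have hprod : ∀ a : ι → σ, constantCoeff (σ := σ) (R := k) (∏ i, X (a i)) = 0 := by
    intro a
    rw [map_prod]
    exact Finset.prod_eq_zero (Finset.mem_univ (Classical.arbitrary ι)) (constantCoeff_X _)
  have hconst : ∀ {z η : MvPowerSeries σ k} {a : ι → σ},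
      z - η * ∏ i, X (a i) ∈ Ideal.span (X '' S) → constantCoeff z = 0 := by
    intro z η a hz
    simpa [hprod] using RingHom.mem_ker.1 (hSker hz)
  have hx0 := hconst hx
  have hy0 := hconst hy
  have hprodmem : ∀ {a : ι → σ} {T : Set σ}, (∀ i, a i ∉ T) →
      ∏ i, X (a i) ∉ Ideal.span (X (R := k) '' T) := by
    intro a T haT h
    obtain ⟨i, _, hi⟩ := (isPrime_span_X_image T).prod_mem_iff.1 h
    exact X_notMem_span_X_image (haT i) hi
  have hnot : ∀ {z η : MvPowerSeries σ k} {a : ι → σ} {T : Set σ}, IsUnit η → S ⊆ T →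
      z - η * ∏ i, X (a i) ∈ Ideal.span (X '' S) → (∀ i, a i ∉ T) →
      z ∉ Ideal.span (X '' T) := by
    intro z η a T hη hST hz haT h
    have h1 := sub_mem h (Ideal.span_mono (Set.image_mono hST) hz)
    rw [sub_sub_cancel, Ideal.unit_mul_mem_iff_mem _ hη] at h1
    exact hprodmem haT h1
  have hreg0 : ∀ c, x * c ∈ Ideal.span (X '' S) → c ∈ Ideal.span (X '' S) := fun c hc =>
    ((isPrime_span_X_image _).mem_or_mem hc).resolve_left (hnot hε subset_rfl hx haS)
  have hreg1 : ∀ c, y * c ∈ Ideal.span (X '' S) ⊔ Ideal.span {x} →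
      c ∈ Ideal.span (X '' S) ⊔ Ideal.span {x} := by
    intro c
    rw [hVx, mem_span_X_sup_span_prod_iff ha haS, mem_span_X_sup_span_prod_iff ha haS]
    intro hc i
    refine ((isPrime_span_X_image _).mem_or_mem (hc i)).resolve_left
      (hnot hδ (Set.subset_insert _ _) hy ?_)
    rintro j (h | h)
    exacts [hab i j h.symm, hbS j h]
  obtain ⟨θ, hθK, hθ⟩ : ∃ θ ∈ K, ∀ i j,
      θ ∉ Ideal.span (X '' insert (a i) (insert (b j) S)) := by
    by_contra! hcon
    have h1 : (K : Set (MvPowerSeries σ k)) ⊆ ⋃ ij ∈ ((Finset.univ : Finset (ι × ι)) : Set (ι × ι)),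
        (Ideal.span (X (R := k) '' insert (a ij.1) (insert (b ij.2) S)) :
          Set (MvPowerSeries σ k)) := by
      intro f hf
      obtain ⟨i, j, hij⟩ := hcon f hf
      exact Set.mem_iUnion₂.2 ⟨(i, j), by simp, hij⟩
    obtain ⟨ij, _, hij⟩ := (Ideal.subset_union_prime (Classical.arbitrary (ι × ι))
      (Classical.arbitrary (ι × ι)) fun _ _ _ _ => isPrime_span_X_image _).1 h1
    exact hK _ _ hij
  have hreg2 : ∀ c, θ * c ∈ Ideal.span (X '' S) ⊔ Ideal.span {x} ⊔ Ideal.span {y} →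
      c ∈ Ideal.span (X '' S) ⊔ Ideal.span {x} ⊔ Ideal.span {y} := by
    intro c
    rw [hVxy, mem_span_X_sup_span_prod_sup_span_prod_iff ha hb haS hbS hab,
      mem_span_X_sup_span_prod_sup_span_prod_iff ha hb haS hbS hab]
    intro hc i j
    exact ((isPrime_span_X_image _).mem_or_mem (hc i j)).resolve_left (hθ i j)
  have h01 := (isWeaklyRegular_self_iff _).1 (isWeaklyRegular_of_regular_mod_variables S [x, y]
    (by simp [hx0, hy0]) (by
      intro i hi c
      match i, hi with
      | 0, _ => simpa using hreg0 c
      | 1, _ => simpa using hreg1 c))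
  have hxc : ∀ c, x * c = 0 → c = 0 := fun c => by simpa using h01 0 (by simp) c
  have hyc : ∀ c, x ∣ y * c → x ∣ c := fun c => by
    simpa [Ideal.mem_span_singleton] using h01 1 (by simp) c
  refine ⟨fun h => one_ne_zero (hxc 1 (by simp [h])), fun h => ?_, hyc, θ, hθK, ?_⟩
  · have := map_dvd (constantCoeff (σ := σ) (R := k)) (hyc 1 (by simp [h]))
    simp [hx0] at this
  · by_cases hu : constantCoeff θ = 0
    · have h012 := (isWeaklyRegular_self_iff _).1 (isWeaklyRegular_of_regular_mod_variables S
        [x, y, θ] (by simp [hx0, hy0, hu]) (by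
          intro i hi c
          match i, hi with
          | 0, _ => simpa using hreg0 c
          | 1, _ => simpa using hreg1 c
          | 2, _ => simpa [sup_assoc] using hreg2 c))
      intro c
      simpa [Ideal.span_insert] using h012 2 (by simp) c
    · intro c hc
      have hθu : IsUnit θ := isUnit_iff_constantCoeff.2 (isUnit_iff_ne_zero.2 hu)
      exact (Ideal.unit_mul_mem_iff_mem _ hθu).1 hc

end RegularModVariables

section DetModIdeal

variable {R : Type*} [CommRing R] {n : ℕ} {J : Ideal R}

theorem det_sub_prod_diag_mem_of_upper {N : Matrix (Fin n) (Fin n) R}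
    (h : ∀ r c, c < r → N r c ∈ J) : N.det - ∏ i, N i i ∈ J := by
  rw [← Ideal.Quotient.eq, RingHom.map_det, map_prod, Matrix.det_of_isUpperTriangular]
  · rfl
  · intro r c hrc
    exact Ideal.Quotient.eq_zero_iff_mem.2 (h r c hrc)

theorem det_sub_prod_diag_mem_of_lower {N : Matrix (Fin n) (Fin n) R}
    (h : ∀ r c, r < c → N r c ∈ J) : N.det - ∏ i, N i i ∈ J := by
  rw [← Matrix.det_transpose]
  exact det_sub_prod_diag_mem_of_upper (N := N.transpose) fun r c hrc => h c r hrc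

theorem det_notMem_of_perm [hJ : J.IsPrime] {N : Matrix (Fin n) (Fin n) R}
    (π : Equiv.Perm (Fin n)) (h : ∀ r c, c ≠ π r → N r c ∈ J) (hπ : ∀ r, N r (π r) ∉ J) :
    N.det ∉ J := by
  intro hN
  have h1 : (N.submatrix id π).det - ∏ i, N i (π i) ∈ J :=
    det_sub_prod_diag_mem_of_upper (N := N.submatrix id π) fun r c hrc =>
      h r (π c) fun e => hrc.ne (π.injective e)
  rw [Matrix.det_permute'] at h1
  have h2 := sub_mem (Ideal.mul_mem_left J (Equiv.Perm.sign π : R) hN) h1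
  rw [sub_sub_cancel] at h2
  obtain ⟨r, _, hr⟩ := hJ.prod_mem_iff.1 h2
  exact hπ r hr

end DetModIdeal

section GenericMatrix

open MvPowerSeries

variable (k : Type) [Field k] (m : ℕ)

/-- The generic `(m + 2) × (m + 1)` matrix. -/
noncomputable def genericMatrix :
    Matrix (Fin (m + 2)) (Fin (m + 1)) (MvPowerSeries (Fin (m + 2) × Fin (m + 1)) k) :=
  Matrix.of fun i j => X (i, j)

variable {m} in
theorem det_genericMatrix_submatrix_notMem {n : ℕ} {f : Fin n → Fin (m + 2)}
    {g : Fin n → Fin (m + 1)} (hf : f.Injective) (hg : g.Injective) (π : Equiv.Perm (Fin n))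
    {U : Set (Fin (m + 2) × Fin (m + 1))} (hU : ∀ r, (f r, g (π r)) ∉ U) :
    ((genericMatrix k m).submatrix f g).det ∉ Ideal.span (X '' U) := by
  have hsub : U ⊆ (Set.range fun r => (f r, g (π r)))ᶜ := by
    rintro s hs ⟨r, rfl⟩
    exact hU r hs
  refine fun h => det_notMem_of_perm (hJ := isPrime_span_X_image _) π ?_ ?_
    (Ideal.span_mono (Set.image_mono hsub) h)
  · intro r c hc
    refine Ideal.subset_span ⟨(f r, g c), ?_, rfl⟩
    rintro ⟨r', hr'⟩
    obtain ⟨h1, h2⟩ := Prod.mk.inj hr'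
    exact hc (by rw [← hf h1, hg h2])
  · intro r
    exact X_notMem_span_X_image fun h => h ⟨r, rfl⟩

/-- The row containing the off-diagonal band entry of the `c`-th column of an
`(m + 2) × (m + 1)` matrix: the last row for `c = 0`, and the row `c - 1` otherwise. -/
def bandRow (c : Fin (m + 1)) : Fin (m + 2) :=
  ⟨if (c : ℕ) = 0 then m + 1 else c - 1, by split_ifs <;> omega⟩

theorem val_bandRow (c : Fin (m + 1)) :
    (bandRow m c : ℕ) = if (c : ℕ) = 0 then m + 1 else c - 1 := rfl

/-- The positions outside of the main diagonal and the cyclic superdiagonal. -/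
def offBand : Set (Fin (m + 2) × Fin (m + 1)) :=
  {s | s.1 ≠ s.2.castSucc ∧ s.1 ≠ bandRow m s.2}

theorem minorLast_genericMatrix_sub_mem :
    minorLast (genericMatrix k m) - (-1) ^ m * ∏ c : Fin (m + 1), X (c.castSucc, c) ∈
      Ideal.span (X '' offBand m) := by
  rw [minorLast, ← mul_sub, Fin.succAbove_last]
  refine Ideal.mul_mem_left _ _ (det_sub_prod_diag_mem_of_upper
    (N := (genericMatrix k m).submatrix Fin.castSucc id) fun r c hrc => ?_)
  refine Ideal.subset_span ⟨(r.castSucc, c), ?_, rfl⟩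
  simp only [offBand, bandRow, Set.mem_ofPred_eq, Fin.ext_iff, Fin.val_castSucc, ne_eq]
  rw [Fin.lt_def] at hrc
  split_ifs <;> omega

theorem val_succAbove_eq_ite {n : ℕ} (i : Fin (n + 1)) (r : Fin n) :
    (i.succAbove r : ℕ) = if (r : ℕ) < i then (r : ℕ) else r + 1 := by
  simp only [Fin.succAbove, Fin.lt_def, Fin.val_castSucc]
  split_ifs <;> rfl

theorem bandRow_finRotate (r : Fin (m + 1)) :
    bandRow m (finRotate (m + 1) r) = (Fin.last m).castSucc.succAbove r := by
  have h1 := val_bandRow m (finRotate (m + 1) r)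
  have h2 := val_succAbove_eq_ite (Fin.last m).castSucc r
  have h3 : (finRotate (m + 1) r : ℕ) = if r = Fin.last m then (0 : ℕ) else r + 1 :=
    coe_finRotate r
  simp only [Fin.ext_iff, Fin.val_castSucc, Fin.val_last] at h2 h3 ⊢
  split_ifs at h1 h2 h3 <;> omega

theorem minorPenult_genericMatrix_sub_mem :
    minorPenult (genericMatrix k m) -
        (-1) ^ m * (Equiv.Perm.sign (finRotate (m + 1)) : MvPowerSeries _ k) *
          ∏ c : Fin (m + 1), X (bandRow m c, c) ∈
      Ideal.span (X '' offBand m) := by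
  have h : (genericMatrix k m).submatrix (Fin.last m).castSucc.succAbove id =
      ((genericMatrix k m).submatrix (bandRow m) id).submatrix (finRotate (m + 1)) id :=
    Matrix.ext fun r c => by simp only [Matrix.submatrix_apply, bandRow_finRotate, id]
  rw [minorPenult, h, Matrix.det_permute, mul_assoc, ← mul_sub, ← mul_sub]
  refine Ideal.mul_mem_left _ _ (Ideal.mul_mem_left _ _ (det_sub_prod_diag_mem_of_lower
    (N := (genericMatrix k m).submatrix (bandRow m) id) fun r c hrc => ?_))
  refine Ideal.subset_span ⟨(bandRow m r, c), ?_, rfl⟩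
  simp only [offBand, bandRow, Set.mem_ofPred_eq, Fin.ext_iff, Fin.val_castSucc, ne_eq]
  rw [Fin.lt_def] at hrc
  split_ifs <;> omega

theorem bandRow_ne_castSucc (c : Fin (m + 1)) : bandRow m c ≠ c.castSucc := by
  simp only [bandRow, ne_eq, Fin.ext_iff, Fin.val_castSucc]
  split_ifs <;> omega

theorem det_genericMatrix_top_notMem {i j : Fin (m + 1)} (hji : j ≤ i) :
    ((genericMatrix k m).submatrix (Fin.castAdd 2) i.succAbove).det ∉
      Ideal.span (X '' insert (i.castSucc, i) (insert (bandRow m j, j) (offBand m))) := by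
  refine det_genericMatrix_submatrix_notMem k (Fin.castAdd_injective _ _)
    Fin.succAbove_right_injective 1 fun r => ?_
  have h1 := val_bandRow m (i.succAbove r)
  have h2 := val_bandRow m j
  have h3 := val_succAbove_eq_ite i r
  have hr := r.isLt
  rw [Fin.le_def] at hji
  simp only [Set.mem_insert_iff, offBand, Set.mem_ofPred_eq, Fin.ext_iff, Prod.ext_iff,
    Fin.val_castSucc, ne_eq, Equiv.Perm.one_apply, Fin.val_castAdd]
  split_ifs at h1 h2 h3 <;> omega

theorem det_genericMatrix_max_notMem {i j : Fin (m + 1)} (hij : i < j) :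
    ((genericMatrix k m).submatrix i.castSucc.succAbove id).det ∉
      Ideal.span (X '' insert (i.castSucc, i) (insert (bandRow m j, j) (offBand m))) := by
  refine det_genericMatrix_submatrix_notMem k Fin.succAbove_right_injective
    Function.injective_id (finRotate (m + 1)) fun r => ?_
  have h1 := val_bandRow m (finRotate (m + 1) r)
  have h2 := val_bandRow m j
  have h3 := val_succAbove_eq_ite i.castSucc r
  have h4 : (finRotate (m + 1) r : ℕ) = if r = Fin.last m then (0 : ℕ) else r + 1 :=
    coe_finRotate r
  rw [Fin.lt_def] at hij
  simp only [Set.mem_insert_iff, offBand, Set.mem_ofPred_eq, Fin.ext_iff, Prod.ext_iff,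
    Fin.val_castSucc, ne_eq, id, Fin.val_last] at h3 h4 ⊢
  split_ifs at h1 h2 h3 h4 <;> omega

theorem span_signedMaxMinor_genericMatrix :
    Ideal.span (Set.range (signedMaxMinor (genericMatrix k m))) = Imax k m := by
  apply le_antisymm <;> refine Ideal.span_le.2 ?_
  · rintro _ ⟨i, rfl⟩
    exact Ideal.mul_mem_left _ _ (Ideal.subset_span ⟨i, rfl⟩)
  · rintro _ ⟨i, rfl⟩
    refine (Ideal.unit_mul_mem_iff_mem _ ((isUnit_one.neg).pow (i : ℕ))).1 ?_
    exact Ideal.subset_span ⟨i, rfl⟩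

theorem span_signedTopMinor_genericMatrix :
    Ideal.span (Set.range (signedTopMinor (genericMatrix k m))) = Psub k m := by
  apply le_antisymm <;> refine Ideal.span_le.2 ?_
  · rintro _ ⟨i, rfl⟩
    exact Ideal.mul_mem_left _ _ (Ideal.subset_span ⟨i, rfl⟩)
  · rintro _ ⟨i, rfl⟩
    refine (Ideal.unit_mul_mem_iff_mem _ ((isUnit_one.neg).pow (i : ℕ))).1 ?_
    exact Ideal.subset_span ⟨i, rfl⟩

theorem not_Omeg_le_span_X (i j : Fin (m + 1)) :
    ¬ Omeg k m ≤
      Ideal.span (X '' insert (i.castSucc, i) (insert (bandRow m j, j) (offBand m))) := by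
  intro h
  obtain hji | hij := le_or_gt j i
  · exact det_genericMatrix_top_notMem k m hji
      (h (Ideal.mem_sup_right (Ideal.subset_span ⟨i, rfl⟩)))
  · exact det_genericMatrix_max_notMem k m hij
      (h (Ideal.mem_sup_left (Ideal.subset_span ⟨i.castSucc, rfl⟩)))

theorem exists_regular_genericMatrix :
    minorLast (genericMatrix k m) ≠ 0 ∧ minorPenult (genericMatrix k m) ≠ 0 ∧
      (∀ c, minorLast (genericMatrix k m) ∣ minorPenult (genericMatrix k m) * c →
        minorLast (genericMatrix k m) ∣ c) ∧
      ∃ θ ∈ Omeg k m, ∀ c,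
        θ * c ∈ Ideal.span {minorLast (genericMatrix k m), minorPenult (genericMatrix k m)} →
          c ∈ Ideal.span {minorLast (genericMatrix k m), minorPenult (genericMatrix k m)} := by
  have hsign : IsUnit (Equiv.Perm.sign (finRotate (m + 1)) :
      MvPowerSeries (Fin (m + 2) × Fin (m + 1)) k) :=
    (Equiv.Perm.sign (finRotate (m + 1))).isUnit.map (Int.castRingHom _)
  have hneg : IsUnit ((-1 : MvPowerSeries (Fin (m + 2) × Fin (m + 1)) k) ^ m) :=
    (isUnit_one.neg).pow m
  have ha : Function.Injective fun c : Fin (m + 1) => (c.castSucc, c) :=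
    fun c d h => congrArg Prod.snd h
  have hb : Function.Injective fun c : Fin (m + 1) => (bandRow m c, c) :=
    fun c d h => congrArg Prod.snd h
  have haS : ∀ c : Fin (m + 1), (c.castSucc, c) ∉ offBand m := fun c h => h.1 rfl
  have hbS : ∀ c : Fin (m + 1), (bandRow m c, c) ∉ offBand m := fun c h => h.2 rfl
  have hab : ∀ c d : Fin (m + 1), (c.castSucc, c) ≠ (bandRow m d, d) := by
    intro c d h
    obtain ⟨h1, rfl⟩ := Prod.mk.inj h
    exact bandRow_ne_castSucc m _ h1.symm
  have hx := minorLast_genericMatrix_sub_mem k m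
  have hy := minorPenult_genericMatrix_sub_mem k m
  generalize minorLast (genericMatrix k m) = x at hx ⊢
  generalize minorPenult (genericMatrix k m) = y at hy ⊢
  exact exists_regular_of_sub_prod_mem ha hb haS hbS hab hneg (hneg.mul hsign) hx hy
    (not_Omeg_le_span_X k m)

end GenericMatrix

/-- For every `n ≥ 2` (here `n = m + 2`), with `I = I_{n-1}(X)` and `Ω = I + I_{n-2}(X')`,
one has `(I^{[p]} : I) ∩ (Ω^{[p]} : Ω) = I^{[p]} + ((G_n G_{n-1})^{p-1})`. -/
theorem stmt6 (p : ℕ) (hp : p.Prime) (k : Type) [Field k] [CharP k p] (m : ℕ) :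
    Submodule.colon (frobPow p (Imax k m)) (Imax k m) ⊓
        Submodule.colon (frobPow p (Omeg k m)) (Omeg k m) =
      frobPow p (Imax k m) ⊔
        Ideal.span
          {(Gmin k m (Fin.last (m + 1)) * Gmin k m (Fin.castSucc (Fin.last m))) ^ (p - 1)} := by
  have : CharP (MvPowerSeries (Fin (m + 2) × Fin (m + 1)) k) p :=
    charP_of_injective_ringHom (MvPowerSeries.C_injective (σ := Fin (m + 2) × Fin (m + 1)) (R := k)) p
  have : ExpChar (MvPowerSeries (Fin (m + 2) × Fin (m + 1)) k) p := ExpChar.prime hp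
  have : IsDomain (MvPowerSeries (Fin (m + 2) × Fin (m + 1)) k) := NoZeroDivisors.to_isDomain _
  obtain ⟨hx, hy, hxy, θ, hθ, hreg⟩ := exists_regular_genericMatrix k m
  have h := colon_frobPow_inf_colon_frobPow p hp.ne_zero (genericMatrix k m) hx hy hxy
    (span_signedMaxMinor_genericMatrix k m).symm (span_signedTopMinor_genericMatrix k m).symm hθ hreg
  have hG : minorLast (genericMatrix k m) * minorPenult (genericMatrix k m) =
      Gmin k m (Fin.last (m + 1)) * Gmin k m (Fin.castSucc (Fin.last m)) := by
    have h1 : ((-1 : MvPowerSeries (Fin (m + 2) × Fin (m + 1)) k) ^ m) * (-1) ^ m = 1 := by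
      rw [← mul_pow]; simp
    calc _ = ((-1) ^ m * Gmin k m (Fin.last (m + 1))) *
          ((-1) ^ m * Gmin k m (Fin.castSucc (Fin.last m))) := rfl
      _ = _ := by rw [mul_mul_mul_comm, h1, one_mul]
  rw [hG] at h
  exact h
end
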